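/- Let Ω ⊆ ℂ be a Denjoy domain of hyperbolic type with (−∞, 0) ⊂ Ω, and let F ⊆ (−∞, 0] be a closed set. If the Poincaré metric space (Ω, h_Ω) is not Gromov hyperbolic, then the Poincaré metric space (Ω \ F, h_{Ω\F}) is not Gromov hyperbolic either. -/

import Mathlib

open Set Metric Filter Complex

noncomputable section

/-- The length of a curve `γ : [0,1] → E` with respect to the conformal density `ρ`. -/
def curveLen {E : Type*} [NormedAddCommGroup E] [NormedSpace ℝ E]
    (ρ : E → ℝ) (γ : ℝ → E) : ℝ :=
  ∫ t in (0:ℝ)..1, ρ (γ t) * ‖deriv γ t‖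

/-- The distance induced on the set `S` by the conformal density `ρ`, defined as the infimum
of the `ρ`-lengths of C¹ curves joining the two points inside `S`. -/
def densityDist {E : Type*} [NormedAddCommGroup E] [NormedSpace ℝ E]
    (S : Set E) (ρ : E → ℝ) (z w : E) : ℝ :=
  sInf { L | ∃ γ : ℝ → E, ContDiffOn ℝ 1 γ (Icc 0 1) ∧ γ 0 = z ∧ γ 1 = w ∧
      (∀ t ∈ Icc (0:ℝ) 1, γ t ∈ S) ∧ L = curveLen ρ γ }

/-- The quasihyperbolic density `1/δ_Ω(z)` of a domain `Ω`. -/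
def qhDensity {E : Type*} [NormedAddCommGroup E] [NormedSpace ℝ E] (Ω : Set E) : E → ℝ :=
  fun z => (Metric.infDist z Ωᶜ)⁻¹

/-- The quasihyperbolic distance of a domain `Ω`. -/
def qhDist {E : Type*} [NormedAddCommGroup E] [NormedSpace ℝ E] (Ω : Set E) : E → E → ℝ :=
  densityDist Ω (qhDensity Ω)

/-- `lam` is the density of the Poincaré (hyperbolic) metric of the plane domain `Ω`:
it is the pushforward of the density `2/(1-|z|²)` of the unit disk under a holomorphic
universal covering map `p : 𝔻 → Ω`. -/
def IsPoincareDensity (Ω : Set ℂ) (lam : ℂ → ℝ) : Prop :=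
  ∃ p : ℂ → ℂ,
    (∀ z ∈ ball (0:ℂ) 1, DifferentiableAt ℂ p z) ∧
    p '' ball (0:ℂ) 1 = Ω ∧
    IsCoveringMapOn (fun z : ball (0:ℂ) 1 => p z) Ω ∧
    ∀ z ∈ ball (0:ℂ) 1, lam (p z) * ‖deriv p z‖ = 2 / (1 - ‖z‖ ^ 2)

/-- `g` is a geodesic in `(S, d)` from `x` to `y`, parametrized by arclength on
`[0, d x y]`. -/
def IsGeodesicIn {α : Type*} (S : Set α) (d : α → α → ℝ) (g : ℝ → α) (x y : α) : Prop :=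
  g 0 = x ∧ g (d x y) = y ∧ (∀ t ∈ Icc (0:ℝ) (d x y), g t ∈ S) ∧
  ∀ s ∈ Icc (0:ℝ) (d x y), ∀ t ∈ Icc (0:ℝ) (d x y), d (g s) (g t) = |s - t|

/-- Every geodesic triangle of `(S, d)` is `δ`-thin (Rips condition). -/
def GromovHyperbolicWith {α : Type*} (S : Set α) (d : α → α → ℝ) (δ : ℝ) : Prop :=
  ∀ x ∈ S, ∀ y ∈ S, ∀ z ∈ S, ∀ gxy gxz gzy : ℝ → α,
    IsGeodesicIn S d gxy x y → IsGeodesicIn S d gxz x z → IsGeodesicIn S d gzy z y →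
    ∀ t ∈ Icc (0:ℝ) (d x y),
      ∃ p ∈ gxz '' Icc (0:ℝ) (d x z) ∪ gzy '' Icc (0:ℝ) (d z y), d (gxy t) p ≤ δ

/-- `(S, d)` is Gromov hyperbolic: some `δ ≥ 0` works for all geodesic triangles. -/
def IsGromovHyperbolic {α : Type*} (S : Set α) (d : α → α → ℝ) : Prop :=
  ∃ δ : ℝ, 0 ≤ δ ∧ GromovHyperbolicWith S d δ

/-- The real axis inside `ℂ`. -/
def realLine : Set ℂ := {z : ℂ | z.im = 0}

/-- A Denjoy domain: a domain whose boundary is contained in the real axis. -/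
def IsDenjoyDomain (Ω : Set ℂ) : Prop :=
  IsOpen Ω ∧ IsConnected Ω ∧ frontier Ω ⊆ realLine

/-- The distance (for the distance function `d`) from a point to a set. -/
def distToSet {α : Type*} (d : α → α → ℝ) (z : α) (A : Set α) : ℝ :=
  sInf (d z '' A)

/-- A fundamental geodesic: a geodesic of `(S, d)` contained in the closed upper half plane,
joining a point of the boundary interval `I` (on the real axis) to a point of the boundary
interval `J`. -/
def IsFundGeodesic (S : Set ℂ) (d : ℂ → ℂ → ℝ) (I J : Set ℝ) (g : ℝ → ℂ) (x y : ℂ) : Prop :=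
  IsGeodesicIn S d g x y ∧ x.im = 0 ∧ x.re ∈ I ∧ y.im = 0 ∧ y.re ∈ J ∧
  ∀ t ∈ Icc (0:ℝ) (d x y), 0 ≤ (g t).im

end

noncomputable section

open ComplexConjugate Topology

/-! ### The hyperbolic distance of the unit disc -/

/-- The weight `√(1 - |a|²)`. -/
def dw (a : ℂ) : ℝ := √(1 - ‖a‖ ^ 2)

/-- The hyperbolic distance of the unit disc, in closed form. -/
def hd (a b : ℂ) : ℝ := 2 * Real.arsinh (‖a - b‖ / (dw a * dw b))

lemma one_sub_sq_pos {a : ℂ} (ha : a ∈ ball (0:ℂ) 1) : 0 < 1 - ‖a‖ ^ 2 := by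
  have := mem_ball_zero_iff.1 ha
  nlinarith [norm_nonneg a]

lemma dw_pos {a : ℂ} (ha : a ∈ ball (0:ℂ) 1) : 0 < dw a := Real.sqrt_pos.2 (one_sub_sq_pos ha)

lemma dw_sq {a : ℂ} (ha : a ∈ ball (0:ℂ) 1) : dw a ^ 2 = 1 - ‖a‖ ^ 2 :=
  Real.sq_sqrt (one_sub_sq_pos ha).le

lemma dw_nonneg (a : ℂ) : 0 ≤ dw a := Real.sqrt_nonneg _

lemma hd_nonneg (a b : ℂ) : 0 ≤ hd a b :=
  mul_nonneg zero_le_two (Real.arsinh_nonneg_iff.2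
    (div_nonneg (norm_nonneg _) (mul_nonneg (dw_nonneg a) (dw_nonneg b))))

@[simp] lemma hd_self (a : ℂ) : hd a a = 0 := by simp [hd]

lemma hd_comm (a b : ℂ) : hd a b = hd b a := by
  rw [hd, hd, norm_sub_rev, mul_comm (dw a)]

lemma sinh_hd (a b : ℂ) : Real.sinh (hd a b / 2) = ‖a - b‖ / (dw a * dw b) := by
  rw [hd, mul_div_cancel_left₀ _ two_ne_zero, Real.sinh_arsinh]

lemma normSq_one_sub (a b : ℂ) :
    ‖1 - conj a * b‖ ^ 2 = ‖a - b‖ ^ 2 + (1 - ‖a‖ ^ 2) * (1 - ‖b‖ ^ 2) := by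
  simp only [← Complex.normSq_eq_norm_sq, Complex.normSq_apply]
  simp
  ring

lemma cosh_hd {a b : ℂ} (ha : a ∈ ball (0:ℂ) 1) (hb : b ∈ ball (0:ℂ) 1) :
    Real.cosh (hd a b / 2) = ‖1 - conj a * b‖ / (dw a * dw b) := by
  have h1 := dw_pos ha
  have h2 := dw_pos hb
  have : Real.cosh (hd a b / 2) ^ 2 = (‖1 - conj a * b‖ / (dw a * dw b)) ^ 2 := by
    rw [Real.cosh_sq, sinh_hd, div_pow, div_pow, normSq_one_sub, ← dw_sq ha, ← dw_sq hb]
    field_simp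
  exact (pow_left_inj₀ (Real.cosh_pos _).le (by positivity) two_ne_zero).1 this

lemma hd_pos {a b : ℂ} (ha : a ∈ ball (0:ℂ) 1) (hb : b ∈ ball (0:ℂ) 1) (h : a ≠ b) :
    0 < hd a b := by
  have : 0 < ‖a - b‖ / (dw a * dw b) :=
    div_pos (norm_pos_iff.2 (sub_ne_zero.2 h)) (mul_pos (dw_pos ha) (dw_pos hb))
  rw [hd]
  have := Real.arsinh_pos_iff.2 this
  linarith

lemma eq_of_hd_le_zero {a b : ℂ} (ha : a ∈ ball (0:ℂ) 1) (hb : b ∈ ball (0:ℂ) 1)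
    (h : hd a b ≤ 0) : a = b := by
  by_contra hne
  exact absurd (hd_pos ha hb hne) (not_lt.2 h)

lemma hd_triangle {a b c : ℂ} (ha : a ∈ ball (0:ℂ) 1) (hb : b ∈ ball (0:ℂ) 1)
    (hc : c ∈ ball (0:ℂ) 1) : hd a c ≤ hd a b + hd b c := by
  have h1 := dw_pos ha
  have h2 := dw_pos hb
  have h3 := dw_pos hc
  suffices Real.sinh (hd a c / 2) ≤ Real.sinh (hd a b / 2 + hd b c / 2) by
    have := Real.sinh_le_sinh.1 this
    linarith
  rw [Real.sinh_add, sinh_hd, sinh_hd, sinh_hd, cosh_hd ha hb, cosh_hd hb hc]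
  have key : ‖a - c‖ * dw b ^ 2 ≤ ‖a - b‖ * ‖1 - conj b * c‖ + ‖1 - conj a * b‖ * ‖b - c‖ := by
    have e1 : ‖1 - conj a * b‖ = ‖1 - conj b * a‖ := by
      rw [← Complex.norm_conj]; simp [mul_comm]
    rw [e1, ← norm_mul, ← norm_mul]
    have e2 : (a - c) * ((dw b ^ 2 : ℝ) : ℂ)
        = (a - b) * (1 - conj b * c) + (1 - conj b * a) * (b - c) := by
      rw [dw_sq hb, ← Complex.normSq_eq_norm_sq]
      push_cast
      rw [Complex.normSq_eq_conj_mul_self]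
      ring
    have e3 : ‖a - c‖ * dw b ^ 2 = ‖(a - c) * ((dw b ^ 2 : ℝ) : ℂ)‖ := by
      rw [norm_mul, Complex.norm_real, Real.norm_of_nonneg (by positivity)]
    rw [e3, e2]
    exact norm_add_le _ _
  have : ‖a - c‖ / (dw a * dw c) = ‖a - c‖ * dw b ^ 2 / (dw a * dw c * dw b ^ 2) := by
    field_simp
  rw [this]
  have : ‖a - b‖ / (dw a * dw b) * (‖1 - conj b * c‖ / (dw b * dw c)) +
      ‖1 - conj a * b‖ / (dw a * dw b) * (‖b - c‖ / (dw b * dw c)) =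
      (‖a - b‖ * ‖1 - conj b * c‖ + ‖1 - conj a * b‖ * ‖b - c‖) / (dw a * dw c * dw b ^ 2) := by
    field_simp
  rw [this]
  gcongr

/-- The four-point constant of the disc. -/
def hdK : ℝ := 2 * Real.log 8

lemma hdK_nonneg : 0 ≤ hdK := mul_nonneg zero_le_two (Real.log_nonneg (by norm_num))

lemma hd_four_point {a b c d : ℂ} (ha : a ∈ ball (0:ℂ) 1) (hb : b ∈ ball (0:ℂ) 1)
    (hc : c ∈ ball (0:ℂ) 1) (hd' : d ∈ ball (0:ℂ) 1) :
    hd a c + hd b d ≤ max (hd a b + hd c d) (hd b c + hd a d) + hdK := by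
  have h1 := dw_pos ha
  have h2 := dw_pos hb
  have h3 := dw_pos hc
  have h4 := dw_pos hd'
  have key : Real.cosh (hd a c / 2) * Real.cosh (hd b d / 2) ≤
      Real.sinh (hd a b / 2) * Real.sinh (hd c d / 2) +
      Real.cosh (hd b c / 2) * Real.cosh (hd a d / 2) := by
    rw [cosh_hd ha hc, cosh_hd hb hd', cosh_hd hb hc, cosh_hd ha hd', sinh_hd, sinh_hd]
    have e1 : ‖1 - conj a * c‖ * ‖1 - conj b * d‖ ≤
        ‖a - b‖ * ‖c - d‖ + ‖1 - conj b * c‖ * ‖1 - conj a * d‖ := by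
      have e2 : ‖a - b‖ = ‖conj a - conj b‖ := by
        rw [← Complex.norm_conj, map_sub]
      rw [e2, norm_sub_rev c d, ← norm_mul, ← norm_mul, ← norm_mul]
      have : (1 - conj a * c) * (1 - conj b * d) =
        (conj a - conj b) * (d - c) + (1 - conj b * c) * (1 - conj a * d) := by ring
      rw [this]
      exact norm_add_le _ _
    have e2 : ‖1 - conj a * c‖ / (dw a * dw c) * (‖1 - conj b * d‖ / (dw b * dw d)) =
        (‖1 - conj a * c‖ * ‖1 - conj b * d‖) / (dw a * dw c * dw b * dw d) := by
      field_simp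
    have e3 : ‖a - b‖ / (dw a * dw b) * (‖c - d‖ / (dw c * dw d)) +
        ‖1 - conj b * c‖ / (dw b * dw c) * (‖1 - conj a * d‖ / (dw a * dw d)) =
        (‖a - b‖ * ‖c - d‖ + ‖1 - conj b * c‖ * ‖1 - conj a * d‖) /
          (dw a * dw c * dw b * dw d) := by
      field_simp
    rw [e2, e3]
    gcongr
  have cl : ∀ x : ℝ, Real.exp x / 2 ≤ Real.cosh x := fun x => by
    rw [Real.cosh_eq]; have := Real.exp_pos (-x); linarith
  have cu : ∀ x : ℝ, 0 ≤ x → Real.cosh x ≤ Real.exp x := fun x hx => by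
    rw [Real.cosh_eq]
    have := Real.exp_le_exp.2 (show -x ≤ x by linarith); linarith
  have su : ∀ x : ℝ, 0 ≤ x → Real.sinh x ≤ Real.exp x := fun x hx => by
    rw [Real.sinh_eq]
    have := Real.exp_pos (-x)
    have := Real.exp_pos x; linarith
  have n1 := hd_nonneg a b
  have n2 := hd_nonneg c d
  have n3 := hd_nonneg b c
  have n4 := hd_nonneg a d
  set M := max (hd a b + hd c d) (hd b c + hd a d)
  have m1 : hd a b + hd c d ≤ M := le_max_left _ _
  have m2 : hd b c + hd a d ≤ M := le_max_right _ _
  have l1 : Real.exp ((hd a c + hd b d) / 2) / 4 ≤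
      Real.cosh (hd a c / 2) * Real.cosh (hd b d / 2) := by
    have : Real.exp ((hd a c + hd b d) / 2) / 4 =
        (Real.exp (hd a c / 2) / 2) * (Real.exp (hd b d / 2) / 2) := by
      rw [add_div, Real.exp_add]; ring
    rw [this]
    exact mul_le_mul (cl _) (cl _) (by positivity) (Real.cosh_pos _).le
  have l2 : Real.sinh (hd a b / 2) * Real.sinh (hd c d / 2) ≤ Real.exp (M / 2) := by
    calc _ ≤ Real.exp (hd a b / 2) * Real.exp (hd c d / 2) :=
          mul_le_mul (su _ (by linarith)) (su _ (by linarith))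
            (Real.sinh_nonneg_iff.2 (by linarith)) (Real.exp_pos _).le
      _ = Real.exp ((hd a b + hd c d) / 2) := by rw [add_div, Real.exp_add]
      _ ≤ _ := Real.exp_le_exp.2 (by linarith)
  have l3 : Real.cosh (hd b c / 2) * Real.cosh (hd a d / 2) ≤ Real.exp (M / 2) := by
    calc _ ≤ Real.exp (hd b c / 2) * Real.exp (hd a d / 2) :=
          mul_le_mul (cu _ (by linarith)) (cu _ (by linarith))
            (Real.cosh_pos _).le (Real.exp_pos _).le
      _ = Real.exp ((hd b c + hd a d) / 2) := by rw [add_div, Real.exp_add]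
      _ ≤ _ := Real.exp_le_exp.2 (by linarith)
  have l4 : Real.exp ((hd a c + hd b d) / 2) ≤ Real.exp (M / 2 + Real.log 8) := by
    rw [Real.exp_add (M / 2), Real.exp_log (by norm_num)]
    linarith
  have := Real.exp_le_exp.1 l4
  rw [hdK]
  linarith

/-! ### Möbius transformations -/

/-- The disc automorphism sending `0` to `a`. -/
def mob (a z : ℂ) : ℂ := (z + a) / (1 + conj a * z)

lemma mob_den_ne {a z : ℂ} (ha : a ∈ ball (0:ℂ) 1) (hz : z ∈ ball (0:ℂ) 1) :
    1 + conj a * z ≠ 0 := by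
  intro h
  have h1 : conj a * z = -1 := by linear_combination h
  have h2 : ‖a‖ * ‖z‖ = 1 := by
    rw [← Complex.norm_conj a, ← norm_mul, h1]; simp
  have := mem_ball_zero_iff.1 ha
  have := mem_ball_zero_iff.1 hz
  nlinarith [norm_nonneg a, norm_nonneg z]

lemma one_sub_mob {a z : ℂ} (ha : a ∈ ball (0:ℂ) 1) (hz : z ∈ ball (0:ℂ) 1) :
    1 - ‖mob a z‖ ^ 2 = (1 - ‖a‖ ^ 2) * (1 - ‖z‖ ^ 2) / ‖1 + conj a * z‖ ^ 2 := by
  have h := norm_pos_iff.2 (mob_den_ne ha hz)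
  rw [mob, norm_div, div_pow, eq_div_iff (by positivity), sub_mul,
    div_mul_cancel₀ _ (by positivity)]
  have := normSq_one_sub (-a) z
  simp only [map_neg, norm_neg] at this
  have e : ‖-a - z‖ = ‖z + a‖ := by rw [← norm_neg]; congr 1; ring
  rw [e] at this
  have e' : (1:ℂ) - -conj a * z = 1 + conj a * z := by ring
  rw [e'] at this
  linarith

lemma mob_mem {a z : ℂ} (ha : a ∈ ball (0:ℂ) 1) (hz : z ∈ ball (0:ℂ) 1) :
    mob a z ∈ ball (0:ℂ) 1 := by
  have h := norm_pos_iff.2 (mob_den_ne ha hz)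
  have h1 := one_sub_mob ha hz
  have h2 : 0 < (1 - ‖a‖ ^ 2) * (1 - ‖z‖ ^ 2) / ‖1 + conj a * z‖ ^ 2 :=
    div_pos (mul_pos (one_sub_sq_pos ha) (one_sub_sq_pos hz)) (by positivity)
  rw [mem_ball_zero_iff]
  nlinarith [norm_nonneg (mob a z)]

lemma neg_mem_disc {a : ℂ} (ha : a ∈ ball (0:ℂ) 1) : -a ∈ ball (0:ℂ) 1 := by simpa using ha

@[simp] lemma mob_zero (a : ℂ) : mob a 0 = a := by simp [mob]

@[simp] lemma mob_neg_self (a : ℂ) : mob (-a) a = 0 := by simp [mob]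

lemma mob_neg_mob {a z : ℂ} (ha : a ∈ ball (0:ℂ) 1) (hz : z ∈ ball (0:ℂ) 1) :
    mob (-a) (mob a z) = z := by
  have h1 := mob_den_ne ha hz
  have h2 := mob_den_ne (neg_mem_disc ha) (mob_mem ha hz)
  rw [mob, div_eq_iff h2, mob]
  have e : (z + a) / (1 + conj a * z) * (1 + conj a * z) = z + a := div_mul_cancel₀ _ h1
  generalize (z + a) / (1 + conj a * z) = m at e
  rw [map_neg]
  linear_combination e

lemma mob_mob_neg {a z : ℂ} (ha : a ∈ ball (0:ℂ) 1) (hz : z ∈ ball (0:ℂ) 1) :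
    mob a (mob (-a) z) = z := by
  have := mob_neg_mob (neg_mem_disc ha) hz
  rwa [neg_neg] at this

lemma hd_mob {a z w : ℂ} (ha : a ∈ ball (0:ℂ) 1) (hz : z ∈ ball (0:ℂ) 1)
    (hw : w ∈ ball (0:ℂ) 1) : hd (mob a z) (mob a w) = hd z w := by
  have h1 := mob_den_ne ha hz
  have h2 := mob_den_ne ha hw
  have n1 := norm_pos_iff.2 h1
  have n2 := norm_pos_iff.2 h2
  have dwm : ∀ {z : ℂ}, z ∈ ball (0:ℂ) 1 → dw (mob a z) = dw a * dw z / ‖1 + conj a * z‖ := by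
    intro z hz
    have := norm_pos_iff.2 (mob_den_ne ha hz)
    rw [dw, one_sub_mob ha hz, Real.sqrt_div (mul_pos (one_sub_sq_pos ha) (one_sub_sq_pos hz)).le,
      Real.sqrt_mul (one_sub_sq_pos ha).le, Real.sqrt_sq (norm_nonneg _)]
    rfl
  have e : mob a z - mob a w =
      ((dw a ^ 2 : ℝ) : ℂ) * (z - w) / ((1 + conj a * z) * (1 + conj a * w)) := by
    rw [dw_sq ha, ← Complex.normSq_eq_norm_sq]
    push_cast
    rw [Complex.normSq_eq_conj_mul_self, mob, mob, div_sub_div _ _ h1 h2]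
    congr 1
    ring
  have d1 := dw_pos ha
  have d2 := dw_pos hz
  have d3 := dw_pos hw
  rw [hd, hd, dwm hz, dwm hw, e, norm_div, norm_mul, norm_mul, Complex.norm_real,
    Real.norm_of_nonneg (by positivity)]
  congr 2
  generalize ‖1 + conj a * z‖ = m at n1
  generalize ‖1 + conj a * w‖ = n at n2
  field_simp

lemma hasDerivAt_mob {a z : ℂ} (ha : a ∈ ball (0:ℂ) 1) (hz : z ∈ ball (0:ℂ) 1) :
    HasDerivAt (mob a) ((1 - ‖a‖ ^ 2 : ℝ) / (1 + conj a * z) ^ 2) z := by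
  have h := ((hasDerivAt_id z).add_const a).div
    (((hasDerivAt_id z).const_mul (conj a)).const_add 1) (mob_den_ne ha hz)
  refine h.congr_deriv ?_
  rw [← Complex.normSq_eq_norm_sq]
  push_cast
  rw [Complex.normSq_eq_conj_mul_self]
  simp only [id]
  ring

lemma norm_deriv_mob {a z : ℂ} (ha : a ∈ ball (0:ℂ) 1) (hz : z ∈ ball (0:ℂ) 1) :
    ‖deriv (mob a) z‖ * (1 - ‖z‖ ^ 2) = 1 - ‖mob a z‖ ^ 2 := by
  rw [(hasDerivAt_mob ha hz).deriv, one_sub_mob ha hz, norm_div, Complex.norm_real,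
    Real.norm_of_nonneg (one_sub_sq_pos ha).le, norm_pow]
  ring

lemma hd_zero_left (z : ℂ) : hd 0 z = 2 * Real.arsinh (‖z‖ / dw z) := by
  simp [hd, dw]

lemma hd_zero_le_iff {z w : ℂ} (hz : z ∈ ball (0:ℂ) 1) (hw : w ∈ ball (0:ℂ) 1) :
    hd 0 z ≤ hd 0 w ↔ ‖z‖ ≤ ‖w‖ := by
  have h1 := dw_pos hz
  have h2 := dw_pos hw
  have h0 : (0:ℂ) ∈ ball (0:ℂ) 1 := by simp
  rw [← div_le_div_iff_of_pos_right (zero_lt_two' ℝ), ← Real.cosh_strictMonoOn.le_iff_le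
    (by simpa using div_nonneg (hd_nonneg 0 z) zero_le_two)
    (by simpa using div_nonneg (hd_nonneg 0 w) zero_le_two), cosh_hd h0 hz, cosh_hd h0 hw]
  have e : dw 0 = 1 := by simp [dw]
  simp only [map_zero, zero_mul, sub_zero, norm_one, e, one_mul]
  rw [div_le_div_iff_of_pos_left one_pos h1 h2, dw, dw, Real.sqrt_le_sqrt_iff (one_sub_sq_pos hz).le]
  constructor
  · intro h
    exact (sq_le_sq₀ (norm_nonneg _) (norm_nonneg _)).1 (by linarith)
  · intro h
    have := (sq_le_sq₀ (norm_nonneg _) (norm_nonneg _)).2 h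
    linarith

/-! ### The Schwarz–Pick lemma -/

lemma zero_mem_disc : (0:ℂ) ∈ ball (0:ℂ) 1 := by simp

lemma differentiableOn_mob {a : ℂ} (ha : a ∈ ball (0:ℂ) 1) :
    DifferentiableOn ℂ (mob a) (ball 0 1) := fun _ hz =>
  (hasDerivAt_mob ha hz).differentiableAt.differentiableWithinAt

lemma mapsTo_mob {a : ℂ} (ha : a ∈ ball (0:ℂ) 1) : MapsTo (mob a) (ball 0 1) (ball 0 1) :=
  fun _ hz => mob_mem ha hz

lemma differentiableOn_conj_mob {f : ℂ → ℂ} (hf : DifferentiableOn ℂ f (ball 0 1))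
    (hm : MapsTo f (ball 0 1) (ball 0 1)) {a : ℂ} (ha : a ∈ ball (0:ℂ) 1) :
    DifferentiableOn ℂ (mob (-f a) ∘ f ∘ mob a) (ball 0 1) :=
  (differentiableOn_mob (neg_mem_disc (hm ha))).comp
    (hf.comp (differentiableOn_mob ha) (mapsTo_mob ha)) (hm.comp (mapsTo_mob ha))

lemma schwarzPick_hd {f : ℂ → ℂ} (hf : DifferentiableOn ℂ f (ball 0 1))
    (hm : MapsTo f (ball 0 1) (ball 0 1)) {a b : ℂ} (ha : a ∈ ball (0:ℂ) 1)
    (hb : b ∈ ball (0:ℂ) 1) : hd (f a) (f b) ≤ hd a b := by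
  set g := mob (-f a) ∘ f ∘ mob a with hg
  have gm : MapsTo g (ball 0 1) (ball 0 1) :=
    (mapsTo_mob (neg_mem_disc (hm ha))).comp (hm.comp (mapsTo_mob ha))
  have g0 : g 0 = 0 := by simp [hg]
  set c := mob (-a) b with hc
  have hcm : c ∈ ball (0:ℂ) 1 := mob_mem (neg_mem_disc ha) hb
  have key : ‖g c‖ ≤ ‖c‖ :=
    Complex.norm_le_norm_of_mapsTo_ball (differentiableOn_conj_mob hf hm ha)
      (fun x hx => ball_subset_closedBall (gm hx)) g0 (mem_ball_zero_iff.1 hcm)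
  have k2 := (hd_zero_le_iff (gm hcm) hcm).2 key
  have e1 : hd 0 c = hd a b := by
    rw [← hd_mob ha zero_mem_disc hcm, mob_zero, hc, mob_mob_neg ha hb]
  have e2 : hd 0 (g c) = hd (f a) (f b) := by
    rw [← hd_mob (hm ha) zero_mem_disc (gm hcm), mob_zero, hg]
    simp only [Function.comp]
    rw [hc, mob_mob_neg ha hb, mob_mob_neg (hm ha) (hm hb)]
  rwa [e1, e2] at k2

lemma schwarzPick_deriv {f : ℂ → ℂ} (hf : DifferentiableOn ℂ f (ball 0 1))
    (hm : MapsTo f (ball 0 1) (ball 0 1)) {a : ℂ} (ha : a ∈ ball (0:ℂ) 1) :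
    ‖deriv f a‖ * (1 - ‖a‖ ^ 2) ≤ 1 - ‖f a‖ ^ 2 := by
  set g := mob (-f a) ∘ f ∘ mob a with hg
  have gm : MapsTo g (ball 0 1) (ball 0 1) :=
    (mapsTo_mob (neg_mem_disc (hm ha))).comp (hm.comp (mapsTo_mob ha))
  have g0 : g 0 = 0 := by simp [hg]
  have h1 : ‖deriv g 0‖ ≤ 1 := by
    refine Complex.norm_deriv_le_one_of_mapsTo_ball (differentiableOn_conj_mob hf hm ha) ?_ one_pos
    intro x hx
    rw [g0]
    exact ball_subset_closedBall (gm hx)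
  have d1 := hasDerivAt_mob ha zero_mem_disc
  have d2 : HasDerivAt f (deriv f a) (mob a 0) := by
    rw [mob_zero]
    exact (hf.differentiableAt (isOpen_ball.mem_nhds ha)).hasDerivAt
  have d3 := hasDerivAt_mob (neg_mem_disc (hm ha)) (hm (mob_mem ha zero_mem_disc))
  have d4 : HasDerivAt g _ 0 := d3.comp (0:ℂ) (d2.comp (0:ℂ) d1)
  have n1 := norm_deriv_mob (neg_mem_disc (hm ha)) (hm ha)
  have p2 := one_sub_sq_pos (hm ha)
  have p1 := one_sub_sq_pos ha
  rw [(hasDerivAt_mob (neg_mem_disc (hm ha)) (hm ha)).deriv, mob_neg_self] at n1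
  rw [d4.deriv, norm_mul, norm_mul] at h1
  simp only [mob_zero, mul_zero, add_zero, one_pow, div_one, Complex.norm_real,
    Real.norm_of_nonneg p1.le] at h1
  simp only [norm_zero] at n1
  set A := ‖((1 - ‖-f a‖ ^ 2 : ℝ) : ℂ) / (1 + conj (-f a) * f a) ^ 2‖
  have hA' : A = 1 / (1 - ‖f a‖ ^ 2) := by
    rw [eq_div_iff p2.ne']; linarith
  rw [hA', div_mul_eq_mul_div, one_mul, div_le_one p2] at h1
  exact h1

/-! ### Geodesics of the disc -/

lemma hd_ray {u : ℂ} (hu : ‖u‖ = 1) (s t : ℝ) :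
    hd (Real.tanh (s / 2) * u) (Real.tanh (t / 2) * u) = |s - t| := by
  have hc : ∀ s, dw (Real.tanh s * u) = 1 / Real.cosh s := by
    intro s
    rw [dw, norm_mul, hu, mul_one, Complex.norm_real, Real.norm_eq_abs, sq_abs,
      Real.tanh_eq_sinh_div_cosh]
    have : 1 - (Real.sinh s / Real.cosh s) ^ 2 = (1 / Real.cosh s) ^ 2 := by
      field_simp
      rw [Real.cosh_sq]; ring
    rw [this, Real.sqrt_sq (by positivity)]
  have h1 := Real.cosh_pos (s / 2)
  have h2 := Real.cosh_pos (t / 2)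
  have key : Real.sinh (hd (Real.tanh (s / 2) * u) (Real.tanh (t / 2) * u) / 2)
      = Real.sinh (|s - t| / 2) := by
    rw [sinh_hd, hc, hc, ← sub_mul, norm_mul, hu, mul_one, ← Complex.ofReal_sub,
      Complex.norm_real, Real.norm_eq_abs]
    have e : |s - t| / 2 = |s / 2 - t / 2| := by
      rw [← sub_div, abs_div, abs_two]
    have e' : ∀ x : ℝ, Real.sinh |x| = |Real.sinh x| := by
      intro x
      rcases abs_cases x with ⟨h, h'⟩ | ⟨h, h'⟩
      · rw [h, abs_of_nonneg (Real.sinh_nonneg_iff.2 h')]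
      · rw [h, Real.sinh_neg, abs_of_nonpos (Real.sinh_nonpos_iff.2 h'.le)]
    rw [e, e', Real.sinh_sub, Real.tanh_eq_sinh_div_cosh, Real.tanh_eq_sinh_div_cosh,
      div_sub_div _ _ h1.ne' h2.ne', abs_div, abs_of_pos (mul_pos h1 h2)]
    field_simp
  have := Real.sinh_injective key
  linarith

lemma ray_mem {u : ℂ} (hu : ‖u‖ = 1) (s : ℝ) : (Real.tanh (s / 2) * u : ℂ) ∈ ball (0:ℂ) 1 := by
  rw [mem_ball_zero_iff, norm_mul, hu, mul_one, Complex.norm_real, Real.norm_eq_abs]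
  exact Real.abs_tanh_lt_one _

lemma exists_eq_ray {b : ℂ} (hb : b ∈ ball (0:ℂ) 1) :
    ∃ u : ℂ, ‖u‖ = 1 ∧ b = Real.tanh (hd 0 b / 2) * u := by
  have key : ∀ u : ℂ, ‖u‖ = 1 → b = ‖b‖ * u → b = Real.tanh (hd 0 b / 2) * u := by
    intro u hu h
    have hb' := mem_ball_zero_iff.1 hb
    have e := Real.tanh_artanh (show ‖b‖ ∈ Ioo (-1:ℝ) 1 from ⟨by linarith [norm_nonneg b], hb'⟩)
    have h0 := Real.artanh_nonneg (norm_nonneg b)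
    have h2 := hd_ray hu 0 (2 * Real.artanh ‖b‖)
    rw [zero_div, Real.tanh_zero, mul_div_cancel_left₀ _ two_ne_zero, e, ofReal_zero, zero_mul,
      ← h, zero_sub, abs_neg, abs_of_nonneg (by linarith)] at h2
    rw [h2, mul_div_cancel_left₀ _ two_ne_zero, e]
    exact h
  by_cases h : b = 0
  · exact ⟨1, by simp, key 1 (by simp) (by simp [h])⟩
  · have h' : (‖b‖ : ℂ) ≠ 0 := by simpa using h
    have hu : ‖b / ‖b‖‖ = 1 := by
      rw [norm_div, Complex.norm_real, norm_norm, div_self (by simpa using h)]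
    exact ⟨b / ‖b‖, hu, key _ hu (by field_simp)⟩

lemma hasDerivAt_tanh_half (t : ℝ) :
    HasDerivAt (fun t => Real.tanh (t / 2)) ((1 - Real.tanh (t / 2) ^ 2) / 2) t := by
  have h := Real.cosh_pos (t / 2)
  have e : (fun t => Real.tanh (t / 2)) = fun t => Real.sinh (t / 2) / Real.cosh (t / 2) := by
    funext t; exact Real.tanh_eq_sinh_div_cosh _
  rw [e, Real.tanh_eq_sinh_div_cosh]
  have h1 : HasDerivAt (fun t : ℝ => t / 2) (1 / 2) t := (hasDerivAt_id t).div_const 2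
  refine (h1.sinh.div h1.cosh h.ne').congr_deriv ?_
  field_simp

/-- Unit-speed geodesic lines of the disc through two given points. -/
lemma exists_geodesic {a b : ℂ} (ha : a ∈ ball (0:ℂ) 1) (hb : b ∈ ball (0:ℂ) 1) :
    ∃ γ : ℝ → ℂ, (∀ t, γ t ∈ ball (0:ℂ) 1) ∧ γ 0 = a ∧ γ (hd a b) = b ∧
      (∀ s t, hd (γ s) (γ t) = |s - t|) ∧ ContDiff ℝ 1 γ ∧
      ∀ t, 2 / (1 - ‖γ t‖ ^ 2) * ‖deriv γ t‖ = 1 := by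
  obtain ⟨u, hu, hbu⟩ := exists_eq_ray (mob_mem (neg_mem_disc ha) hb)
  have e1 : hd 0 (mob (-a) b) = hd a b := by
    rw [← hd_mob ha zero_mem_disc (mob_mem (neg_mem_disc ha) hb), mob_zero, mob_mob_neg ha hb]
  rw [e1] at hbu
  set r : ℝ → ℂ := fun t => Real.tanh (t / 2) * u with hr
  have rm : ∀ t, r t ∈ ball (0:ℂ) 1 := ray_mem hu
  have rd : ∀ t, HasDerivAt r (((1 - Real.tanh (t / 2) ^ 2) / 2 : ℝ) * u) t := fun t =>
    (hasDerivAt_tanh_half t).ofReal_comp.mul_const u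
  have cd : ∀ t, HasDerivAt (fun t => mob a (r t))
      ((1 - ‖a‖ ^ 2 : ℝ) / (1 + conj a * r t) ^ 2 * (((1 - Real.tanh (t / 2) ^ 2) / 2 : ℝ) * u)) t :=
    fun t => (hasDerivAt_mob ha (rm t)).comp t (rd t)
  have rc : Continuous r := continuous_iff_continuousAt.2 fun t => (rd t).continuousAt
  have tc : Continuous fun t : ℝ => Real.tanh (t / 2) :=
    continuous_iff_continuousAt.2 fun t => (hasDerivAt_tanh_half t).continuousAt
  refine ⟨fun t => mob a (r t), fun t => mob_mem ha (rm t), by simp [hr], ?_, ?_, ?_, ?_⟩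
  · change mob a (r (hd a b)) = b
    rw [hr]; simp only
    rw [← hbu, mob_mob_neg ha hb]
  · intro s t
    rw [hd_mob ha (rm s) (rm t), hr]
    exact hd_ray hu s t
  · rw [contDiff_one_iff_deriv]
    refine ⟨fun t => (cd t).differentiableAt, ?_⟩
    have : deriv (fun t => mob a (r t)) = fun t => _ := funext fun t => (cd t).deriv
    rw [this]
    refine Continuous.mul (Continuous.div continuous_const (by fun_prop)
      fun t => pow_ne_zero 2 (mob_den_ne ha (rm t))) ?_
    refine Continuous.mul (Complex.continuous_ofReal.comp ?_) continuous_const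
    exact (continuous_const.sub (tc.pow 2)).div_const 2
  · intro t
    have n1 := norm_deriv_mob ha (rm t)
    have p1 := one_sub_sq_pos (rm t)
    have p2 := one_sub_sq_pos (mob_mem ha (rm t))
    rw [(hasDerivAt_mob ha (rm t)).deriv] at n1
    have n2 : 1 - Real.tanh (t / 2) ^ 2 = 1 - ‖r t‖ ^ 2 := by
      rw [hr]; simp only
      rw [norm_mul, hu, mul_one, Complex.norm_real, Real.norm_eq_abs, sq_abs]
    rw [(cd t).deriv, norm_mul, norm_mul, hu, mul_one, Complex.norm_real, n2,
      Real.norm_of_nonneg (by linarith), ← n1]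
    rw [← n1] at p2
    have := pos_of_mul_pos_left p2 p1.le
    field_simp

/-- Points of the disc at prescribed distances on a geodesic are unique. -/
lemma hd_between_unique {a b m n : ℂ} (ha : a ∈ ball (0:ℂ) 1) (hb : b ∈ ball (0:ℂ) 1)
    (hm : m ∈ ball (0:ℂ) 1) (hn : n ∈ ball (0:ℂ) 1) (h1 : hd a m + hd m b ≤ hd a b)
    (h2 : hd a n + hd n b ≤ hd a b) (h : hd a m = hd a n) : m = n := by
  have key : ∀ {b m : ℂ}, b ∈ ball (0:ℂ) 1 → m ∈ ball (0:ℂ) 1 → hd 0 m + hd m b ≤ hd 0 b →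
      ∀ u : ℂ, ‖u‖ = 1 → b = Real.tanh (hd 0 b / 2) * u → m = Real.tanh (hd 0 m / 2) * u := by
    intro b m hb hm h u hu hbu
    obtain ⟨v, hv, hmv⟩ := exists_eq_ray hm
    set r := hd 0 m
    set L := hd 0 b
    have hrL : r ≤ L := by linarith [hd_nonneg m b]
    have hr0 : 0 ≤ r := hd_nonneg _ _
    have h3 : hd m b ≤ |r - L| := by rw [abs_sub_comm, abs_of_nonneg] <;> linarith
    have h4 : ‖1 - conj m * b‖ ≤ 1 - Real.tanh (r / 2) * Real.tanh (L / 2) := by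
      have hm' := ray_mem hu r
      have k1 : Real.cosh (hd m b / 2) ≤ Real.cosh (|r - L| / 2) := by
        apply Real.cosh_le_cosh.2
        rw [abs_of_nonneg (by linarith [hd_nonneg m b]), abs_of_nonneg (by positivity)]
        linarith
      have e2 : dw (Real.tanh (r / 2) * u) = dw m := by
        rw [dw, dw, hmv]; simp [hu, hv]
      rw [← hd_ray hu r L, ← hbu, cosh_hd hm hb, cosh_hd hm' hb, e2,
        div_le_div_iff_of_pos_right (mul_pos (dw_pos hm) (dw_pos hb))] at k1
      refine k1.trans_eq ?_
      have e3 : (1 : ℂ) - conj (Real.tanh (r / 2) * u) * b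
          = ((1 - Real.tanh (r / 2) * Real.tanh (L / 2) : ℝ) : ℂ) := by
        rw [hbu, map_mul, Complex.conj_ofReal]
        have : conj u * u = 1 := by
          rw [← Complex.normSq_eq_conj_mul_self, Complex.normSq_eq_norm_sq, hu]; simp
        push_cast
        linear_combination (-(Complex.tanh (r / 2)) * Complex.tanh (L / 2)) * this
      rw [e3, Complex.norm_real, Real.norm_of_nonneg]
      nlinarith [Real.tanh_lt_one (r / 2), Real.tanh_lt_one (L / 2),
        Real.neg_one_lt_tanh (r / 2), Real.neg_one_lt_tanh (L / 2)]
    set α := Real.tanh (r / 2) with hα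
    set β := Real.tanh (L / 2) with hβ
    rcases eq_or_lt_of_le hr0 with h0 | h0
    · have : α = 0 := by rw [hα, ← h0]; simp
      rw [hmv, this]; simp
    have hα1 : 0 < α := by
      rw [hα, Real.tanh_eq_sinh_div_cosh]
      exact div_pos (Real.sinh_pos_iff.2 (by linarith)) (Real.cosh_pos _)
    have hβ1 : 0 < β := by
      rw [hβ, Real.tanh_eq_sinh_div_cosh]
      exact div_pos (Real.sinh_pos_iff.2 (by linarith)) (Real.cosh_pos _)
    have h5 := (Complex.re_le_norm _).trans h4
    rw [hmv, hbu] at h5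
    simp only [map_mul, Complex.conj_ofReal] at h5
    have h6 : 1 ≤ (conj v * u).re := by
      have e : (1 - α * conj v * (β * u) : ℂ) = 1 - ((α * β : ℝ) : ℂ) * (conj v * u) := by
        push_cast; ring
      rw [e, Complex.sub_re, Complex.re_ofReal_mul, Complex.one_re] at h5
      have := mul_pos hα1 hβ1
      nlinarith
    have h7 : ‖v - u‖ ^ 2 = 2 - 2 * (conj v * u).re := by
      have hv' := Complex.normSq_eq_norm_sq v
      have hu' := Complex.normSq_eq_norm_sq u
      rw [hv, one_pow, Complex.normSq_apply] at hv'
      rw [hu, one_pow, Complex.normSq_apply] at hu'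
      rw [← Complex.normSq_eq_norm_sq, Complex.normSq_apply]
      simp only [Complex.sub_re, Complex.sub_im, Complex.mul_re, Complex.conj_re, Complex.conj_im]
      linear_combination hv' + hu'
    have h8 : ‖v - u‖ = 0 := by nlinarith [norm_nonneg (v - u)]
    rw [hmv, sub_eq_zero.1 (norm_eq_zero.1 h8)]
  set φ := mob (-a) with hφ
  have ha' := neg_mem_disc ha
  have e0 : φ a = 0 := mob_neg_self a
  have iso : ∀ {x y}, x ∈ ball (0:ℂ) 1 → y ∈ ball (0:ℂ) 1 → hd (φ x) (φ y) = hd x y :=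
    fun hx hy => hd_mob ha' hx hy
  have hφb := mob_mem ha' hb
  obtain ⟨u, hu, hbu⟩ := exists_eq_ray hφb
  have km := key hφb (mob_mem ha' hm) (by
    rw [← hφ, iso hm hb, ← e0, iso ha hm, iso ha hb]; exact h1) u hu hbu
  have kn := key hφb (mob_mem ha' hn) (by
    rw [← hφ, iso hn hb, ← e0, iso ha hn, iso ha hb]; exact h2) u hu hbu
  rw [← hφ] at km kn
  have : φ m = φ n := by
    rw [km, kn, ← e0, iso ha hm, iso ha hn, h]
  have := congrArg (mob a) this
  rwa [hφ, mob_mob_neg ha hm, mob_mob_neg ha hn] at this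

/-! ### Four-point conditions -/

/-- Gromov's four-point condition implies that geodesic triangles are thin. -/
lemma gromovHyperbolicWith_of_fourPoint {α : Type*} {S : Set α} {d : α → α → ℝ} {K : ℝ}
    (hK : 0 ≤ K) (dnn : ∀ x ∈ S, ∀ y ∈ S, 0 ≤ d x y)
    (ds : ∀ x ∈ S, ∀ y ∈ S, d x y = d y x)
    (d4 : ∀ x ∈ S, ∀ y ∈ S, ∀ z ∈ S, ∀ w ∈ S,
      d x y + d z w ≤ max (d x z + d y w) (d x w + d y z) + K) :
    GromovHyperbolicWith S d (2 * K) := by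
  intro x hx y hy z hz gxy gxz gzy ⟨a0, a1, a2, a3⟩ ⟨b0, b1, b2, b3⟩ ⟨c0, c1, c2, c3⟩ t ht
  have hxz := dnn x hx z hz
  have hzy := dnn z hz y hy
  have hxy := dnn x hx y hy
  set m := gxy t
  have hmS : m ∈ S := a2 t ht
  have m1 : d x m = t := by
    have := a3 0 ⟨le_rfl, hxy⟩ t ht
    rwa [a0, zero_sub, abs_neg, abs_of_nonneg ht.1] at this
  have m2 : d m y = d x y - t := by
    have := a3 t ht (d x y) ⟨hxy, le_rfl⟩
    rwa [a1, abs_sub_comm, abs_of_nonneg (by linarith [ht.2])] at this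
  have q := d4 z hz m hmS x hx y hy
  rcases le_max_iff.1 (show d z m + d x y - K ≤ max _ _ by linarith) with q1 | q1
  · have q2 : d m z ≤ d x z - t + K := by
      rw [ds m hmS z hz]; rw [ds z hz x hx] at q1; linarith
    by_cases htz : t ≤ d x z
    · refine ⟨gxz t, Or.inl ⟨t, ⟨ht.1, htz⟩, rfl⟩, ?_⟩
      have hqS := b2 t ⟨ht.1, htz⟩
      have e1 : d x (gxz t) = t := by
        have := b3 0 ⟨le_rfl, hxz⟩ t ⟨ht.1, htz⟩
        rwa [b0, zero_sub, abs_neg, abs_of_nonneg ht.1] at this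
      have e2 : d (gxz t) z = d x z - t := by
        have := b3 t ⟨ht.1, htz⟩ (d x z) ⟨hxz, le_rfl⟩
        rwa [b1, abs_sub_comm, abs_of_nonneg (by linarith)] at this
      have := d4 m hmS _ hqS x hx z hz
      rw [ds m hmS x hx, ds _ hqS x hx] at this
      rcases max_cases (d x m + d (gxz t) z) (d m z + d x (gxz t)) with ⟨h, -⟩ | ⟨h, -⟩ <;>
        rw [h] at this <;> linarith
    · refine ⟨z, Or.inl ⟨d x z, ⟨hxz, le_rfl⟩, b1⟩, ?_⟩
      linarith
  · have q2 : d m z ≤ d z y - (d x y - t) + K := by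
      rw [ds m hmS z hz]; rw [ds m hmS x hx] at q1; linarith
    by_cases htz : d x y - t ≤ d z y
    · set u := d z y - (d x y - t)
      have hu' : u ∈ Icc 0 (d z y) := ⟨by linarith, by linarith [ht.2]⟩
      refine ⟨gzy u, Or.inr ⟨u, hu', rfl⟩, ?_⟩
      have hqS := c2 u hu'
      have e1 : d z (gzy u) = u := by
        have := c3 0 ⟨le_rfl, hzy⟩ u hu'
        rwa [c0, zero_sub, abs_neg, abs_of_nonneg hu'.1] at this
      have e2 : d (gzy u) y = d z y - u := by
        have := c3 u hu' (d z y) ⟨hzy, le_rfl⟩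
        rwa [c1, abs_sub_comm, abs_of_nonneg (by linarith [hu'.2])] at this
      have := d4 m hmS _ hqS z hz y hy
      rw [ds _ hqS z hz] at this
      rcases max_cases (d m z + d (gzy u) y) (d m y + d z (gzy u)) with ⟨h, -⟩ | ⟨h, -⟩ <;>
        rw [h] at this <;> linarith
    · refine ⟨z, Or.inr ⟨0, ⟨le_rfl, hzy⟩, c0⟩, ?_⟩
      linarith

/-- A distance obtained by gluing two copies of a space satisfying the four-point condition along
a quasiconvex subset `B` satisfies the four-point condition. -/
lemma fourPoint_of_glued {α : Type*} {S B : Set α} {d e : α → α → ℝ} {σ : α → Bool} {K c : ℝ}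
    (hK : 0 ≤ K) (hc : 0 ≤ c) (hBS : B ⊆ S) (hB : B.Nonempty)
    (enn : ∀ x y, 0 ≤ e x y) (es : ∀ x y, e x y = e y x)
    (et : ∀ x ∈ S, ∀ y ∈ S, ∀ z ∈ S, e x z ≤ e x y + e y z)
    (e4 : ∀ x ∈ S, ∀ y ∈ S, ∀ z ∈ S, ∀ w ∈ S,
      e x y + e z w ≤ max (e x z + e y w) (e x w + e y z) + K)
    (ds : ∀ x ∈ S, ∀ y ∈ S, d x y = d y x)
    (hsame : ∀ x ∈ S, ∀ y ∈ S, σ x = σ y → d x y = e x y)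
    (hle : ∀ x ∈ S, ∀ y ∈ S, e x y ≤ d x y)
    (hglue : ∀ x ∈ S, ∀ y ∈ S, ∀ b ∈ B, d x y ≤ e x b + e b y)
    (hopp : ∀ x ∈ S, ∀ y ∈ S, σ x ≠ σ y → ∃ b ∈ B, e x b + e b y ≤ d x y + 1)
    (hD : ∀ b₁ ∈ B, ∀ b₂ ∈ B, ∀ r ∈ Icc 0 (e b₁ b₂), ∃ m ∈ S,
      e b₁ m = r ∧ e m b₂ = e b₁ b₂ - r ∧ ∃ b ∈ B, e m b ≤ c) :
    ∃ K', 0 ≤ K' ∧ ∀ x ∈ S, ∀ y ∈ S, ∀ z ∈ S, ∀ w ∈ S,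
      d x y + d z w ≤ max (d x z + d y w) (d x w + d y z) + K' := by
  have hproj : ∀ x, ∃ b ∈ B, ∀ b' ∈ B, e x b ≤ e x b' + 1 := by
    intro x
    have hne : (e x '' B).Nonempty := hB.image _
    have hbd : BddBelow (e x '' B) := ⟨0, by rintro _ ⟨b, -, rfl⟩; exact enn _ _⟩
    obtain ⟨_, ⟨b, hb, rfl⟩, h⟩ := exists_lt_of_csInf_lt hne (lt_add_one (sInf (e x '' B)))
    exact ⟨b, hb, fun b' hb' => by linarith [csInf_le hbd ⟨b', hb', rfl⟩]⟩
  choose β hβB hβ using hproj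
  have hβS : ∀ x, β x ∈ S := fun x => hBS (hβB x)
  set K₁ := 2 * K + 2 * c + 3
  have proj : ∀ x ∈ S, ∀ b ∈ B, e x (β x) + e (β x) b ≤ e x b + K₁ := by
    intro x hx b hb
    by_cases hr : K + c + 2 ≤ e (β x) b
    · obtain ⟨m, hm, m1, m2, b', hb', m3⟩ := hD _ (hβB x) b hb (K + c + 2) ⟨by linarith, hr⟩
      have h1 := e4 x hx m hm (β x) (hβS x) b (hBS hb)
      have h2 := et x hx m hm b' (hBS hb')
      have h3 := hβ x b' hb'
      rw [es m (β x), m1, m2] at h1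
      rcases max_cases (e x (β x) + (e (β x) b - (K + c + 2))) (e x b + (K + c + 2))
        with ⟨h, -⟩ | ⟨h, -⟩ <;> rw [h] at h1 <;> linarith
    · have := hβ x b hb
      linarith
  set T : α → α → ℝ := fun x w => e x (β x) + e w (β w) + e (β x) (β w) with hT
  have dT : ∀ x ∈ S, ∀ w ∈ S, d x w ≤ e x (β x) + e (β x) w := fun x hx w hw =>
    hglue x hx w hw _ (hβB x)
  have GT : ∀ x ∈ S, ∀ w ∈ S, e x (β x) + e (β x) w ≤ T x w := by
    intro x hx w hw
    have := et _ (hβS x) _ (hβS w) w hw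
    rw [es (β w) w] at this
    simp only [hT]; linarith
  have Td : ∀ x ∈ S, ∀ w ∈ S, σ x ≠ σ w → T x w ≤ d x w + (2 * K₁ + 1) := by
    intro x hx w hw h
    obtain ⟨b, hb, h1⟩ := hopp x hx w hw h
    have h2 := proj x hx b hb
    have h3 := proj w hw b hb
    have h4 := et _ (hβS x) b (hBS hb) _ (hβS w)
    rw [es b w] at h1
    rw [es b] at h4
    simp only [hT]; linarith
  have Gd : ∀ x ∈ S, ∀ w ∈ S, σ x ≠ σ w → e x (β x) + e (β x) w ≤ d x w + (2 * K₁ + 1) :=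
    fun x hx w hw h => (GT x hx w hw).trans (Td x hx w hw h)
  have TQ : ∀ x ∈ S, ∀ w ∈ S, T x w ≤ e x w + (K + 2 * K₁) ∨ e (β x) (β w) ≤ K + 2 * K₁ := by
    intro x hx w hw
    have h1 := e4 x hx _ (hβS w) _ (hβS x) w hw
    have h2 := proj x hx _ (hβB w)
    have h3 := proj w hw _ (hβB x)
    rw [es (β w) (β x), es (β w) w, es (β x) w] at h1
    rw [es (β w) (β x)] at h3
    simp only [hT]
    rcases max_cases (e x (β x) + e w (β w)) (e x w + e (β x) (β w)) with ⟨h, -⟩ | ⟨h, -⟩ <;>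
      rw [h] at h1
    · right; linarith [enn (β x) (β w)]
    · left; linarith
  set M := 5 * K + 20 * K₁ + 20
  have same : ∀ x ∈ S, ∀ y ∈ S, ∀ z ∈ S, ∀ w ∈ S, σ x = σ y → σ z = σ w →
      d x y + d z w ≤ max (d x z + d y w) (d x w + d y z) + M := by
    intro x hx y hy z hz w hw hxy hzw
    rw [hsame x hx y hy hxy, hsame z hz w hw hzw]
    refine (e4 x hx y hy z hz w hw).trans ?_
    refine add_le_add (max_le_max ?_ ?_) (by linarith)
    · exact add_le_add (hle x hx z hz) (hle y hy w hw)
    · exact add_le_add (hle x hx w hw) (hle y hy z hz)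
  have lone : ∀ x ∈ S, ∀ y ∈ S, ∀ z ∈ S, ∀ w ∈ S, σ x ≠ σ y → σ x ≠ σ z → σ x ≠ σ w →
      σ z = σ w → d x y + d z w ≤ max (d x z + d y w) (d x w + d y z) + M := by
    intro x hx y hy z hz w hw hxy hxz hxw hzw
    have h1 := e4 _ (hβS x) y hy z hz w hw
    have h2 := dT x hx y hy
    have h3 := Gd x hx z hz hxz
    have h4 := Gd x hx w hw hxw
    have h5 := hle y hy w hw
    have h6 := hle y hy z hz
    rw [hsame z hz w hw hzw]
    have l1 := le_max_left (d x z + d y w) (d x w + d y z)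
    have l2 := le_max_right (d x z + d y w) (d x w + d y z)
    rcases max_cases (e (β x) z + e y w) (e (β x) w + e y z) with ⟨h, -⟩ | ⟨h, -⟩ <;>
      rw [h] at h1 <;> linarith
  have two : ∀ x ∈ S, ∀ y ∈ S, ∀ z ∈ S, ∀ w ∈ S, σ x ≠ σ y → σ z ≠ σ w → σ x = σ z →
      σ y = σ w → d x y + d z w ≤ max (d x z + d y w) (d x w + d y z) + M := by
    intro x hx y hy z hz w hw hxy hzw hxz hyw
    have l1 := le_max_left (d x z + d y w) (d x w + d y z)
    have l2 := le_max_right (d x z + d y w) (d x w + d y z)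
    have a1 := (dT x hx y hy).trans (GT x hx y hy)
    have a2 := (dT z hz w hw).trans (GT z hz w hw)
    have a3 := Td x hx w hw (hyw ▸ hxy)
    have a4 := Td y hy z hz (fun h => hxy (hxz.trans h.symm))
    have a5 := hle x hx z hz
    have a6 := hle y hy w hw
    have h1 := e4 _ (hβS x) _ (hβS y) _ (hβS z) _ (hβS w)
    rcases TQ x hx z hz with h | h
    · rcases TQ y hy w hw with h' | h'
      · simp only [hT] at *
        rcases max_cases (e (β x) (β z) + e (β y) (β w)) (e (β x) (β w) + e (β y) (β z))
          with ⟨h2, -⟩ | ⟨h2, -⟩ <;> rw [h2] at h1 <;> linarith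
      · have t1 := et _ (hβS x) _ (hβS w) _ (hβS y)
        have t2 := et _ (hβS z) _ (hβS y) _ (hβS w)
        rw [es (β w) (β y)] at t1
        rw [es (β z) (β y)] at t2
        simp only [hT] at *
        linarith
    · have t1 := et _ (hβS x) _ (hβS z) _ (hβS y)
      have t2 := et _ (hβS z) _ (hβS x) _ (hβS w)
      rw [es (β z) (β y)] at t1
      rw [es (β z) (β x)] at t2
      simp only [hT] at *
      linarith
  refine ⟨M, by positivity, fun x hx y hy z hz w hw => ?_⟩
  have sxy := ds x hx y hy
  have sxz := ds x hx z hz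
  have sxw := ds x hx w hw
  have syz := ds y hy z hz
  have syw := ds y hy w hw
  have szw := ds z hz w hw
  have tr : ∀ {a b c : Bool}, a ≠ b → c ≠ b → a = c := by decide
  by_cases hxy : σ x = σ y <;> by_cases hzw : σ z = σ w
  · exact same x hx y hy z hz w hw hxy hzw
  · by_cases hxz : σ x = σ z
    · have h1 : σ x ≠ σ w := hxz ▸ hzw
      have := lone w hw z hz y hy x hx (Ne.symm hzw) (Ne.symm (hxy ▸ h1)) (Ne.symm h1) hxy.symm
      rwa [← szw, ← sxy, ← syw, ← sxz, ← sxw, ← syz, add_comm (d z w), add_comm (d y w)] at this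
    · have h1 : σ z ≠ σ y := hxy ▸ Ne.symm hxz
      have := lone z hz w hw x hx y hy hzw (Ne.symm hxz) h1 hxy
      rwa [add_comm (d z w), ← sxz, ← syz, add_comm (d y z), ← sxw, ← syw] at this
  · by_cases hxz : σ x = σ z
    · have h1 : σ y ≠ σ z := hxz ▸ Ne.symm hxy
      have := lone y hy x hx w hw z hz (Ne.symm hxy) (hzw ▸ h1) h1 hzw.symm
      rwa [← sxy, ← szw, add_comm (d y w), add_comm (d y z)] at this
    · exact lone x hx y hy z hz w hw hxy hxz (hzw ▸ hxz) hzw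
  · by_cases hxz : σ x = σ z
    · exact two x hx y hy z hz w hw hxy hzw hxz (tr (Ne.symm hxy) (hxz ▸ Ne.symm hzw))
    · have h1 : σ x = σ w := tr hxz (Ne.symm hzw)
      have h2 : σ y = σ z := tr (Ne.symm hxy) (Ne.symm hxz)
      have := two x hx y hy w hw z hz hxy (Ne.symm hzw) h1 h2
      rwa [← szw, max_comm] at this

/-- `p` is a holomorphic covering of the open set `Ω` by the unit disk which pushes the hyperbolic
density forward to `lam`. -/
structure PCov (Ω : Set ℂ) (lam : ℂ → ℝ) (p : ℂ → ℂ) : Prop where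
  op : IsOpen Ω
  diff : ∀ z ∈ ball (0:ℂ) 1, DifferentiableAt ℂ p z
  img : p '' ball (0:ℂ) 1 = Ω
  cov : IsCoveringMapOn (fun z : ball (0:ℂ) 1 => p z) Ω
  dens : ∀ z ∈ ball (0:ℂ) 1, lam (p z) * ‖deriv p z‖ = 2 / (1 - ‖z‖ ^ 2)

theorem IsPoincareDensity.exists_pcov {Ω : Set ℂ} {lam : ℂ → ℝ} (h : IsPoincareDensity Ω lam)
    (ho : IsOpen Ω) : ∃ p, PCov Ω lam p := by
  obtain ⟨p, h1, h2, h3, h4⟩ := h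
  exact ⟨p, ho, h1, h2, h3, h4⟩

namespace PCov

variable {Ω : Set ℂ} {lam : ℂ → ℝ} {p : ℂ → ℂ}

theorem mem (h : PCov Ω lam p) {z : ℂ} (hz : z ∈ ball (0:ℂ) 1) : p z ∈ Ω :=
  h.img ▸ mem_image_of_mem p hz

theorem exists_eq (h : PCov Ω lam p) {z : ℂ} (hz : z ∈ Ω) : ∃ a ∈ ball (0:ℂ) 1, p a = z := by
  rw [← h.img] at hz
  exact hz

theorem hyp_pos {z : ℂ} (hz : z ∈ ball (0:ℂ) 1) : 0 < 2 / (1 - ‖z‖ ^ 2) := by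
  have := one_sub_sq_pos hz
  positivity

theorem deriv_ne (h : PCov Ω lam p) {z : ℂ} (hz : z ∈ ball (0:ℂ) 1) : deriv p z ≠ 0 := by
  intro h0
  have := h.dens z hz
  rw [h0, norm_zero, mul_zero] at this
  exact (hyp_pos hz).ne this

theorem lam_pos (h : PCov Ω lam p) {z : ℂ} (hz : z ∈ Ω) : 0 < lam z := by
  obtain ⟨a, ha, rfl⟩ := h.exists_eq hz
  have h1 : 0 < ‖deriv p a‖ := norm_pos_iff.2 (h.deriv_ne ha)
  have h2 : 0 < lam (p a) * ‖deriv p a‖ := by rw [h.dens a ha]; exact hyp_pos ha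
  exact pos_of_mul_pos_left h2 h1.le

theorem differentiableOn (h : PCov Ω lam p) : DifferentiableOn ℂ p (ball 0 1) :=
  fun z hz => (h.diff z hz).differentiableWithinAt

theorem strict (h : PCov Ω lam p) {z : ℂ} (hz : z ∈ ball (0:ℂ) 1) :
    HasStrictDerivAt p (deriv p z) z := by
  have h1 : AnalyticAt ℂ p z := h.differentiableOn.analyticAt (isOpen_ball.mem_nhds hz)
  exact h1.hasStrictDerivAt

theorem exists_localInverse (h : PCov Ω lam p) {a : ℂ} (ha : a ∈ ball (0:ℂ) 1) :
    ∃ g : ℂ → ℂ, g (p a) = a ∧ DifferentiableAt ℂ g (p a) ∧ (∀ᶠ x in 𝓝 a, g (p x) = x) ∧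
      ∀ᶠ w in 𝓝 (p a), p (g w) = w := by
  have h1 := h.strict ha
  refine ⟨h1.localInverse _ _ _ (h.deriv_ne ha), ?_,
    (h1.to_localInverse (h.deriv_ne ha)).hasDerivAt.differentiableAt,
    h1.eventually_left_inverse _, h1.eventually_right_inverse _⟩
  exact (h1.eventually_left_inverse (h.deriv_ne ha)).self_of_nhds

theorem continuousOn_lam (h : PCov Ω lam p) : ContinuousOn lam Ω := by
  intro z hz
  obtain ⟨a, ha, rfl⟩ := h.exists_eq hz
  obtain ⟨g, g0, g1, -, g3⟩ := h.exists_localInverse ha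
  have hball : ball (0:ℂ) 1 ∈ 𝓝 a := isOpen_ball.mem_nhds ha
  have hdp : ContinuousAt (deriv p) a :=
    ((h.differentiableOn.deriv isOpen_ball).differentiableAt hball).continuousAt
  have hc : ContinuousAt (fun z => 2 / (1 - ‖z‖ ^ 2) / ‖deriv p z‖) a := by
    refine ContinuousAt.div (ContinuousAt.div continuousAt_const (by fun_prop)
      (one_sub_sq_pos ha).ne') hdp.norm (norm_ne_zero_iff.2 (h.deriv_ne ha))
  have hg : ContinuousAt g (p a) := g1.continuousAt
  have hc2 : ContinuousAt ((fun z => 2 / (1 - ‖z‖ ^ 2) / ‖deriv p z‖) ∘ g) (p a) := by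
    refine ContinuousAt.comp ?_ hg
    rw [g0]; exact hc
  refine (hc2.congr ?_).continuousWithinAt
  have hgb : ∀ᶠ w in 𝓝 (p a), g w ∈ ball (0:ℂ) 1 := hg (by rw [g0]; exact hball)
  filter_upwards [g3, hgb] with w hw hwb
  simp only [Function.comp]
  rw [← h.dens _ hwb, hw, mul_div_assoc, div_self (norm_ne_zero_iff.2 (h.deriv_ne hwb)), mul_one]

theorem differentiableAt_lift (h : PCov Ω lam p) {g q : ℂ → ℂ} {z : ℂ} (hg : ContinuousAt g z)
    (hz : g z ∈ ball (0:ℂ) 1) (hq : DifferentiableAt ℂ q z) (he : ∀ᶠ w in 𝓝 z, p (g w) = q w) :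
    DifferentiableAt ℂ g z := by
  obtain ⟨k, k0, k1, k2, -⟩ := h.exists_localInverse hz
  have h1 : ∀ᶠ w in 𝓝 z, k (p (g w)) = g w := hg.eventually k2
  have h2 : DifferentiableAt ℂ (k ∘ q) z := by
    refine DifferentiableAt.comp z ?_ hq
    rw [← he.self_of_nhds]; exact k1
  refine h2.congr_of_eventuallyEq ?_
  filter_upwards [h1, he] with w hw1 hw2
  simp only [Function.comp]
  rw [← hw2, hw1]

theorem isLocallyInjective (h : PCov Ω lam p) :
    IsLocallyInjective (fun z : ball (0:ℂ) 1 => p z) := by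
  have h1 := h.cov.isLocalHomeomorphOn
  have h2 : (fun z : ball (0:ℂ) 1 => p z) ⁻¹' Ω = univ := by
    ext z; simpa using h.mem z.2
  rw [h2] at h1
  exact (isLocalHomeomorph_iff_isLocalHomeomorphOn_univ.2 h1).isLocallyInjective

theorem eqOn_of_lift (h : PCov Ω lam p) {X : Type*} [TopologicalSpace X] {s : Set X}
    (hs : IsPreconnected s) {g₁ g₂ : X → ℂ} (c₁ : ContinuousOn g₁ s) (c₂ : ContinuousOn g₂ s)
    (m₁ : MapsTo g₁ s (ball 0 1)) (m₂ : MapsTo g₂ s (ball 0 1))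
    (he : ∀ x ∈ s, p (g₁ x) = p (g₂ x)) {a : X} (ha : a ∈ s) (haa : g₁ a = g₂ a) :
    EqOn g₁ g₂ s := by
  have : PreconnectedSpace s := isPreconnected_iff_preconnectedSpace.1 hs
  let G₁ : s → ball (0:ℂ) 1 := fun x => ⟨g₁ x, m₁ x.2⟩
  let G₂ : s → ball (0:ℂ) 1 := fun x => ⟨g₂ x, m₂ x.2⟩
  have e : G₁ = G₂ := by
    refine IsSeparatedMap.eq_of_comp_eq (p := fun z : ball (0:ℂ) 1 => p z)
      (T2Space.isSeparatedMap _) h.isLocallyInjective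
      ((continuousOn_iff_continuous_domRestrict.1 c₁).subtype_mk _)
      ((continuousOn_iff_continuous_domRestrict.1 c₂).subtype_mk _) ?_ ⟨a, ha⟩ (Subtype.ext haa)
    funext x
    exact he x x.2
  intro x hx
  exact congrArg Subtype.val (congrFun e ⟨x, hx⟩)

theorem exists_lift (h : PCov Ω lam p) {D : Set ℂ} {c : ℂ} {q : ℂ → ℂ} (hD : IsOpen D)
    (hs : StarConvex ℝ c D) (hc : c ∈ D) (hq : ContinuousOn q D) (hm : MapsTo q D Ω) {a₀ : ℂ}
    (ha : a₀ ∈ ball (0:ℂ) 1) (h0 : p a₀ = q c) :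
    ∃ g : ℂ → ℂ, ContinuousOn g D ∧ MapsTo g D (ball 0 1) ∧ g c = a₀ ∧ ∀ z ∈ D, p (g z) = q z := by
  classical
  have : ContractibleSpace D := hs.contractibleSpace ⟨c, hc⟩
  have : LocallyPathConnectedSpace D := hD.locallyPathConnectedSpace
  obtain ⟨G, ⟨hG1, hG2⟩, -⟩ := h.cov.existsUnique_continuousMap_lifts
    (⟨D.domRestrict q, continuousOn_iff_continuous_domRestrict.1 hq⟩ : C(D, ℂ)) (a₀ := ⟨c, hc⟩)
    (e₀ := ⟨a₀, ha⟩) h0 (fun a => hm a.2)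
  refine ⟨fun z => if hz : z ∈ D then (G ⟨z, hz⟩ : ℂ) else 0, ?_, ?_, ?_, ?_⟩
  · rw [continuousOn_iff_continuous_domRestrict]
    have : D.domRestrict (fun z => if hz : z ∈ D then (G ⟨z, hz⟩ : ℂ) else 0) =
        fun z => (G z : ℂ) := by
      funext z; simp [Set.domRestrict]
    rw [this]
    exact continuous_subtype_val.comp G.continuous
  · intro z hz
    simp only [hz, dite_true]
    exact (G ⟨z, hz⟩).2
  · simp [hc, hG1]
  · intro z hz
    simp only [hz, dite_true]
    exact congrFun hG2 ⟨z, hz⟩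

theorem exists_disc_lift (h : PCov Ω lam p) {q : ℂ → ℂ} (hq : DifferentiableOn ℂ q (ball 0 1))
    (hm : MapsTo q (ball 0 1) Ω) {c a₀ : ℂ} (hc : c ∈ ball (0:ℂ) 1) (ha : a₀ ∈ ball (0:ℂ) 1)
    (h0 : p a₀ = q c) : ∃ g : ℂ → ℂ, DifferentiableOn ℂ g (ball 0 1) ∧
      MapsTo g (ball 0 1) (ball 0 1) ∧ g c = a₀ ∧ ∀ z ∈ ball (0:ℂ) 1, p (g z) = q z := by
  obtain ⟨g, g1, g2, g3, g4⟩ := h.exists_lift isOpen_ball ((convex_ball 0 1).starConvex hc) hc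
    hq.continuousOn hm ha h0
  refine ⟨g, fun z hz => ?_, g2, g3, g4⟩
  have hb : ball (0:ℂ) 1 ∈ 𝓝 z := isOpen_ball.mem_nhds hz
  exact (h.differentiableAt_lift (g1.continuousAt hb) (g2 hz) (hq.differentiableAt hb)
    (eventually_of_mem hb g4)).differentiableWithinAt

theorem lam_schwarz (h : PCov Ω lam p) {q : ℂ → ℂ} (hq : DifferentiableOn ℂ q (ball 0 1))
    (hm : MapsTo q (ball 0 1) Ω) {a : ℂ} (ha : a ∈ ball (0:ℂ) 1) :
    lam (q a) * ‖deriv q a‖ ≤ 2 / (1 - ‖a‖ ^ 2) := by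
  obtain ⟨b, hb, hba⟩ := h.exists_eq (hm ha)
  obtain ⟨g, g1, g2, g3, g4⟩ := h.exists_disc_lift hq hm ha hb hba
  have hn : ball (0:ℂ) 1 ∈ 𝓝 a := isOpen_ball.mem_nhds ha
  have h1 : deriv q a = deriv p b * deriv g a := by
    have e : q =ᶠ[𝓝 a] p ∘ g := by
      filter_upwards [hn] with z hz using (g4 z hz).symm
    rw [e.deriv_eq, deriv_comp a (by rw [g3]; exact h.diff b hb) (g1.differentiableAt hn), g3]
  have h2 := schwarzPick_deriv g1 g2 ha
  rw [g3] at h2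
  have h3 := one_sub_sq_pos ha
  have h4 := one_sub_sq_pos hb
  rw [← hba, h1, norm_mul, ← mul_assoc, h.dens b hb, div_mul_eq_mul_div, div_le_div_iff₀ h4 h3]
  nlinarith

theorem lam_conj (h : PCov Ω lam p) (hΩ : ∀ z ∈ Ω, conj z ∈ Ω) {z : ℂ} (hz : z ∈ Ω) :
    lam (conj z) = lam z := by
  have key : ∀ z ∈ Ω, lam (conj z) ≤ lam z := by
    intro z hz
    obtain ⟨b, hb, rfl⟩ := h.exists_eq hz
    have hcb : ∀ a ∈ ball (0:ℂ) 1, conj a ∈ ball (0:ℂ) 1 := by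
      intro a ha; simpa using ha
    have hd : ∀ a ∈ ball (0:ℂ) 1, HasDerivAt (conj ∘ p ∘ conj) (conj (deriv p (conj a))) a := by
      intro a ha
      have := (h.diff (conj a) (hcb a ha)).hasDerivAt.conj_conj
      simpa using this
    have h1 := h.lam_schwarz (q := conj ∘ p ∘ conj)
      (fun a ha => (hd a ha).differentiableAt.differentiableWithinAt)
      (fun a ha => hΩ _ (h.mem (hcb a ha))) (hcb b hb)
    rw [(hd _ (hcb b hb)).deriv] at h1
    simp only [Function.comp, conj_conj, norm_conj] at h1
    rw [← h.dens b hb] at h1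
    exact le_of_mul_le_mul_right h1 (norm_pos_iff.2 (h.deriv_ne hb))
  refine le_antisymm (key z hz) ?_
  have := key _ (hΩ z hz)
  rwa [conj_conj] at this

/-- Complex conjugation on `Ω` lifts to the disk. -/
theorem exists_reflection (h : PCov Ω lam p) (hΩ : ∀ z ∈ Ω, conj z ∈ Ω) {a b : ℂ}
    (ha : a ∈ ball (0:ℂ) 1) (hb : b ∈ ball (0:ℂ) 1) (hab : p b = conj (p a)) :
    ∃ J : ℂ → ℂ, ContinuousOn J (ball 0 1) ∧ MapsTo J (ball 0 1) (ball 0 1) ∧ J a = b ∧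
      (∀ z ∈ ball (0:ℂ) 1, p (J z) = conj (p z)) ∧
      ∀ z ∈ ball (0:ℂ) 1, ∀ w ∈ ball (0:ℂ) 1, hd (J z) (J w) ≤ hd z w := by
  have hcb : ∀ a ∈ ball (0:ℂ) 1, conj a ∈ ball (0:ℂ) 1 := by
    intro a ha; simpa using ha
  have hd' : ∀ a ∈ ball (0:ℂ) 1, HasDerivAt (conj ∘ p ∘ conj) (conj (deriv p (conj a))) a := by
    intro a ha
    have := (h.diff (conj a) (hcb a ha)).hasDerivAt.conj_conj
    simpa using this
  obtain ⟨g, g1, g2, g3, g4⟩ := h.exists_disc_lift (q := conj ∘ p ∘ conj)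
      (fun a ha => (hd' a ha).differentiableAt.differentiableWithinAt)
      (fun a ha => hΩ _ (h.mem (hcb a ha))) (hcb a ha) hb (by simp [hab])
  refine ⟨g ∘ conj, g1.continuousOn.comp continuous_conj.continuousOn hcb,
    fun z hz => g2 (hcb z hz), g3, fun z hz => ?_, fun z hz w hw => ?_⟩
  · simp [g4 _ (hcb z hz)]
  · refine (schwarzPick_hd g1 g2 (hcb z hz) (hcb w hw)).trans_eq ?_
    have hn : ∀ a : ℂ, dw (conj a) = dw a := fun a => by simp [dw]
    simp only [hd, hn, ← map_sub, norm_conj]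

end PCov

/-- Folding of the plane along the real axis onto the closed upper half plane. -/
def fold (z : ℂ) : ℂ := ⟨z.re, |z.im|⟩

theorem fold_im_nonneg (z : ℂ) : 0 ≤ (fold z).im := abs_nonneg _

theorem fold_of_nonneg {z : ℂ} (h : 0 ≤ z.im) : fold z = z :=
  Complex.ext rfl (abs_of_nonneg h)

theorem fold_of_nonpos {z : ℂ} (h : z.im ≤ 0) : fold z = conj z :=
  Complex.ext rfl (abs_of_nonpos h)

theorem fold_fold (z : ℂ) : fold (fold z) = fold z := fold_of_nonneg (fold_im_nonneg z)

theorem norm_fold_sub_le (z w : ℂ) : ‖fold z - fold w‖ ≤ ‖z - w‖ := by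
  rw [← sq_le_sq₀ (norm_nonneg _) (norm_nonneg _), Complex.sq_norm, Complex.sq_norm,
    normSq_apply, normSq_apply]
  have h := abs_abs_sub_abs_le_abs_sub z.im w.im
  have h2 := (sq_le_sq.2 (by simpa using h) : (|z.im| - |w.im|) ^ 2 ≤ (z.im - w.im) ^ 2)
  simp only [sub_re, sub_im, fold]
  nlinarith

theorem continuous_fold : Continuous fold := by
  have : LipschitzWith 1 fold := LipschitzWith.of_dist_le_mul fun z w => by
    simpa [dist_eq_norm] using norm_fold_sub_le z w
  exact this.continuous

/-- A covering `p` of a domain containing all non-real points, with a section `s` over the part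
of the domain in the closed upper half plane. -/
structure Chart (Ω : Set ℂ) (lam : ℂ → ℝ) (p s : ℂ → ℂ) : Prop extends PCov Ω lam p where
  nonreal : ∀ z : ℂ, z.im ≠ 0 → z ∈ Ω
  sdiff : ∀ z ∈ Ω, 0 ≤ z.im → DifferentiableAt ℂ s z
  smem : ∀ z ∈ Ω, 0 ≤ z.im → s z ∈ ball (0:ℂ) 1
  sect : ∀ z ∈ Ω, 0 ≤ z.im → ∀ᶠ w in 𝓝 z, p (s w) = w

theorem isOpen_starHull {Ω : Set ℂ} (hΩ : IsOpen Ω) (c : ℂ) :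
    IsOpen {w | segment ℝ c w ⊆ Ω} := by
  rw [Metric.isOpen_iff]
  intro w hw
  have hcomp : IsCompact (segment ℝ c w) := by
    rw [segment_eq_image]
    exact isCompact_Icc.image (by fun_prop)
  obtain ⟨ε, hε, h⟩ := hcomp.exists_thickening_subset_open hΩ hw
  refine ⟨ε, hε, fun w' hw' => ?_⟩
  rintro z ⟨a, b, ha, hb, hab, rfl⟩
  refine h (mem_thickening_iff.2 ⟨a • c + b • w, ⟨a, b, ha, hb, hab, rfl⟩, ?_⟩)
  rw [dist_add_left, dist_smul₀, Real.norm_of_nonneg hb]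
  have h1 : dist w' w < ε := hw'
  have h2 := dist_nonneg (x := w') (y := w)
  nlinarith

theorem PCov.exists_chart {Ω : Set ℂ} {lam : ℂ → ℝ} {p : ℂ → ℂ} (h : PCov Ω lam p)
    (hn : ∀ z : ℂ, z.im ≠ 0 → z ∈ Ω) : ∃ s, Chart Ω lam p s := by
  set D : Set ℂ := {w | segment ℝ I w ⊆ Ω}
  have hD : IsOpen D := isOpen_starHull h.op I
  have hI : I ∈ Ω := hn I (by simp)
  have hID : I ∈ D := by
    change segment ℝ I I ⊆ Ω
    rw [segment_same]; simpa using hI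
  have hDΩ : D ⊆ Ω := fun w hw => hw (right_mem_segment ℝ I w)
  have hst : StarConvex ℝ I D := by
    rw [starConvex_iff_segment_subset]
    intro w hw z hz
    exact ((convex_segment I w).segment_subset (left_mem_segment ℝ I w) hz).trans hw
  have hP : ∀ z ∈ Ω, 0 ≤ z.im → z ∈ D := by
    intro z hz him
    rintro _ ⟨a, b, ha, hb, hab, rfl⟩
    rcases ha.eq_or_lt with rfl | ha
    · have : b = 1 := by linarith
      simpa [this] using hz
    · refine hn _ ?_
      have : (a • I + b • z).im = a + b * z.im := by simp
      rw [this]; positivity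
  obtain ⟨a, ha, haI⟩ := h.exists_eq hI
  obtain ⟨s, s1, s2, s3, s4⟩ := h.exists_lift (q := id) hD hst hID continuousOn_id hDΩ ha haI
  refine ⟨s, h, hn, fun z hz hi => ?_, fun z hz hi => s2 (hP z hz hi), fun z hz hi =>
    eventually_of_mem (hD.mem_nhds (hP z hz hi)) s4⟩
  have hzD := hD.mem_nhds (hP z hz hi)
  exact h.differentiableAt_lift (s1.continuousAt hzD) (s2 (hP z hz hi)) differentiableAt_id
    (eventually_of_mem hzD s4)

theorem hd_le_div (a b : ℂ) : hd a b ≤ 2 * (‖a - b‖ / (dw a * dw b)) := by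
  unfold hd
  have h0 : 0 ≤ ‖a - b‖ / (dw a * dw b) :=
    div_nonneg (norm_nonneg _) (mul_nonneg (dw_nonneg a) (dw_nonneg b))
  have : Real.arsinh (‖a - b‖ / (dw a * dw b)) ≤ ‖a - b‖ / (dw a * dw b) := by
    rw [← Real.sinh_le_sinh, Real.sinh_arsinh]
    exact Real.self_le_sinh_iff.2 h0
  linarith

theorem continuous_dw : Continuous dw := by unfold dw; fun_prop

namespace PCov

variable {Ω : Set ℂ} {lam : ℂ → ℝ} {p : ℂ → ℂ}

theorem curveLen_nonneg (h : PCov Ω lam p) {γ : ℝ → ℂ} (hγ : ∀ t ∈ Icc (0:ℝ) 1, γ t ∈ Ω) :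
    0 ≤ curveLen lam γ :=
  intervalIntegral.integral_nonneg zero_le_one fun t ht =>
    mul_nonneg (h.lam_pos (hγ t ht)).le (norm_nonneg _)

theorem densityDist_le (h : PCov Ω lam p) {γ : ℝ → ℂ} (h1 : ContDiffOn ℝ 1 γ (Icc 0 1))
    (h2 : ∀ t ∈ Icc (0:ℝ) 1, γ t ∈ Ω) : densityDist Ω lam (γ 0) (γ 1) ≤ curveLen lam γ := by
  refine csInf_le ⟨0, ?_⟩ ⟨γ, h1, rfl, rfl, h2, rfl⟩
  rintro _ ⟨γ', -, -, -, h3, rfl⟩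
  exact h.curveLen_nonneg h3

theorem exists_curve (h : PCov Ω lam p) {a b : ℂ} (ha : a ∈ ball (0:ℂ) 1)
    (hb : b ∈ ball (0:ℂ) 1) : ∃ γ : ℝ → ℂ, ContDiffOn ℝ 1 γ (Icc 0 1) ∧ γ 0 = p a ∧ γ 1 = p b ∧
      (∀ t ∈ Icc (0:ℝ) 1, γ t ∈ Ω) ∧ hd a b = curveLen lam γ := by
  obtain ⟨γ, g1, g2, g3, -, g5, g6⟩ := exists_geodesic ha hb
  set L := hd a b
  have hp : ContDiffOn ℝ 1 p (ball 0 1) :=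
    (h.differentiableOn.contDiffOn isOpen_ball).restrict_scalars ℝ
  refine ⟨fun t => p (γ (L * t)), ?_, ?_, ?_, fun t _ => h.mem (g1 _), ?_⟩
  · exact (hp.comp_contDiff (g5.comp (contDiff_const.mul contDiff_id)) (fun t => g1 _)).contDiffOn
  · simp [g2]
  · simp [g3]
  · have hder : ∀ t : ℝ, HasDerivAt (fun t => p (γ (L * t)))
        (deriv p (γ (L * t)) * (L * deriv γ (L * t))) t := by
      intro t
      have h1 : HasDerivAt γ (deriv γ (L * t)) (L * t) :=
        ((g5.differentiable one_ne_zero) _).hasDerivAt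
      have h2 : HasDerivAt (fun t => L * t) L t := by simpa using (hasDerivAt_id t).const_mul L
      have h3 := h1.scomp t h2
      have h4 := (h.diff _ (g1 (L * t))).hasDerivAt
      have h5 := HasDerivAt.comp_of_eq t h4 h3 rfl
      simpa [Function.comp_def] using h5
    unfold curveLen
    have : ∀ t : ℝ, lam (p (γ (L * t))) * ‖deriv (fun t => p (γ (L * t))) t‖ = L := by
      intro t
      rw [(hder t).deriv, norm_mul, norm_mul, ← mul_assoc, h.dens _ (g1 _)]
      have := g6 (L * t)
      have hL : ‖(L:ℂ)‖ = L := by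
        rw [Complex.norm_real, Real.norm_of_nonneg (hd_nonneg a b)]
      rw [hL]
      calc 2 / (1 - ‖γ (L * t)‖ ^ 2) * (L * ‖deriv γ (L * t)‖)
          = L * (2 / (1 - ‖γ (L * t)‖ ^ 2) * ‖deriv γ (L * t)‖) := by ring
        _ = L := by rw [this, mul_one]
    simp [this]

theorem densityDist_map_le (h : PCov Ω lam p) {a b : ℂ} (ha : a ∈ ball (0:ℂ) 1)
    (hb : b ∈ ball (0:ℂ) 1) : densityDist Ω lam (p a) (p b) ≤ hd a b := by
  obtain ⟨γ, g1, g2, g3, g4, g5⟩ := h.exists_curve ha hb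
  rw [g5, ← g2, ← g3]
  exact h.densityDist_le g1 g4

end PCov

namespace Chart

variable {Ω : Set ℂ} {lam : ℂ → ℝ} {p s : ℂ → ℂ}

theorem conj_mem (h : Chart Ω lam p s) : ∀ z ∈ Ω, conj z ∈ Ω := by
  intro z hz
  by_cases h0 : z.im = 0
  · rwa [conj_eq_iff_im.2 h0]
  · exact h.nonreal _ (by simpa using h0)

theorem fold_mem (h : Chart Ω lam p s) {z : ℂ} (hz : z ∈ Ω) : fold z ∈ Ω := by
  rcases le_total 0 z.im with h0 | h0
  · rwa [fold_of_nonneg h0]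
  · rw [fold_of_nonpos h0]; exact h.conj_mem z hz

theorem sfold_mem (h : Chart Ω lam p s) {z : ℂ} (hz : z ∈ Ω) : s (fold z) ∈ ball (0:ℂ) 1 :=
  h.smem _ (h.fold_mem hz) (fold_im_nonneg z)

theorem p_s (h : Chart Ω lam p s) {z : ℂ} (hz : z ∈ Ω) (hi : 0 ≤ z.im) : p (s z) = z :=
  (h.sect z hz hi).self_of_nhds

theorem p_sfold (h : Chart Ω lam p s) {z : ℂ} (hz : z ∈ Ω) : p (s (fold z)) = fold z :=
  h.p_s (h.fold_mem hz) (fold_im_nonneg z)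

theorem lam_fold (h : Chart Ω lam p s) {z : ℂ} (hz : z ∈ Ω) : lam (fold z) = lam z := by
  rcases le_total 0 z.im with h0 | h0
  · rw [fold_of_nonneg h0]
  · rw [fold_of_nonpos h0, h.lam_conj h.conj_mem hz]

theorem continuousOn_sfold (h : Chart Ω lam p s) : ContinuousOn (fun z => s (fold z)) Ω := by
  intro z hz
  have h1 : ContinuousAt s (fold z) :=
    (h.sdiff _ (h.fold_mem hz) (fold_im_nonneg z)).continuousAt
  exact (ContinuousAt.comp h1 continuous_fold.continuousAt).continuousWithinAt

theorem lam_eq (h : Chart Ω lam p s) {z : ℂ} (hz : z ∈ Ω) (hi : 0 ≤ z.im) :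
    lam z = 2 / (1 - ‖s z‖ ^ 2) * ‖deriv s z‖ := by
  have hm := h.smem z hz hi
  have h1 : deriv p (s z) * deriv s z = 1 := by
    have e1 : HasDerivAt (p ∘ s) (deriv p (s z) * deriv s z) z :=
      (h.diff _ hm).hasDerivAt.comp z (h.sdiff z hz hi).hasDerivAt
    have e2 : HasDerivAt (p ∘ s) 1 z := (hasDerivAt_id z).congr_of_eventuallyEq (h.sect z hz hi)
    exact e1.unique e2
  have h2 := h.dens _ hm
  rw [h.p_s hz hi] at h2
  rw [← h2, mul_assoc, ← norm_mul, h1, norm_one, mul_one]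

end Chart

/-- The pull-back of the distance of the disk under the section `s` precomposed with `fold`. -/
def ed (s : ℂ → ℂ) (z w : ℂ) : ℝ := hd (s (fold z)) (s (fold w))

namespace Chart

variable {Ω : Set ℂ} {lam : ℂ → ℝ} {p s : ℂ → ℂ}

theorem slope_bound (h : Chart Ω lam p s) {γ : ℝ → ℂ} {γ' : ℂ} {x : ℝ} (hx : γ x ∈ Ω)
    (hγ : HasDerivWithinAt γ γ' (Ioi x) x) {r : ℝ} (hr : lam (γ x) * ‖γ'‖ < r) :
    ∀ᶠ t in 𝓝[>] x, ed s (γ x) (γ t) ≤ r * (t - x) := by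
  set c := fold (γ x)
  have hcΩ : c ∈ Ω := h.fold_mem hx
  have hci : 0 ≤ c.im := fold_im_nonneg _
  set a := s c
  have ham : a ∈ ball (0:ℂ) 1 := h.smem c hcΩ hci
  have hγc : ContinuousWithinAt γ (Ioi x) x := hγ.continuousWithinAt
  have hfc : Tendsto (fun t => fold (γ t)) (𝓝[>] x) (𝓝 c) :=
    (continuous_fold.continuousAt.tendsto).comp hγc
  have hsd := (h.sdiff c hcΩ hci)
  have hdwc : Tendsto (fun t => dw (s (fold (γ t)))) (𝓝[>] x) (𝓝 (dw a)) :=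
    (continuous_dw.continuousAt.tendsto.comp hsd.continuousAt.tendsto).comp hfc
  have hdw0 := dw_pos ham
  obtain ⟨η, hη, hη2⟩ : ∃ η > 0, 2 * ((‖deriv s c‖ + η) * (‖γ'‖ + η)) / (dw a * dw a) < r := by
    have hcont : ContinuousAt (fun η : ℝ => 2 * ((‖deriv s c‖ + η) * (‖γ'‖ + η)) / (dw a * dw a))
        0 := by fun_prop
    have hlt : 2 * ((‖deriv s c‖ + 0) * (‖γ'‖ + 0)) / (dw a * dw a) < r := by
      refine lt_of_eq_of_lt ?_ hr
      rw [← h.lam_fold hx, h.lam_eq hcΩ hci, ← sq, dw_sq ham, add_zero, add_zero]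
      ring
    have := (hcont.tendsto.eventually_lt_const hlt).filter_mono (nhdsWithin_le_nhds (s := Ioi 0))
    obtain ⟨η, h1, h2⟩ := (this.and self_mem_nhdsWithin).exists
    exact ⟨η, h2, h1⟩
  have e1 : ∀ᶠ t in 𝓝[>] x, 2 * ((‖deriv s c‖ + η) * (‖γ'‖ + η)) / (dw a * dw (s (fold (γ t))))
      < r := by
    have : Tendsto (fun t => 2 * ((‖deriv s c‖ + η) * (‖γ'‖ + η)) /
        (dw a * dw (s (fold (γ t))))) (𝓝[>] x)
        (𝓝 (2 * ((‖deriv s c‖ + η) * (‖γ'‖ + η)) / (dw a * dw a))) :=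
      tendsto_const_nhds.div (tendsto_const_nhds.mul hdwc) (by positivity)
    exact this.eventually_lt_const hη2
  have e2 : ∀ᶠ w in 𝓝 c, ‖s w - s c‖ ≤ (‖deriv s c‖ + η) * ‖w - c‖ := by
    have h1 := hsd.hasDerivAt.isLittleO.def hη
    filter_upwards [h1] with w hw
    have h2 := norm_add_le (s w - s c - (w - c) • deriv s c) ((w - c) • deriv s c)
    rw [sub_add_cancel, norm_smul] at h2
    nlinarith
  have e3 : ∀ᶠ t in 𝓝[>] x, ‖γ t - γ x‖ ≤ (‖γ'‖ + η) * (t - x) := by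
    have h1 := hγ.isLittleO.def hη
    filter_upwards [h1, self_mem_nhdsWithin] with t ht htx
    have h2 := norm_add_le (γ t - γ x - (t - x) • γ') ((t - x) • γ')
    rw [sub_add_cancel, norm_smul] at h2
    have h3 : ‖t - x‖ = t - x := Real.norm_of_nonneg (sub_nonneg.2 (le_of_lt htx))
    rw [h3] at h2 ht
    nlinarith
  have e4 : ∀ᶠ t in 𝓝[>] x, 0 < dw (s (fold (γ t))) := hdwc.eventually_const_lt hdw0
  filter_upwards [e1, hfc.eventually e2, e3, e4, self_mem_nhdsWithin] with t t1 t2 t3 t4 t5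
  have htx : 0 < t - x := sub_pos.2 t5
  have h1 : ‖s c - s (fold (γ t))‖ ≤ (‖deriv s c‖ + η) * (‖γ'‖ + η) * (t - x) := by
    rw [norm_sub_rev]
    refine t2.trans ?_
    rw [mul_assoc]
    refine mul_le_mul_of_nonneg_left ?_ (by positivity)
    exact (norm_fold_sub_le _ _).trans t3
  refine (hd_le_div _ _).trans ?_
  have h2 := mul_le_mul_of_nonneg_right t1.le htx.le
  refine le_trans ?_ h2
  rw [div_mul_eq_mul_div, ← mul_div_assoc]
  have : 0 < dw a * dw (s (fold (γ t))) := mul_pos hdw0 t4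
  refine div_le_div_of_nonneg_right ?_ this.le
  calc 2 * ‖s c - s (fold (γ t))‖ ≤ 2 * ((‖deriv s c‖ + η) * (‖γ'‖ + η) * (t - x)) := by gcongr
    _ = _ := by ring

theorem continuousOn_hd {X : Type*} [TopologicalSpace X] {f g : X → ℂ} {S : Set X}
    (hf : ContinuousOn f S) (hg : ContinuousOn g S) (mf : MapsTo f S (ball 0 1))
    (mg : MapsTo g S (ball 0 1)) : ContinuousOn (fun x => hd (f x) (g x)) S := by
  unfold hd
  refine continuousOn_const.mul (Real.continuous_arsinh.comp_continuousOn ?_)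
  refine (hf.sub hg).norm.div ?_ fun x hx => (mul_pos (dw_pos (mf hx)) (dw_pos (mg hx))).ne'
  exact (continuous_dw.comp_continuousOn hf).mul (continuous_dw.comp_continuousOn hg)

theorem ed_le_integral (h : Chart Ω lam p s) {γ : ℝ → ℂ} (h1 : ContDiffOn ℝ 1 γ (Icc 0 1))
    (h2 : ∀ t ∈ Icc (0:ℝ) 1, γ t ∈ Ω) {α β : ℝ} (hα : 0 ≤ α) (hαβ : α ≤ β) (hβ : β ≤ 1) :
    ed s (γ α) (γ β) ≤ ∫ t in α..β, lam (γ t) * ‖deriv γ t‖ := by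
  set ρ : ℝ → ℝ := fun t => lam (γ t) * ‖derivWithin γ (Icc 0 1) t‖ with hρ
  have hρc : ContinuousOn ρ (Icc 0 1) :=
    (h.continuousOn_lam.comp h1.continuousOn h2).mul
      (h1.continuousOn_derivWithin (uniqueDiffOn_Icc zero_lt_one) le_rfl).norm
  set R : ℝ → ℝ := IccExtend (zero_le_one' ℝ) ((Icc 0 1).domRestrict ρ) with hR
  have hRc : Continuous R := (continuousOn_iff_continuous_domRestrict.1 hρc).Icc_extend'
  have hRe : ∀ t ∈ Icc (0:ℝ) 1, R t = ρ t := fun t ht => by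
    rw [hR, IccExtend_of_mem _ _ ht]; rfl
  have hint : ∫ t in α..β, lam (γ t) * ‖deriv γ t‖ = ∫ t in α..β, R t := by
    rw [intervalIntegral.integral_of_le hαβ, intervalIntegral.integral_of_le hαβ,
      MeasureTheory.integral_Ioc_eq_integral_Ioo, MeasureTheory.integral_Ioc_eq_integral_Ioo]
    refine MeasureTheory.setIntegral_congr_fun measurableSet_Ioo fun t ht => ?_
    have ht' : t ∈ Ioo (0:ℝ) 1 := ⟨hα.trans_lt ht.1, ht.2.trans_le hβ⟩
    simp only [hRe t (Ioo_subset_Icc_self ht'), hρ,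
      derivWithin_of_mem_nhds (Icc_mem_nhds ht'.1 ht'.2)]
  rw [hint]
  have hsub : Icc α β ⊆ Icc 0 1 := Icc_subset_Icc hα hβ
  have hαm : α ∈ Icc (0:ℝ) 1 := ⟨hα, hαβ.trans hβ⟩
  have hfc : ContinuousOn (fun t => ed s (γ α) (γ t)) (Icc α β) :=
    continuousOn_hd continuousOn_const
      (h.continuousOn_sfold.comp (h1.continuousOn.mono hsub) fun t ht => h2 t (hsub ht))
      (fun t _ => h.sfold_mem (h2 α hαm)) fun t ht => h.sfold_mem (h2 t (hsub ht))
  have hB : ∀ x : ℝ, HasDerivAt (fun x => ∫ t in α..x, R t) (R x) x := fun x =>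
    (hRc.integral_hasStrictDerivAt α x).hasDerivAt
  refine image_le_of_liminf_slope_right_le_deriv_boundary hfc (by simp [ed])
    (fun x _ => (hB x).continuousAt.continuousWithinAt) (fun x _ => (hB x).hasDerivWithinAt)
    ?_ ⟨hαβ, le_rfl⟩
  intro x hx r hr
  have hx1 : x ∈ Icc (0:ℝ) 1 := hsub (Ico_subset_Icc_self hx)
  have hd1 : HasDerivWithinAt γ (derivWithin γ (Icc 0 1) x) (Ioi x) x := by
    have := (h1.differentiableOn one_ne_zero x hx1).hasDerivWithinAt
    refine this.mono_of_mem_nhdsWithin ?_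
    exact mem_of_superset (Ioc_mem_nhdsGT (hx.2.trans_le hβ))
      fun t ht => ⟨hx1.1.trans ht.1.le, ht.2⟩
  rw [hRe x hx1] at hr
  obtain ⟨r', hr1, hr2⟩ := exists_between hr
  have hev := h.slope_bound (h2 x hx1) hd1 hr1
  have hin : ∀ᶠ t in 𝓝[>] x, t ∈ Ioc x β := Ioc_mem_nhdsGT hx.2
  refine Eventually.frequently ?_
  filter_upwards [hev, hin] with t ht ht2
  have htx : 0 < t - x := sub_pos.2 ht2.1
  have htm : t ∈ Icc (0:ℝ) 1 := ⟨hx1.1.trans ht2.1.le, ht2.2.trans hβ⟩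
  rw [slope_def_field, div_lt_iff₀ htx]
  have htri := hd_triangle (h.sfold_mem (h2 α hαm)) (h.sfold_mem (h2 x hx1))
    (h.sfold_mem (h2 t htm))
  have : r' * (t - x) < r * (t - x) := mul_lt_mul_of_pos_right hr2 htx
  simp only [ed] at ht ⊢
  linarith

theorem ed_le_dist (h : Chart Ω lam p s) {z w : ℂ} (hz : z ∈ Ω) (hw : w ∈ Ω) :
    ed s z w ≤ densityDist Ω lam z w := by
  obtain ⟨a, ha, rfl⟩ := h.exists_eq hz
  obtain ⟨b, hb, rfl⟩ := h.exists_eq hw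
  obtain ⟨γ, g1, g2, g3, g4, g5⟩ := h.exists_curve ha hb
  refine le_csInf ⟨_, γ, g1, g2, g3, g4, rfl⟩ ?_
  rintro _ ⟨γ', h1, h2, h3, h4, rfl⟩
  rw [← h2, ← h3]
  exact h.ed_le_integral h1 h4 le_rfl zero_le_one le_rfl

theorem dist_le_ed_of_nonneg (h : Chart Ω lam p s) {z w : ℂ} (hz : z ∈ Ω) (hw : w ∈ Ω)
    (hzi : 0 ≤ z.im) (hwi : 0 ≤ w.im) : densityDist Ω lam z w ≤ ed s z w := by
  have := h.densityDist_map_le (h.sfold_mem hz) (h.sfold_mem hw)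
  rw [h.p_sfold hz, h.p_sfold hw] at this
  rwa [ed, fold_of_nonneg hzi, fold_of_nonneg hwi] at *

theorem dist_le_ed_of_nonpos (h : Chart Ω lam p s) {z w : ℂ} (hz : z ∈ Ω) (hw : w ∈ Ω)
    (hzi : z.im ≤ 0) (hwi : w.im ≤ 0) : densityDist Ω lam z w ≤ ed s z w := by
  obtain ⟨a, ha, haz⟩ := h.exists_eq hz
  obtain ⟨J, -, J2, J3, J4, J5⟩ := h.exists_reflection h.conj_mem (h.sfold_mem hz) ha
    (by rw [haz, h.p_sfold hz, fold_of_nonpos hzi, conj_conj])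
  have h1 := h.densityDist_map_le (J2 (h.sfold_mem hz)) (J2 (h.sfold_mem hw))
  refine le_trans ?_ (J5 _ (h.sfold_mem hz) _ (h.sfold_mem hw))
  rwa [J4 _ (h.sfold_mem hz), J4 _ (h.sfold_mem hw), h.p_sfold hz, h.p_sfold hw,
    fold_of_nonpos hzi, fold_of_nonpos hwi, conj_conj, conj_conj] at *

theorem dist_eq_of_nonneg (h : Chart Ω lam p s) {z w : ℂ} (hz : z ∈ Ω) (hw : w ∈ Ω)
    (hzi : 0 ≤ z.im) (hwi : 0 ≤ w.im) : densityDist Ω lam z w = ed s z w :=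
  (h.dist_le_ed_of_nonneg hz hw hzi hwi).antisymm (h.ed_le_dist hz hw)

theorem dist_eq_of_nonpos (h : Chart Ω lam p s) {z w : ℂ} (hz : z ∈ Ω) (hw : w ∈ Ω)
    (hzi : z.im ≤ 0) (hwi : w.im ≤ 0) : densityDist Ω lam z w = ed s z w :=
  (h.dist_le_ed_of_nonpos hz hw hzi hwi).antisymm (h.ed_le_dist hz hw)

theorem ed_triangle (h : Chart Ω lam p s) {x y z : ℂ} (hx : x ∈ Ω) (hy : y ∈ Ω) (hz : z ∈ Ω) :
    ed s x z ≤ ed s x y + ed s y z :=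
  hd_triangle (h.sfold_mem hx) (h.sfold_mem hy) (h.sfold_mem hz)

theorem ed_comm (x y : ℂ) : ed s x y = ed s y x := hd_comm _ _

theorem dist_le_glue (h : Chart Ω lam p s) {z w b : ℂ} (hz : z ∈ Ω) (hw : w ∈ Ω) (hb : b ∈ Ω)
    (hbi : b.im = 0) : densityDist Ω lam z w ≤ ed s z b + ed s b w := by
  have hbf : fold b = b := fold_of_nonneg hbi.ge
  obtain ⟨J, -, J2, J3, J4, J5⟩ := h.exists_reflection h.conj_mem (h.sfold_mem hb)
    (h.sfold_mem hb) (by rw [h.p_sfold hb, hbf, conj_eq_iff_im.2 hbi])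
  rcases le_total 0 z.im with hzi | hzi <;> rcases le_total 0 w.im with hwi | hwi
  · exact (h.dist_le_ed_of_nonneg hz hw hzi hwi).trans (h.ed_triangle hz hb hw)
  · have h1 := h.densityDist_map_le (h.sfold_mem hz) (J2 (h.sfold_mem hw))
    rw [J4 _ (h.sfold_mem hw), h.p_sfold hz, h.p_sfold hw, fold_of_nonneg hzi,
      fold_of_nonpos hwi, conj_conj] at h1
    refine h1.trans ((hd_triangle (h.smem z hz hzi) (h.sfold_mem hb)
      (J2 (h.smem _ (h.conj_mem w hw) (by simpa using hwi)))).trans ?_)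
    refine add_le_add (by rw [ed, fold_of_nonneg hzi]) ?_
    have h2 := J5 _ (h.sfold_mem hb) _ (h.sfold_mem hw)
    rw [J3, fold_of_nonpos hwi] at h2
    rwa [ed, fold_of_nonpos hwi]
  · have h1 := h.densityDist_map_le (J2 (h.sfold_mem hz)) (h.sfold_mem hw)
    rw [J4 _ (h.sfold_mem hz), h.p_sfold hz, h.p_sfold hw, fold_of_nonneg hwi,
      fold_of_nonpos hzi, conj_conj] at h1
    refine h1.trans ((hd_triangle (J2 (h.smem _ (h.conj_mem z hz) (by simpa using hzi)))
      (h.sfold_mem hb) (h.smem w hw hwi)).trans ?_)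
    refine add_le_add ?_ (by rw [ed, fold_of_nonneg hwi])
    have h2 := J5 _ (h.sfold_mem hz) _ (h.sfold_mem hb)
    rw [J3, fold_of_nonpos hzi] at h2
    rwa [ed, fold_of_nonpos hzi]
  · exact (h.dist_le_ed_of_nonpos hz hw hzi hwi).trans (h.ed_triangle hz hb hw)

theorem exists_glue_of_opposite (h : Chart Ω lam p s) {z w : ℂ} (hz : z ∈ Ω) (hw : w ∈ Ω)
    (hzw : z.im * w.im ≤ 0) {ε : ℝ} (hε : 0 < ε) :
    ∃ b ∈ Ω, b.im = 0 ∧ ed s z b + ed s b w ≤ densityDist Ω lam z w + ε := by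
  obtain ⟨a, ha, rfl⟩ := h.exists_eq hz
  obtain ⟨c, hc, rfl⟩ := h.exists_eq hw
  obtain ⟨γ, g1, g2, g3, g4, g5⟩ := h.exists_curve ha hc
  obtain ⟨_, ⟨γ, h1, h2, h3, h4, rfl⟩, h5⟩ := exists_lt_of_csInf_lt
    (⟨_, γ, g1, g2, g3, g4, rfl⟩ : { L | ∃ γ : ℝ → ℂ, ContDiffOn ℝ 1 γ (Icc 0 1) ∧ γ 0 = p a ∧
      γ 1 = p c ∧ (∀ t ∈ Icc (0:ℝ) 1, γ t ∈ Ω) ∧ L = curveLen lam γ }.Nonempty)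
    (lt_add_of_pos_right (densityDist Ω lam (p a) (p c)) hε)
  have hcont : ContinuousOn (fun t => (γ t).im) (Icc 0 1) :=
    continuous_im.comp_continuousOn h1.continuousOn
  obtain ⟨t, ht, ht0⟩ : ∃ t ∈ Icc (0:ℝ) 1, (γ t).im = 0 := by
    rw [← h2, ← h3] at hzw
    rcases le_total 0 (γ 0).im with h0 | h0
    · rcases h0.eq_or_lt with h0 | h0
      · exact ⟨0, by simp, h0.symm⟩
      · have : (γ 1).im ≤ 0 := by nlinarith
        exact intermediate_value_Icc' zero_le_one hcont ⟨this, h0.le⟩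
    · rcases h0.eq_or_lt with h0 | h0
      · exact ⟨0, by simp, h0⟩
      · have : 0 ≤ (γ 1).im := by nlinarith
        exact intermediate_value_Icc zero_le_one hcont ⟨h0.le, this⟩
  refine ⟨γ t, h4 t ht, ht0, ?_⟩
  have i1 := h.ed_le_integral h1 h4 le_rfl ht.1 ht.2
  have i2 := h.ed_le_integral h1 h4 ht.1 ht.2 le_rfl
  rw [h2] at i1
  rw [h3] at i2
  by_cases hi : IntervalIntegrable (fun t => lam (γ t) * ‖deriv γ t‖) MeasureTheory.volume 0 1
  · have := intervalIntegral.integral_add_adjacent_intervals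
      (hi.mono_set (by rw [uIcc_of_le ht.1, uIcc_of_le zero_le_one]; exact Icc_subset_Icc_right ht.2))
      (hi.mono_set (by rw [uIcc_of_le ht.2, uIcc_of_le zero_le_one]; exact Icc_subset_Icc_left ht.1))
    unfold curveLen at h5
    linarith
  · exfalso
    apply hi
    have hρc : ContinuousOn (fun t => lam (γ t) * ‖derivWithin γ (Icc 0 1) t‖) (uIcc 0 1) := by
      rw [uIcc_of_le zero_le_one]
      exact (h.continuousOn_lam.comp h1.continuousOn h4).mul
        (h1.continuousOn_derivWithin (uniqueDiffOn_Icc zero_lt_one) le_rfl).norm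
    have hii := hρc.intervalIntegrable (μ := MeasureTheory.volume)
    rw [intervalIntegrable_iff_integrableOn_Ioo_of_le zero_le_one] at hii ⊢
    refine hii.congr_fun (fun t ht => ?_) measurableSet_Ioo
    simp only [derivWithin_of_mem_nhds (Icc_mem_nhds ht.1 ht.2)]

theorem dist_comm' (h : Chart Ω lam p s) {z w : ℂ} (hz : z ∈ Ω) (hw : w ∈ Ω) :
    densityDist Ω lam z w = densityDist Ω lam w z := by
  have key : ∀ z ∈ Ω, ∀ w ∈ Ω, densityDist Ω lam z w ≤ densityDist Ω lam w z := by
    intro z hz w hw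
    rcases le_total (w.im * z.im) 0 with h0 | h0
    · refine le_of_forall_pos_le_add fun ε hε => ?_
      obtain ⟨b, hb, hbi, h1⟩ := h.exists_glue_of_opposite hw hz h0 hε
      refine (h.dist_le_glue hz hw hb hbi).trans ?_
      rw [ed_comm z b, ed_comm b w, add_comm]
      exact h1
    · rcases mul_nonneg_iff.1 h0 with ⟨h1, h2⟩ | ⟨h1, h2⟩
      · rw [h.dist_eq_of_nonneg hz hw h2 h1, h.dist_eq_of_nonneg hw hz h1 h2, ed_comm]
      · rw [h.dist_eq_of_nonpos hz hw h2 h1, h.dist_eq_of_nonpos hw hz h1 h2, ed_comm]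
  exact (key z hz w hw).antisymm (key w hw z hz)

end Chart

namespace Chart

variable {Ω : Set ℂ} {lam : ℂ → ℝ} {p s : ℂ → ℂ}

theorem hd_fold_le (h : Chart Ω lam p s) {a b : ℂ} (ha : a ∈ ball (0:ℂ) 1)
    (hb : b ∈ ball (0:ℂ) 1) : hd (s (fold (p a))) (s (fold (p b))) ≤ hd a b :=
  (h.ed_le_dist (h.mem ha) (h.mem hb)).trans (h.densityDist_map_le ha hb)

/-- The image of the closed upper half plane under the section is geodesically convex. -/
theorem section_of_between (h : Chart Ω lam p s) {z w ζ : ℂ} (hz : z ∈ Ω) (hw : w ∈ Ω)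
    (hzi : 0 ≤ z.im) (hwi : 0 ≤ w.im) (hζ : ζ ∈ ball (0:ℂ) 1)
    (hb : hd (s z) ζ + hd ζ (s w) ≤ hd (s z) (s w)) : 0 ≤ (p ζ).im ∧ s (p ζ) = ζ := by
  have hzm := h.smem z hz hzi
  have hwm := h.smem w hw hwi
  have hfm := h.sfold_mem (h.mem hζ)
  have h1 := h.hd_fold_le hzm hζ
  have h2 := h.hd_fold_le hζ hwm
  rw [h.p_s hz hzi, fold_of_nonneg hzi] at h1
  rw [h.p_s hw hwi, fold_of_nonneg hwi] at h2
  have h3 := hd_triangle hzm hfm hwm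
  have key : s (fold (p ζ)) = ζ :=
    hd_between_unique hzm hwm hfm hζ (by linarith) hb (by linarith)
  have h4 := h.p_sfold (h.mem hζ)
  rw [key] at h4
  have h5 : 0 ≤ (p ζ).im := by rw [h4]; exact fold_im_nonneg _
  exact ⟨h5, by rwa [fold_of_nonneg h5] at key⟩

theorem exists_upper_geodesic (h : Chart Ω lam p s) {z w : ℂ} (hz : z ∈ Ω) (hw : w ∈ Ω)
    (hzi : 0 ≤ z.im) (hwi : 0 ≤ w.im) :
    ∃ γ : ℝ → ℂ, (∀ t, γ t ∈ ball (0:ℂ) 1) ∧ γ 0 = s z ∧ γ (hd (s z) (s w)) = s w ∧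
      (∀ t t', hd (γ t) (γ t') = |t - t'|) ∧ ContDiff ℝ 1 γ ∧
      ∀ t ∈ Icc 0 (hd (s z) (s w)), 0 ≤ (p (γ t)).im ∧ s (p (γ t)) = γ t := by
  obtain ⟨γ, g1, g2, g3, g4, g5, -⟩ := exists_geodesic (h.smem z hz hzi) (h.smem w hw hwi)
  refine ⟨γ, g1, g2, g3, g4, g5, fun t ht => h.section_of_between hz hw hzi hwi (g1 t) ?_⟩
  have e1 := g4 0 t
  have e2 := g4 t (hd (s z) (s w))
  rw [g2, zero_sub, abs_neg, abs_of_nonneg ht.1] at e1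
  rw [g3, abs_sub_comm, abs_of_nonneg (sub_nonneg.2 ht.2)] at e2
  linarith

theorem ed_of_nonneg {z w : ℂ} (hzi : 0 ≤ z.im) (hwi : 0 ≤ w.im) : ed s z w = hd (s z) (s w) := by
  rw [ed, fold_of_nonneg hzi, fold_of_nonneg hwi]

theorem exists_between (h : Chart Ω lam p s) {z w : ℂ} (hz : z ∈ Ω) (hw : w ∈ Ω)
    (hzi : 0 ≤ z.im) (hwi : 0 ≤ w.im) {r : ℝ} (hr : r ∈ Icc 0 (ed s z w)) :
    ∃ m ∈ Ω, 0 ≤ m.im ∧ ed s z m = r ∧ ed s m w = ed s z w - r := by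
  obtain ⟨γ, g1, g2, g3, g4, g5, g6⟩ := h.exists_upper_geodesic hz hw hzi hwi
  have he := ed_of_nonneg (s := s) hzi hwi
  rw [← he] at g3 g6
  obtain ⟨h1, h2⟩ := g6 r hr
  refine ⟨p (γ r), h.mem (g1 r), h1, ?_, ?_⟩
  · rw [ed_of_nonneg hzi h1, h2, ← g2, g4, zero_sub, abs_neg, abs_of_nonneg hr.1]
  · rw [ed_of_nonneg h1 hwi, h2, ← g3, g4, abs_sub_comm, abs_of_nonneg (sub_nonneg.2 hr.2)]

/-- A geodesic in the closed upper half plane joining the end points of a real segment contained in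
the domain is real. -/
theorem im_eq_zero_of_between (h : Chart Ω lam p s) {x y : ℝ}
    (hseg : ∀ r ∈ uIcc x y, (r:ℂ) ∈ Ω) {m : ℂ} (hm : m ∈ Ω) (hmi : 0 ≤ m.im)
    (hb : ed s x m + ed s m y ≤ ed s x y) : m.im = 0 := by
  have hx := hseg x left_mem_uIcc
  have hsr : ∀ r ∈ uIcc x y, s r ∈ ball (0:ℂ) 1 := fun r hr => h.smem r (hseg r hr) (by simp)
  have hsm := h.smem m hm hmi
  obtain ⟨J, J1, J2, J3, J4, J5⟩ := h.exists_reflection h.conj_mem (hsr x left_mem_uIcc)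
    (hsr x left_mem_uIcc) (by rw [h.p_s hx (by simp), conj_ofReal])
  have hcs : ContinuousOn (fun r : ℝ => s r) (uIcc x y) := fun r hr =>
    (ContinuousAt.comp (f := fun r : ℝ => (r:ℂ)) (h.sdiff r (hseg r hr) (by simp)).continuousAt
      continuous_ofReal.continuousAt).continuousWithinAt
  have heq : EqOn (fun r : ℝ => J (s r)) (fun r => s r) (uIcc x y) :=
    h.eqOn_of_lift (isPreconnected_uIcc) (J1.comp hcs hsr) hcs (fun r hr => J2 (hsr r hr)) hsr
      (fun r hr => by
        rw [J4 _ (hsr r hr), h.p_s (hseg r hr) (by simp), conj_ofReal])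
      left_mem_uIcc J3
  have hJy : J (s y) = s y := heq right_mem_uIcc
  rw [ed_of_nonneg (by simp) hmi, ed_of_nonneg hmi (by simp), ed_of_nonneg (by simp) (by simp)]
    at hb
  have k1 := J5 _ (hsr x left_mem_uIcc) _ hsm
  have k2 := J5 _ hsm _ (hsr y right_mem_uIcc)
  rw [J3] at k1
  rw [hJy] at k2
  have k3 := hd_triangle (hsr x left_mem_uIcc) (J2 hsm) (hsr y right_mem_uIcc)
  have k4 : J (s m) = s m := hd_between_unique (hsr x left_mem_uIcc) (hsr y right_mem_uIcc)
    (J2 hsm) hsm (by linarith) hb (by linarith)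
  have k5 := J4 _ hsm
  rw [k4, h.p_s hm hmi] at k5
  exact conj_eq_iff_im.1 k5.symm

theorem isGeodesicIn_upper (h : Chart Ω lam p s) {z w : ℂ} (hz : z ∈ Ω) (hw : w ∈ Ω)
    (hzi : 0 ≤ z.im) (hwi : 0 ≤ w.im) {γ : ℝ → ℂ} (g1 : ∀ t, γ t ∈ ball (0:ℂ) 1) (g2 : γ 0 = s z)
    (g3 : γ (hd (s z) (s w)) = s w) (g4 : ∀ t t', hd (γ t) (γ t') = |t - t'|)
    (g6 : ∀ t ∈ Icc 0 (hd (s z) (s w)), 0 ≤ (p (γ t)).im ∧ s (p (γ t)) = γ t) :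
    IsGeodesicIn Ω (densityDist Ω lam) (fun t => p (γ t)) z w ∧
      IsGeodesicIn Ω (densityDist Ω lam) (fun t => conj (p (γ t))) (conj z) (conj w) := by
  have he := ed_of_nonneg (s := s) hzi hwi
  have hd1 := h.dist_eq_of_nonneg hz hw hzi hwi
  have hcz := h.conj_mem z hz
  have hcw := h.conj_mem w hw
  have hd2 := h.dist_eq_of_nonpos hcz hcw (by simpa using hzi) (by simpa using hwi)
  rw [ed, fold_of_nonpos (by simpa using hzi), fold_of_nonpos (by simpa using hwi), conj_conj,
    conj_conj] at hd2
  have g0 : p (γ 0) = z := by rw [g2, h.p_s hz hzi]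
  have gL : p (γ (hd (s z) (s w))) = w := by rw [g3, h.p_s hw hwi]
  refine ⟨⟨g0, by rw [hd1, he]; exact gL, fun t _ => h.mem (g1 t), fun t ht t' ht' => ?_⟩,
    ⟨by simp only [g0], by simp only [hd2, gL], fun t _ => h.conj_mem _ (h.mem (g1 t)),
      fun t ht t' ht' => ?_⟩⟩
  · rw [hd1, he] at ht ht'
    rw [h.dist_eq_of_nonneg (h.mem (g1 t)) (h.mem (g1 t')) (g6 t ht).1 (g6 t' ht').1,
      ed_of_nonneg (g6 t ht).1 (g6 t' ht').1, (g6 t ht).2, (g6 t' ht').2, g4]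
  · rw [hd2] at ht ht'
    have i1 : (conj (p (γ t))).im ≤ 0 := by simpa using (g6 t ht).1
    have i2 : (conj (p (γ t'))).im ≤ 0 := by simpa using (g6 t' ht').1
    rw [h.dist_eq_of_nonpos (h.conj_mem _ (h.mem (g1 t))) (h.conj_mem _ (h.mem (g1 t'))) i1 i2,
      ed, fold_of_nonpos i1, fold_of_nonpos i2, conj_conj, conj_conj, (g6 t ht).2, (g6 t' ht').2,
      g4]

theorem ed_four_point (h : Chart Ω lam p s) : ∀ x ∈ Ω, ∀ y ∈ Ω, ∀ z ∈ Ω, ∀ w ∈ Ω,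
    ed s x y + ed s z w ≤ max (ed s x z + ed s y w) (ed s x w + ed s y z) + hdK := by
  intro x hx y hy z hz w hw
  have := hd_four_point (h.sfold_mem hx) (h.sfold_mem hz) (h.sfold_mem hy) (h.sfold_mem hw)
  simp only [ed]
  rw [hd_comm (s (fold z)) (s (fold y))] at this
  rw [add_comm (hd _ (s (fold w)))]
  exact this

theorem ed_nonneg (x y : ℂ) : 0 ≤ ed s x y := hd_nonneg _ _

/-- If the upper half of every bigon between real points stays close to the real points, then
the domain is Gromov hyperbolic. -/
theorem isGromovHyperbolic_of_near (h : Chart Ω lam p s) (hne : ∃ b ∈ Ω, b.im = 0) {c : ℝ}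
    (hc : 0 ≤ c)
    (hD : ∀ x y : ℝ, (x:ℂ) ∈ Ω → (y:ℂ) ∈ Ω → ∀ m ∈ Ω, 0 ≤ m.im →
      ed s x m + ed s m y ≤ ed s x y → ∃ b : ℝ, (b:ℂ) ∈ Ω ∧ ed s m b ≤ c) :
    IsGromovHyperbolic Ω (densityDist Ω lam) := by
  classical
  obtain ⟨K', hK', h4⟩ := fourPoint_of_glued (S := Ω) (B := {b ∈ Ω | b.im = 0})
    (d := densityDist Ω lam) (e := ed s) (σ := fun z => decide (0 ≤ z.im)) hdK_nonneg hc
    (fun z hz => hz.1) hne ed_nonneg ed_comm (fun x hx y hy z hz => h.ed_triangle hx hy hz)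
    h.ed_four_point (fun x hx y hy => h.dist_comm' hx hy)
    (fun x hx y hy hσ => by
      simp only [decide_eq_decide] at hσ
      by_cases h0 : 0 ≤ x.im
      · exact h.dist_eq_of_nonneg hx hy h0 (hσ.1 h0)
      · have h1 : ¬ 0 ≤ y.im := fun h1 => h0 (hσ.2 h1)
        exact h.dist_eq_of_nonpos hx hy (not_le.1 h0).le (not_le.1 h1).le)
    (fun x hx y hy => h.ed_le_dist hx hy)
    (fun x hx y hy b hb => h.dist_le_glue hx hy hb.1 hb.2)
    (fun x hx y hy hσ => by
      have : x.im * y.im ≤ 0 := by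
        by_cases h0 : 0 ≤ x.im <;> by_cases h1 : 0 ≤ y.im
        · simp [h0, h1] at hσ
        · nlinarith
        · nlinarith
        · simp [h0, h1] at hσ
      obtain ⟨b, b1, b2, b3⟩ := h.exists_glue_of_opposite hx hy this one_pos
      exact ⟨b, ⟨b1, b2⟩, b3⟩)
    (fun b₁ hb₁ b₂ hb₂ r hr => by
      obtain ⟨m, m1, m2, m3, m4⟩ := h.exists_between hb₁.1 hb₂.1 hb₁.2.ge hb₂.2.ge hr
      have e1 : ((b₁.re : ℝ) : ℂ) = b₁ := Complex.ext rfl (by simp [hb₁.2])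
      have e2 : ((b₂.re : ℝ) : ℂ) = b₂ := Complex.ext rfl (by simp [hb₂.2])
      obtain ⟨b, b1, b2⟩ := hD b₁.re b₂.re (e1 ▸ hb₁.1) (e2 ▸ hb₂.1) m m1 m2
        (by rw [e1, e2, m3, m4]; linarith)
      exact ⟨m, m1, m3, m4, b, ⟨b1, by simp⟩, b2⟩)
  exact ⟨2 * K', by positivity, gromovHyperbolicWith_of_fourPoint hK'
    (fun x hx y hy => (ed_nonneg x y).trans (h.ed_le_dist hx hy))
    (fun x hx y hy => h.dist_comm' hx hy) h4⟩

theorem exists_between_near (h : Chart Ω lam p s) {x y u : ℂ} (hx : x ∈ Ω) (hy : y ∈ Ω)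
    (hu : u ∈ Ω) (hxi : 0 ≤ x.im) (hyi : 0 ≤ y.im) {η : ℝ} (hη : 0 ≤ η)
    (hb : ed s x u + ed s u y ≤ ed s x y + η) :
    ∃ v ∈ Ω, 0 ≤ v.im ∧ ed s x v + ed s v y ≤ ed s x y ∧ ed s u v ≤ η + hdK := by
  obtain ⟨v, v1, v2, v3, v4⟩ := h.exists_between hx hy hxi hyi
    (r := min (ed s x u) (ed s x y)) ⟨le_min (ed_nonneg _ _) (ed_nonneg _ _), min_le_right _ _⟩
  refine ⟨v, v1, v2, by linarith, ?_⟩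
  have hfour := h.ed_four_point u hu v v1 x hx y hy
  rw [ed_comm u x, v4, ed_comm v x, v3] at hfour
  have m1 := min_le_left (ed s x u) (ed s x y)
  rcases le_max_iff.1 (sub_le_iff_le_add.2 hfour) with q | q
  · rcases min_choice (ed s x u) (ed s x y) with hm | hm <;> rw [hm] at q
    · linarith
    · have := ed_nonneg (s := s) u y
      linarith
  · linarith

/-- In a domain which is not Gromov hyperbolic and contains the negative half-line, there are
points far from the real axis on geodesics joining positive points. -/
theorem exists_far (h : Chart Ω lam p s) (hneg : ∀ r : ℝ, r < 0 → (r:ℂ) ∈ Ω)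
    (hnot : ¬ IsGromovHyperbolic Ω (densityDist Ω lam)) (R : ℝ) :
    ∃ x y : ℝ, (x:ℂ) ∈ Ω ∧ (y:ℂ) ∈ Ω ∧ 0 < x ∧ x < y ∧ ∃ u ∈ Ω, 0 ≤ u.im ∧
      ed s x u + ed s u y ≤ ed s x y ∧ ∀ b : ℝ, (b:ℂ) ∈ Ω → R < ed s u b := by
  by_contra! hcon
  apply hnot
  have hm1 : ((-1:ℝ):ℂ) ∈ Ω := hneg _ (by norm_num)
  have hle : ∀ x y : ℝ, x ≤ 0 → y ≤ 0 → (x:ℂ) ∈ Ω → (y:ℂ) ∈ Ω →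
      ∀ r ∈ uIcc x y, (r:ℂ) ∈ Ω := by
    intro x y hx hy hxΩ hyΩ r hr
    by_cases hr0 : r < 0
    · exact hneg r hr0
    · rcases le_total x y with hxy | hxy
      · rw [uIcc_of_le hxy] at hr
        have : r = y := by linarith [hr.2]
        rwa [this]
      · rw [uIcc_of_ge hxy] at hr
        have : r = x := by linarith [hr.2]
        rwa [this]
  have hself : ∀ m ∈ Ω, m.im = 0 → ∃ b : ℝ, (b:ℂ) ∈ Ω ∧ ed s m b ≤ 0 := by
    intro m hm h0
    have e1 : ((m.re : ℝ) : ℂ) = m := Complex.ext rfl (by simp [h0])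
    exact ⟨m.re, e1.symm ▸ hm, by rw [e1, ed, hd_self]⟩
  have hpos : ∃ c, 0 ≤ c ∧ ∀ x y : ℝ, (x:ℂ) ∈ Ω → (y:ℂ) ∈ Ω → 0 < x → 0 < y →
      ∀ m ∈ Ω, 0 ≤ m.im → ed s x m + ed s m y ≤ ed s x y → ∃ b : ℝ, (b:ℂ) ∈ Ω ∧ ed s m b ≤ c := by
    refine ⟨max R 0, le_max_right _ _, fun x y hx hy hx0 hy0 m hm hmi hb => ?_⟩
    rcases lt_trichotomy x y with hxy | rfl | hxy
    · obtain ⟨b, b1, b2⟩ := hcon x y hx hy hx0 hxy m hm hmi hb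
      exact ⟨b, b1, b2.trans (le_max_left _ _)⟩
    · have h1 : m.im = 0 := h.im_eq_zero_of_between (x := x) (y := x) (by simpa using hx) hm hmi hb
      obtain ⟨b, b1, b2⟩ := hself m hm h1
      exact ⟨b, b1, b2.trans (le_max_right _ _)⟩
    · obtain ⟨b, b1, b2⟩ := hcon y x hy hx hy0 hxy m hm hmi
        (by rw [ed_comm (y:ℂ) m, ed_comm m x, ed_comm (y:ℂ) x]; linarith)
      exact ⟨b, b1, b2.trans (le_max_left _ _)⟩
  obtain ⟨c, hc, hpos⟩ := hpos
  have hmixed : ∃ c', 0 ≤ c' ∧ ∀ x y : ℝ, (x:ℂ) ∈ Ω → (y:ℂ) ∈ Ω → x ≤ 0 → 0 < y →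
      ∀ m ∈ Ω, 0 ≤ m.im → ed s x m + ed s m y ≤ ed s x y →
        ∃ b : ℝ, (b:ℂ) ∈ Ω ∧ ed s m b ≤ c' := by
    by_cases hB : ∃ y₁ : ℝ, 0 < y₁ ∧ (y₁:ℂ) ∈ Ω
    · obtain ⟨y₁, hy₁, hy₁Ω⟩ := hB
      set E := ed s (-1:ℝ) y₁
      have hE0 : 0 ≤ E := ed_nonneg _ _
      refine ⟨2 * hdK + c + 2 * E, by linarith [hdK_nonneg], ?_⟩
      intro x y hx hy hx0 hy0 m hm hmi hb
      have hfour := h.ed_four_point m hm y₁ hy₁Ω x hx y hy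
      rw [ed_comm m x] at hfour
      rcases le_max_iff.1 (sub_le_iff_le_add.2 hfour) with q | q
      · obtain ⟨v, v1, v2, v3, v4⟩ := h.exists_between_near hy₁Ω hy hm (by simp) (by simp)
          hdK_nonneg (by rw [ed_comm (y₁:ℂ) m]; linarith)
        obtain ⟨b, b1, b2⟩ := hpos y₁ y hy₁Ω hy hy₁ hy0 v v1 v2 v3
        refine ⟨b, b1, ?_⟩
        have := h.ed_triangle hm v1 b1
        linarith
      · have t4 := h.ed_triangle hm hy₁Ω hm1
        rw [ed_comm (y₁:ℂ) ((-1:ℝ):ℂ)] at t4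
        have t5 := h.ed_triangle hy₁Ω hm1 hx
        rw [ed_comm (y₁:ℂ) ((-1:ℝ):ℂ)] at t5
        obtain ⟨v, v1, v2, v3, v4⟩ := h.exists_between_near (η := 2 * E + hdK) hm1 hx hm (by simp)
          (by simp) (by linarith [hdK_nonneg])
          (by rw [ed_comm ((-1:ℝ):ℂ) m, ed_comm m x]; linarith)
        obtain ⟨b, b1, b2⟩ := hself v v1 (h.im_eq_zero_of_between
          (hle (-1) x (by norm_num) hx0 hm1 hx) v1 v2 v3)
        refine ⟨b, b1, ?_⟩
        have := h.ed_triangle hm v1 b1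
        linarith
    · refine ⟨0, le_rfl, fun x y hx hy hx0 hy0 => absurd ⟨y, hy0, hy⟩ hB⟩
  obtain ⟨c', hc', hmixed⟩ := hmixed
  refine h.isGromovHyperbolic_of_near ⟨_, hm1, by simp⟩ (le_max_of_le_left hc : 0 ≤ max c c') ?_
  intro x y hx hy m hm hmi hb
  rcases le_or_gt x 0 with hx0 | hx0 <;> rcases le_or_gt y 0 with hy0 | hy0
  · obtain ⟨b, b1, b2⟩ := hself m hm (h.im_eq_zero_of_between (hle x y hx0 hy0 hx hy) hm hmi hb)
    exact ⟨b, b1, b2.trans (le_max_of_le_left hc)⟩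
  · obtain ⟨b, b1, b2⟩ := hmixed x y hx hy hx0 hy0 m hm hmi hb
    exact ⟨b, b1, b2.trans (le_max_right _ _)⟩
  · obtain ⟨b, b1, b2⟩ := hmixed y x hy hx hy0 hx0 m hm hmi
        (by rw [ed_comm (y:ℂ) m, ed_comm m x, ed_comm (y:ℂ) x]; linarith)
    exact ⟨b, b1, b2.trans (le_max_right _ _)⟩
  · obtain ⟨b, b1, b2⟩ := hpos x y hx hy hx0 hy0 m hm hmi hb
    exact ⟨b, b1, b2.trans (le_max_left _ _)⟩

end Chart

/-- Hyperbolic distances increase when the domain shrinks. -/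
theorem Chart.ed_mono {Ω Ω' : Set ℂ} {lam lam' : ℂ → ℝ} {p p' s s' : ℂ → ℂ}
    (h : Chart Ω lam p s) (h' : Chart Ω' lam' p' s') (hsub : Ω' ⊆ Ω) {z w : ℂ} (hz : z ∈ Ω')
    (hw : w ∈ Ω') : ed s z w ≤ ed s' z w := by
  have hz' := h'.sfold_mem hz
  have hw' := h'.sfold_mem hw
  obtain ⟨f, f1, f2, f3, f4⟩ := h.exists_disc_lift (q := p')
    (fun a ha => (h'.diff a ha).differentiableWithinAt) (fun a ha => hsub (h'.mem ha)) hz'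
    (h.sfold_mem (hsub hz)) (by rw [h.p_sfold (hsub hz), h'.p_sfold hz])
  have h1 := h.hd_fold_le (f2 hz') (f2 hw')
  rw [f4 _ hz', f4 _ hw', h'.p_sfold hz, h'.p_sfold hw, fold_fold, fold_fold] at h1
  exact h1.trans (schwarzPick_hd f1 f2 hz' hw')

theorem im_eq_zero_of_hd_add_le {r : ℝ} (hr : 0 < r) {b : ℂ} (hr1 : (r:ℂ) ∈ ball (0:ℂ) 1)
    (hb : b ∈ ball (0:ℂ) 1) (h : hd r 0 + hd 0 b ≤ hd r b) : b.im = 0 := by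
  have c := Real.cosh_le_cosh.2 (show |(hd r 0 + hd 0 b) / 2| ≤ |hd r b / 2| by
    rw [abs_of_nonneg (by have := hd_nonneg r 0; have := hd_nonneg 0 b; positivity),
      abs_of_nonneg (by have := hd_nonneg r b; positivity)]
    linarith)
  have h0 := dw_pos hr1
  have h1 := dw_pos hb
  rw [add_div, Real.cosh_add, cosh_hd hr1 hb, cosh_hd hr1 zero_mem_disc,
    cosh_hd zero_mem_disc hb, sinh_hd, sinh_hd] at c
  have hd0 : dw 0 = 1 := by simp [dw]
  simp only [hd0, map_zero, zero_mul, mul_zero, sub_zero, zero_sub, norm_neg, norm_one, one_mul,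
    mul_one, conj_ofReal, norm_real, Real.norm_eq_abs, abs_of_pos hr] at c
  rw [div_mul_div_comm, div_mul_div_comm, ← add_div, div_le_div_iff_of_pos_right (by positivity)]
    at c
  have c2 := pow_le_pow_left₀ (by positivity) c 2
  rw [← normSq_eq_norm_sq (1 - _), normSq_apply] at c2
  have e := normSq_eq_norm_sq b
  rw [normSq_apply] at e
  simp at c2
  have hn := norm_nonneg b
  have h5 : b.re ≤ -‖b‖ := by
    have : r * (b.re + ‖b‖) ≤ 0 := by
      have e2 : r ^ 2 * (b.re * b.re + b.im * b.im) = r ^ 2 * ‖b‖ ^ 2 := by rw [e]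
      nlinarith
    nlinarith
  nlinarith

theorem exists_normalise {x y u : ℂ} (hx : x ∈ ball (0:ℂ) 1) (hy : y ∈ ball (0:ℂ) 1)
    (hu : u ∈ ball (0:ℂ) 1) (hxu : x ≠ u) (h : hd x u + hd u y ≤ hd x y) :
    ∃ M : ℂ → ℂ, DifferentiableOn ℂ M (ball 0 1) ∧ (∀ z ∈ ball (0:ℂ) 1, M z ∈ ball (0:ℂ) 1) ∧
      M u = 0 ∧ (∀ z ∈ ball (0:ℂ) 1, ∀ w ∈ ball (0:ℂ) 1, hd (M z) (M w) = hd z w) ∧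
      (M x).im = 0 ∧ (M y).im = 0 := by
  have hnu := neg_mem_disc hu
  obtain ⟨c, c1, c2⟩ := exists_eq_ray (mob_mem hnu hx)
  set r := Real.tanh (hd 0 (mob (-u) x) / 2) with hr
  have hcc : conj c * c = 1 := by rw [← normSq_eq_conj_mul_self, normSq_eq_norm_sq, c1]; simp
  have hxr : conj c * mob (-u) x = r := by
    rw [c2]; linear_combination (r:ℂ) * hcc
  set M : ℂ → ℂ := fun z => conj c * mob (-u) z with hM
  have hMm : ∀ z ∈ ball (0:ℂ) 1, M z ∈ ball (0:ℂ) 1 := by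
    intro z hz
    have := mob_mem hnu hz
    simp only [mem_ball_zero_iff, hM, norm_mul, norm_conj, c1, one_mul] at this ⊢
    exact this
  have hMh : ∀ z ∈ ball (0:ℂ) 1, ∀ w ∈ ball (0:ℂ) 1, hd (M z) (M w) = hd z w := by
    intro z hz w hw
    rw [← hd_mob hnu hz hw]
    simp only [hd, dw, hM, ← mul_sub, norm_mul, norm_conj, c1, one_mul]
  have hMu : M u = 0 := by simp [hM, mob_neg_self]
  have hxp : 0 < hd 0 (mob (-u) x) := by
    have := hd_mob hnu hu hx
    rw [mob_neg_self] at this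
    rw [this]
    exact hd_pos hu hx hxu.symm
  have hrp : 0 < r := by
    rw [hr, Real.tanh_eq_sinh_div_cosh]
    exact div_pos (Real.sinh_pos_iff.2 (by linarith)) (Real.cosh_pos _)
  have hMx : M x = r := hxr
  refine ⟨M, (differentiableOn_mob hnu).const_mul _, hMm, hMu, hMh, by rw [hMx, ofReal_im], ?_⟩
  refine im_eq_zero_of_hd_add_le hrp (hMx ▸ hMm x hx) (hMm y hy) ?_
  rw [← hMx, ← hMu, hMh _ hx _ hu, hMh _ hu _ hy, hMh _ hx _ hy]
  exact h

/-- Points between two real points of the disc are real. -/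
theorem im_eq_zero_of_real_between {a b m : ℂ} (ha : a ∈ ball (0:ℂ) 1) (hb : b ∈ ball (0:ℂ) 1)
    (hm : m ∈ ball (0:ℂ) 1) (hai : a.im = 0) (hbi : b.im = 0) (h : hd a m + hd m b ≤ hd a b) :
    m.im = 0 := by
  have hc : ∀ z w : ℂ, hd (conj z) (conj w) = hd z w := by
    intro z w
    simp only [hd, dw, norm_conj, ← map_sub]
  have e1 := hc a m
  have e2 := hc m b
  rw [conj_eq_iff_im.2 hai] at e1
  rw [conj_eq_iff_im.2 hbi] at e2
  have hm' : conj m ∈ ball (0:ℂ) 1 := by simpa using hm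
  exact conj_eq_iff_im.1 (hd_between_unique ha hb hm' hm (by linarith) h e1)

/-- A maximum principle for the real part of a holomorphic function on an open set. -/
theorem re_nonpos_of_frontier {V : Set ℂ} (hV : IsOpen V) {f : ℂ → ℂ}
    (hf : DifferentiableOn ℂ f V) (hfr : ∀ z ∈ frontier V, ∀ᶠ w in 𝓝[V] z, (f w).re ≤ 0)
    (hinf : ∀ᶠ w in cocompact ℂ ⊓ 𝓟 V, (f w).re ≤ 0) {z : ℂ} (hz : z ∈ V) : (f z).re ≤ 0 := by
  by_contra! hpos
  have hcont : ContinuousOn (fun w => (f w).re) V := continuous_re.comp_continuousOn hf.continuousOn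
  have hclosed : ∀ M > 0, IsCompact {w ∈ V | M ≤ (f w).re} := by
    intro M hM
    refine isCompact_of_isClosed_isBounded ?_ ?_
    · refine isClosed_of_closure_subset fun w hw => ?_
      by_cases hwV : w ∈ V
      · refine ⟨hwV, ?_⟩
        have : (𝓝[{w ∈ V | M ≤ (f w).re}] w).NeBot := mem_closure_iff_nhdsWithin_neBot.1 hw
        have h1 : Tendsto (fun w => (f w).re) (𝓝[{w ∈ V | M ≤ (f w).re}] w) (𝓝 (f w).re) :=
          (hcont w hwV).mono_left (nhdsWithin_mono _ fun a ha => ha.1)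
        refine ge_of_tendsto h1 ?_
        filter_upwards [self_mem_nhdsWithin] with a ha using ha.2
      · exfalso
        have hwf : w ∈ frontier V := by
          rw [hV.frontier_eq]
          exact ⟨closure_mono (fun a ha => ha.1) hw, hwV⟩
        have : (𝓝[{w ∈ V | M ≤ (f w).re}] w).NeBot := mem_closure_iff_nhdsWithin_neBot.1 hw
        have h1 := (hfr w hwf).filter_mono
          (nhdsWithin_mono w (fun a ha => ha.1 : {w ∈ V | M ≤ (f w).re} ⊆ V))
        obtain ⟨a, ha1, ha2⟩ := (h1.and self_mem_nhdsWithin).exists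
        linarith [ha2.2]
    · rw [eventually_inf_principal, ← Metric.cobounded_eq_cocompact] at hinf
      have h2 : Bornology.IsBounded {w | w ∈ V → (f w).re ≤ 0}ᶜ := by
        rw [Bornology.isBounded_def, compl_compl]; exact hinf
      refine h2.subset fun w hw hc => ?_
      have := hc hw.1
      linarith [hw.2]
  obtain ⟨w₀, ⟨hw₀, hw₀'⟩, hmax⟩ := (hclosed _ hpos).exists_isMaxOn ⟨z, hz, le_rfl⟩
    (hcont.mono fun a ha => ha.1)
  have hmax' : ∀ w ∈ V, (f w).re ≤ (f w₀).re := by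
    intro w hw
    by_cases h : (f z).re ≤ (f w).re
    · exact hmax ⟨hw, h⟩
    · exact (not_le.1 h).le.trans hw₀'
  have hT : IsCompact {w ∈ V | (f w₀).re ≤ (f w).re} := hclosed _ (hpos.trans_le hw₀')
  have hTo : IsOpen {w ∈ V | (f w₀).re ≤ (f w).re} := by
    rw [isOpen_iff_mem_nhds]
    rintro w ⟨hw, hww⟩
    have hwn := hV.mem_nhds hw
    have h1 : ∀ᶠ a in 𝓝 w, DifferentiableAt ℂ (fun a => exp (f a)) a := by
      filter_upwards [hwn] with a ha
      exact (hf.differentiableAt (hV.mem_nhds ha)).cexp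
    have h2 : IsLocalMax (norm ∘ fun a => exp (f a)) w := by
      filter_upwards [hwn] with a ha
      simp only [Function.comp, norm_exp]
      exact Real.exp_le_exp.2 ((hmax' a ha).trans hww)
    filter_upwards [Complex.eventually_eq_of_isLocalMax_norm h1 h2, hwn] with a ha haV
    refine ⟨haV, ?_⟩
    have := congrArg norm ha
    rw [norm_exp, norm_exp] at this
    rwa [Real.exp_injective this]
  rcases isClopen_iff.1 ⟨hT.isClosed, hTo⟩ with h | h
  · exact (h ▸ (⟨hw₀, le_rfl⟩ : w₀ ∈ {w ∈ V | (f w₀).re ≤ (f w).re}) : w₀ ∈ (∅ : Set ℂ))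
  · exact noncompact_univ ℂ (h ▸ hT)

/-- The branch on the upper half plane of the logarithm of `(w - y) / (w - x)`. -/
def lg (x y : ℝ) (w : ℂ) : ℂ := log ((w - y) / (w - x))

theorem im_quot {x y : ℝ} {w : ℂ} :
    ((w - y) / (w - x)).im = (y - x) * w.im / normSq (w - x) := by
  rw [div_im]
  simp
  ring

theorem lg_im_nonneg {x y : ℝ} (hxy : x < y) {w : ℂ} (hw : 0 ≤ w.im) : 0 ≤ (lg x y w).im := by
  rw [lg, log_im, arg_nonneg_iff, im_quot]
  exact div_nonneg (mul_nonneg (by linarith) hw) (normSq_nonneg _)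

theorem lg_im_le {x y : ℝ} {w : ℂ} : (lg x y w).im ≤ Real.pi := by
  rw [lg, log_im]; exact arg_le_pi _

theorem quot_im_pos {x y : ℝ} (hxy : x < y) {w : ℂ} (hw : 0 < w.im) :
    0 < ((w - y) / (w - x)).im := by
  rw [im_quot]
  refine div_pos (mul_pos (by linarith) hw) (normSq_pos.2 fun h => ?_)
  have := congrArg im h
  simp at this
  linarith

theorem sub_ofReal_ne {x : ℝ} {w : ℂ} (hw : w.im ≠ 0) : w - x ≠ 0 := by
  intro h
  have := congrArg im h
  simp at this
  exact hw this

theorem differentiableAt_lg {x y : ℝ} (hxy : x < y) {w : ℂ} (hw : 0 < w.im) :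
    DifferentiableAt ℂ (lg x y) w := by
  refine DifferentiableAt.clog ?_ (Or.inr (quot_im_pos hxy hw).ne')
  have := sub_ofReal_ne (x := x) hw.ne'
  fun_prop (disch := assumption)

theorem continuousWithinAt_lg {x y : ℝ} (hxy : x < y) {w : ℂ} (hx : w ≠ x) (hy : w ≠ y) :
    ContinuousWithinAt (lg x y) {z | 0 ≤ z.im} w := by
  have hx' : w - x ≠ 0 := sub_ne_zero.2 hx
  have hq : ContinuousAt (fun w : ℂ => (w - y) / (w - x)) w := by
    fun_prop (disch := assumption)
  have hm : MapsTo (fun w : ℂ => (w - y) / (w - x)) {z | 0 ≤ z.im} {z | 0 ≤ z.im} := by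
    intro z hz
    simp only [mem_ofPred_eq, im_quot]
    exact div_nonneg (mul_nonneg (by linarith) hz) (normSq_nonneg _)
  have h0 : (w - y) / (w - x) ≠ 0 := div_ne_zero (sub_ne_zero.2 hy) hx'
  by_cases hs : (w - y) / (w - x) ∈ slitPlane
  · exact (ContinuousAt.comp (f := fun w : ℂ => (w - y) / (w - x))
      (continuousAt_clog hs) hq).continuousWithinAt
  · rw [mem_slitPlane_iff, not_or, not_not, not_lt] at hs
    have hre : ((w - y) / (w - x)).re < 0 := hs.1.lt_of_ne fun h => h0 (Complex.ext h hs.2)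
    exact ContinuousWithinAt.comp (f := fun w : ℂ => (w - y) / (w - x)) (g := log)
      (continuousWithinAt_log_of_re_neg_of_im_zero hre hs.2) hq.continuousWithinAt hm

theorem lg_inner {x y a : ℝ} (h1 : x < a) (h2 : a < y) : (lg x y a).im = Real.pi := by
  have : ((a:ℂ) - y) / (a - x) = ((a - y) / (a - x) : ℝ) := by push_cast; rfl
  rw [lg, log_im, this, arg_ofReal_of_neg]
  exact div_neg_of_neg_of_pos (by linarith) (by linarith)

theorem lg_outer {x y a : ℝ} (hxy : x < y) (h : a < x ∨ y < a) : (lg x y a).im = 0 := by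
  have : ((a:ℂ) - y) / (a - x) = ((a - y) / (a - x) : ℝ) := by push_cast; rfl
  rw [lg, log_im, this, arg_ofReal_of_nonneg]
  rcases h with h | h
  · exact div_nonneg_of_nonpos (by linarith) (by linarith)
  · exact div_nonneg (by linarith) (by linarith)

theorem tendsto_lg_cocompact (x y : ℝ) : Tendsto (lg x y) (cocompact ℂ) (𝓝 0) := by
  have h1 : Tendsto (fun w : ℂ => (w - x)⁻¹) (cocompact ℂ) (𝓝 0) := by
    refine (tendsto_inv₀_cobounded (α := ℂ)).comp ?_
    rw [← Metric.cobounded_eq_cocompact]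
    simp [sub_eq_add_neg]
  have h2 : Tendsto (fun w : ℂ => 1 + (x - y : ℂ) * (w - x)⁻¹) (cocompact ℂ) (𝓝 1) := by
    simpa using (h1.const_mul (x - y : ℂ)).const_add 1
  have h3 : Tendsto (fun w : ℂ => log (1 + (x - y : ℂ) * (w - x)⁻¹)) (cocompact ℂ) (𝓝 0) := by
    have := (continuousAt_clog (x := 1) (by simp)).tendsto.comp h2
    simpa [Function.comp_def] using this
  refine h3.congr' ?_
  have : ∀ᶠ w : ℂ in cocompact ℂ, w ≠ x := by
    have := (isCompact_singleton (x := (x:ℂ))).compl_mem_cocompact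
    filter_upwards [this] with w hw using hw
  filter_upwards [this] with w hw
  have := sub_ne_zero.2 hw
  rw [lg]
  congr 1
  field_simp
  ring

/-- For an arc in the closed upper half plane joining two real points `x < y`, there is a locally
constant function on the complement of the arc in the closed upper half plane which is `1` at the
remaining real points between `x` and `y`, and `0` at the other ones and at infinity. -/
theorem exists_winding {x y : ℝ} (hxy : x < y) {σ : ℝ → ℂ} {l : ℝ} (hl : 0 ≤ l)
    (hσ : ContDiff ℝ 1 σ) (h0 : σ 0 = x) (h1 : σ l = y) (hi : ∀ t ∈ Icc 0 l, 0 ≤ (σ t).im) :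
    ∃ n : ℂ → ℝ,
      (∀ w : ℂ, 0 ≤ w.im → w ∉ σ '' Icc 0 l → ∀ᶠ w' in 𝓝[{z | 0 ≤ z.im}] w, n w' = n w) ∧
      (∀ a : ℝ, x < a → a < y → (a:ℂ) ∉ σ '' Icc 0 l → n a = 1) ∧
      (∀ a : ℝ, a < x ∨ y < a → (a:ℂ) ∉ σ '' Icc 0 l → n a = 0) ∧
      ∀ᶠ w in cocompact ℂ ⊓ 𝓟 {z | 0 ≤ z.im}, n w = 0 := by
  set T := σ '' Icc 0 l
  have hTc : IsCompact T := isCompact_Icc.image hσ.continuous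
  have hxT : (x:ℂ) ∈ T := ⟨0, ⟨le_rfl, hl⟩, h0⟩
  have hyT : (y:ℂ) ∈ T := ⟨l, ⟨hl, le_rfl⟩, h1⟩
  have hdσ : Continuous (deriv σ) := hσ.continuous_deriv le_rfl
  have hσd : ∀ t, HasDerivAt σ (deriv σ t) t := fun t =>
    (hσ.differentiable one_ne_zero t).hasDerivAt
  set G : ℂ → ℝ → ℂ := fun w t => -deriv σ t / (w - σ t) with hG
  set A : ℂ → ℂ := fun w => ∫ t in (0:ℝ)..l, G w t with hA
  set q : ℝ → ℝ := fun t => (projIcc 0 l hl t : ℝ) with hq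
  have hqc : Continuous q := continuous_subtype_val.comp continuous_projIcc
  have hqm : ∀ t, q t ∈ Icc 0 l := fun t => (projIcc 0 l hl t).2
  have hqe : ∀ t ∈ Icc 0 l, q t = t := fun t ht => by simp [hq, projIcc_of_mem hl ht]
  have hne : ∀ w ∉ T, ∀ t, w - σ (q t) ≠ 0 := fun w hw t h =>
    hw ⟨q t, hqm t, (sub_eq_zero.1 h).symm⟩
  have hAq : ∀ w, A w = ∫ t in (0:ℝ)..l, -deriv σ t / (w - σ (q t)) := by
    intro w
    refine intervalIntegral.integral_congr fun t ht => ?_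
    rw [uIcc_of_le hl] at ht
    simp only [hG, hqe t ht]
  have hAc : ContinuousOn A Tᶜ := by
    rw [continuousOn_iff_continuous_domRestrict]
    have : Continuous fun w : (Tᶜ : Set ℂ) => ∫ t in (0:ℝ)..l, -deriv σ t / ((w:ℂ) - σ (q t)) := by
      refine intervalIntegral.continuous_parametric_intervalIntegral_of_continuous' ?_ _ _
      refine Continuous.div (by fun_prop) ?_ fun ⟨w, t⟩ => hne w w.2 t
      exact (continuous_subtype_val.comp continuous_fst).sub
        (hσ.continuous.comp (hqc.comp continuous_snd))
    exact this.congr fun w => (hAq w).symm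
  have hexp : ∀ w ∉ T, exp (A w) = (w - y) / (w - x) := by
    intro w hw
    have hcont : Continuous fun t => -deriv σ t / (w - σ (q t)) :=
      hdσ.neg.div (continuous_const.sub (hσ.continuous.comp hqc)) (hne w hw)
    set Φ : ℝ → ℂ := fun τ => ∫ t in (0:ℝ)..τ, -deriv σ t / (w - σ (q t)) with hΦ
    have hΦd : ∀ τ, HasDerivAt Φ (-deriv σ τ / (w - σ (q τ))) τ := fun τ =>
      (hcont.integral_hasStrictDerivAt 0 τ).hasDerivAt
    have hd : ∀ τ, HasDerivAt (fun τ => (w - σ τ) * exp (-Φ τ))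
        (-deriv σ τ * exp (-Φ τ) +
          (w - σ τ) * (exp (-Φ τ) * -(-deriv σ τ / (w - σ (q τ))))) τ := fun τ =>
      ((hσd τ).const_sub w).mul (hΦd τ).neg.cexp
    have hc := constant_of_has_deriv_right_zero (a := 0) (b := l)
      (fun τ _ => (hd τ).continuousAt.continuousWithinAt) (fun τ hτ => by
        have h := (hd τ).hasDerivWithinAt (s := Ici τ)
        have h2 := hne w hw τ
        rw [hqe τ (Ico_subset_Icc_self hτ)] at h h2
        convert h using 1
        field_simp
        ring) l ⟨hl, le_rfl⟩
    have hx0 : w - x ≠ 0 := sub_ne_zero.2 fun h => hw (h ▸ hxT)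
    simp only [hΦ, intervalIntegral.integral_same, h0, h1, ← hAq] at hc
    rw [neg_zero, exp_zero, mul_one, exp_neg] at hc
    rw [eq_div_iff hx0, ← hc]
    field_simp [exp_ne_zero]
  have hdiff : ∀ w ∉ T, ∃ k : ℤ, A w - lg x y w = k * (2 * Real.pi * I) := by
    intro w hw
    have hwx : w - x ≠ 0 := sub_ne_zero.2 fun h => hw (h ▸ hxT)
    have hwy : w - y ≠ 0 := sub_ne_zero.2 fun h => hw (h ▸ hyT)
    refine exp_eq_one_iff.1 ?_
    rw [exp_sub, hexp w hw, lg, exp_log (div_ne_zero hwy hwx), div_self (div_ne_zero hwy hwx)]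
  set n : ℂ → ℝ := fun w => -(A w - lg x y w).im / (2 * Real.pi) with hn
  have hnint : ∀ w ∉ T, ∃ k : ℤ, n w = k := by
    intro w hw
    obtain ⟨k, hk⟩ := hdiff w hw
    refine ⟨-k, ?_⟩
    have := Real.pi_pos
    simp only [hn, hk]
    simp
    field_simp
  have hreal : ∀ a : ℝ, (a:ℂ) ∉ T → (A a).im = arg (I * (a - y)) - arg (I * (a - x)) := by
    intro a ha
    have hne' : ∀ t ∈ uIcc 0 l, (a:ℂ) - σ t ≠ 0 := by
      intro t ht
      rw [uIcc_of_le hl] at ht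
      exact fun h => ha ⟨t, ht, (sub_eq_zero.1 h).symm⟩
    have hd : ∀ t ∈ uIcc 0 l, HasDerivAt (fun t => log (I * (a - σ t))) (G a t) t := by
      intro t ht
      have h2 := hne' t ht
      have hs : I * ((a:ℂ) - σ t) ∈ slitPlane := by
        rw [uIcc_of_le hl] at ht
        have h3 := hi t ht
        rw [mem_slitPlane_iff]
        rcases h3.lt_or_eq with h3 | h3
        · left; simpa using h3
        · right
          intro h4
          exact h2 (Complex.ext (by simpa using h4) (by simp [← h3]))
      convert (((hσd t).const_sub (a:ℂ)).const_mul I).clog_real hs using 1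
      simp only [hG]
      field_simp
    have hci : ContinuousOn (G a) (uIcc 0 l) :=
      hdσ.continuousOn.neg.div (continuousOn_const.sub hσ.continuous.continuousOn) hne'
    have := intervalIntegral.integral_eq_sub_of_hasDerivAt hd hci.intervalIntegrable
    simp only [hA, this, h0, h1, sub_im, log_im]
  refine ⟨n, ?_, ?_, ?_, ?_⟩
  · intro w hw hwT
    have hcn : ContinuousWithinAt n {z | 0 ≤ z.im} w := by
      have c1 : ContinuousAt A w := hAc.continuousAt (hTc.isClosed.isOpen_compl.mem_nhds hwT)
      have c2 := continuousWithinAt_lg hxy (w := w) (fun h => hwT (h ▸ hxT))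
        (fun h => hwT (h ▸ hyT))
      have c3 := continuous_im.continuousAt.comp_continuousWithinAt
        (c1.continuousWithinAt.sub c2)
      exact (c3.neg).div_const _
    have e1 : ∀ᶠ w' in 𝓝[{z | 0 ≤ z.im}] w, dist (n w') (n w) < 1 :=
      hcn.eventually (Metric.ball_mem_nhds _ one_pos)
    have e2 : ∀ᶠ w' in 𝓝[{z | 0 ≤ z.im}] w, w' ∉ T :=
      nhdsWithin_le_nhds (hTc.isClosed.isOpen_compl.mem_nhds hwT)
    filter_upwards [e1, e2] with w' d1 d2
    obtain ⟨k, hk⟩ := hnint w hwT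
    obtain ⟨k', hk'⟩ := hnint w' d2
    rw [hk, hk', Real.dist_eq] at d1
    rw [hk, hk']
    have : |k' - k| < 1 := by exact_mod_cast d1
    have := Int.abs_lt_one_iff.1 this
    rw [sub_eq_zero.1 this]
  · intro a ha1 ha2 haT
    have e1 : I * ((a:ℂ) - y) = ((y - a : ℝ) : ℂ) * (-I) := by push_cast; ring
    have e2 : I * ((a:ℂ) - x) = ((a - x : ℝ) : ℂ) * I := by push_cast; ring
    simp only [hn, sub_im, hreal a haT, lg_inner ha1 ha2]
    rw [e1, e2, arg_real_mul _ (by linarith), arg_real_mul _ (by linarith), arg_I, arg_neg_I]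
    have := Real.pi_pos
    field_simp
    norm_num
  · intro a ha haT
    simp only [hn, sub_im, hreal a haT, lg_outer hxy ha]
    rcases ha with ha | ha
    · have e1 : I * ((a:ℂ) - y) = ((y - a : ℝ) : ℂ) * (-I) := by push_cast; ring
      have e2 : I * ((a:ℂ) - x) = ((x - a : ℝ) : ℂ) * (-I) := by push_cast; ring
      rw [e1, e2, arg_real_mul _ (by linarith), arg_real_mul _ (by linarith)]
      simp
    · have e1 : I * ((a:ℂ) - y) = ((a - y : ℝ) : ℂ) * I := by push_cast; ring
      have e2 : I * ((a:ℂ) - x) = ((a - x : ℝ) : ℂ) * I := by push_cast; ring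
      rw [e1, e2, arg_real_mul _ (by linarith), arg_real_mul _ (by linarith)]
      simp
  · obtain ⟨M, hM⟩ := isCompact_Icc.exists_bound_of_continuousOn (s := Icc 0 l) hdσ.continuousOn
    obtain ⟨ρ, hρ⟩ := isCompact_Icc.exists_bound_of_continuousOn (s := Icc 0 l)
      hσ.continuous.continuousOn
    have hM0 : 0 ≤ M := (norm_nonneg _).trans (hM 0 ⟨le_rfl, hl⟩)
    rw [eventually_inf_principal]
    have hcb : ∀ᶠ w : ℂ in cocompact ℂ, ρ + M * l + 1 < ‖w‖ := by
      have := tendsto_norm_cocompact_atTop (E := ℂ)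
      exact this.eventually_gt_atTop _
    filter_upwards [hcb] with w hw hwi
    have hwT : w ∉ T := by
      rintro ⟨t, ht, rfl⟩
      have := hρ t ht
      nlinarith [mul_nonneg hM0 hl]
    have hA1 : ‖A w‖ ≤ M / (M * l + 1) * |l - 0| := by
      refine intervalIntegral.norm_integral_le_of_norm_le_const fun t ht => ?_
      rw [uIoc_of_le hl] at ht
      have ht' := Ioc_subset_Icc_self ht
      simp only [hG, norm_div, norm_neg]
      have h3 : M * l + 1 ≤ ‖w - σ t‖ := by
        have := norm_sub_norm_le w (σ t)
        linarith [hρ t ht']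
      have := mul_nonneg hM0 hl
      exact div_le_div₀ hM0 (hM t ht') (by positivity) h3
    have hA2 : M / (M * l + 1) * |l - 0| < 1 := by
      have := mul_nonneg hM0 hl
      rw [sub_zero, abs_of_nonneg hl, div_mul_eq_mul_div, div_lt_one (by positivity)]
      linarith
    have hA3 := abs_im_le_norm (A w)
    have hb1 := lg_im_nonneg hxy hwi
    have hb2 := lg_im_le (x := x) (y := y) (w := w)
    have hpi := Real.pi_gt_three
    have hlt : |n w| < 1 := by
      have e : |n w| = |(A w - lg x y w).im| / (2 * Real.pi) := by
        simp only [hn]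
        rw [abs_div, abs_neg, abs_of_pos (by positivity : 0 < 2 * Real.pi)]
      rw [e, div_lt_one (by positivity), sub_im, abs_lt]
      obtain ⟨k1, k2⟩ := abs_le.1 hA3
      constructor <;> linarith
    obtain ⟨k, hk⟩ := hnint w hwT
    rw [hk] at hlt ⊢
    have : |k| < 1 := by exact_mod_cast hlt
    rw [Int.abs_lt_one_iff.1 this, Int.cast_zero]

section

/-- A unit speed geodesic of the disc joining `s z` to `s w` and staying in the range of the
section `s` of `p`. -/
structure UpperGeodesic (p s : ℂ → ℂ) (z w : ℂ) (γ : ℝ → ℂ) : Prop where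
  mem : ∀ t, γ t ∈ ball (0:ℂ) 1
  left : γ 0 = s z
  right : γ (hd (s z) (s w)) = s w
  isom : ∀ t t', hd (γ t) (γ t') = |t - t'|
  smooth : ContDiff ℝ 1 γ
  upper : ∀ t ∈ Icc 0 (hd (s z) (s w)), 0 ≤ (p (γ t)).im ∧ s (p (γ t)) = γ t

/-- The trace in the closed upper half plane of the geodesic `γ`. -/
def trace (p s : ℂ → ℂ) (z w : ℂ) (γ : ℝ → ℂ) : Set ℂ :=
  (fun t => p (γ t)) '' Icc 0 (hd (s z) (s w))

/-- A locally constant function on the complement of `T` in the closed upper half plane which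
takes the value `1` on the interval `(x, y)`, and `0` outside `[x, y]` and at infinity. -/
structure IsWinding (x y : ℝ) (T : Set ℂ) (n : ℂ → ℝ) : Prop where
  loc : ∀ w : ℂ, 0 ≤ w.im → w ∉ T → ∀ᶠ w' in 𝓝[{z | 0 ≤ z.im}] w, n w' = n w
  inner : ∀ a : ℝ, x < a → a < y → (a:ℂ) ∉ T → n a = 1
  outer : ∀ a : ℝ, a < x ∨ y < a → (a:ℂ) ∉ T → n a = 0
  inf : ∀ᶠ w in cocompact ℂ ⊓ 𝓟 {z | 0 ≤ z.im}, n w = 0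

variable {Ω : Set ℂ} {lam : ℂ → ℝ} {p s : ℂ → ℂ}

namespace Chart

theorem exists_upperGeodesic (h : Chart Ω lam p s) {z w : ℂ} (hz : z ∈ Ω) (hw : w ∈ Ω)
    (hzi : 0 ≤ z.im) (hwi : 0 ≤ w.im) : ∃ γ, UpperGeodesic p s z w γ := by
  obtain ⟨γ, g1, g2, g3, g4, g5, g6⟩ := h.exists_upper_geodesic hz hw hzi hwi
  exact ⟨γ, g1, g2, g3, g4, g5, g6⟩

theorem contDiff_trace (h : Chart Ω lam p s) {z w : ℂ} {γ : ℝ → ℂ}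
    (hγ : UpperGeodesic p s z w γ) : ContDiff ℝ 1 fun t => p (γ t) :=
  ((h.differentiableOn.contDiffOn isOpen_ball).restrict_scalars ℝ).comp_contDiff hγ.smooth hγ.mem

theorem isCompact_trace (h : Chart Ω lam p s) {z w : ℂ} {γ : ℝ → ℂ}
    (hγ : UpperGeodesic p s z w γ) : IsCompact (trace p s z w γ) :=
  isCompact_Icc.image (h.contDiff_trace hγ).continuous

theorem exists_isWinding (h : Chart Ω lam p s) {x y : ℝ} (hx : (x:ℂ) ∈ Ω) (hy : (y:ℂ) ∈ Ω)
    (hxy : x < y) {γ : ℝ → ℂ} (hγ : UpperGeodesic p s x y γ) :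
    ∃ n, IsWinding x y (trace p s x y γ) n := by
  obtain ⟨n, n1, n2, n3, n4⟩ := exists_winding hxy (hd_nonneg (s x) (s y)) (h.contDiff_trace hγ)
    (by rw [hγ.left, h.p_s hx (by simp)]) (by rw [hγ.right, h.p_s hy (by simp)])
    fun t ht => (hγ.upper t ht).1
  exact ⟨n, n1, n2, n3, n4⟩

theorem left_mem_trace (h : Chart Ω lam p s) {z w : ℂ} (hz : z ∈ Ω) (hzi : 0 ≤ z.im) {γ : ℝ → ℂ}
    (hγ : UpperGeodesic p s z w γ) : z ∈ trace p s z w γ :=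
  ⟨0, ⟨le_rfl, hd_nonneg _ _⟩, by simp only [hγ.left, h.p_s hz hzi]⟩

theorem right_mem_trace (h : Chart Ω lam p s) {z w : ℂ} (hw : w ∈ Ω) (hwi : 0 ≤ w.im)
    {γ : ℝ → ℂ} (hγ : UpperGeodesic p s z w γ) : w ∈ trace p s z w γ :=
  ⟨_, ⟨hd_nonneg _ _, le_rfl⟩, by simp only [hγ.right, h.p_s hw hwi]⟩

theorem trace_subset (h : Chart Ω lam p s) {z w : ℂ} {γ : ℝ → ℂ} (hγ : UpperGeodesic p s z w γ)
    {a : ℂ} (ha : a ∈ trace p s z w γ) :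
    a ∈ Ω ∧ 0 ≤ a.im ∧ hd (s z) (s a) + hd (s a) (s w) ≤ hd (s z) (s w) := by
  obtain ⟨t, ht, rfl⟩ := ha
  refine ⟨h.mem (hγ.mem t), (hγ.upper t ht).1, ?_⟩
  have e1 := hγ.isom 0 t
  have e2 := hγ.isom t (hd (s z) (s w))
  rw [hγ.left, zero_sub, abs_neg, abs_of_nonneg ht.1] at e1
  rw [hγ.right, abs_sub_comm, abs_of_nonneg (by linarith [ht.2])] at e2
  simp only [(hγ.upper t ht).2, e1, e2]
  linarith

theorem exists_nearest {γ : ℝ → ℂ} {z w : ℂ} (hγ : UpperGeodesic p s z w γ) {o : ℂ}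
    (ho : o ∈ ball (0:ℂ) 1) :
    ∃ v ∈ trace p s z w γ, ∀ a ∈ trace p s z w γ,
      hd (s v) (s a) ≤ hd o (s a) - hd o (s v) + (2 * hdK + 1) := by
  have hl := hd_nonneg (s z) (s w)
  have hc : ContinuousOn (fun t => hd o (γ t)) (Icc 0 (hd (s z) (s w))) := by
    intro t ht
    exact Chart.continuousOn_hd (S := univ) continuousOn_const hγ.smooth.continuous.continuousOn
      (fun _ _ => ho) (fun _ _ => hγ.mem _) t (mem_univ t) |>.mono (subset_univ _)
  obtain ⟨t₀, ht₀, hmin⟩ := isCompact_Icc.exists_isMinOn ⟨0, left_mem_Icc.2 hl⟩ hc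
  refine ⟨_, ⟨t₀, ht₀, rfl⟩, ?_⟩
  rintro _ ⟨t, ht, rfl⟩
  simp only [(hγ.upper t ht).2, (hγ.upper t₀ ht₀).2]
  have hK := hdK_nonneg
  have hm := hmin ht
  simp only [mem_ofPred_eq] at hm
  by_cases hD : hd (γ t₀) (γ t) ≤ hdK + 1
  · linarith
  push Not at hD
  obtain ⟨m, hm1, hm2, hm3⟩ : ∃ m ∈ Icc 0 (hd (s z) (s w)), |t₀ - m| = hdK + 1 ∧
      |m - t| = |t₀ - t| - (hdK + 1) := by
    rw [hγ.isom] at hD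
    rcases le_total t₀ t with h1 | h1
    · rw [abs_sub_comm, abs_of_nonneg (by linarith)] at hD
      refine ⟨t₀ + (hdK + 1), ⟨by linarith [ht₀.1], by linarith [ht.2]⟩, ?_, ?_⟩
      · rw [abs_sub_comm, abs_of_nonneg (by linarith)]; ring
      · rw [abs_sub_comm, abs_of_nonneg (by linarith), abs_sub_comm, abs_of_nonneg (by linarith)]
        ring
    · rw [abs_of_nonneg (by linarith)] at hD
      refine ⟨t₀ - (hdK + 1), ⟨by linarith [ht.1], by linarith [ht₀.2]⟩, ?_, ?_⟩
      · rw [abs_of_nonneg (by linarith)]; ring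
      · rw [abs_of_nonneg (by linarith), abs_of_nonneg (by linarith)]
        ring
  have h4 := hd_four_point ho (hγ.mem t₀) (hγ.mem m) (hγ.mem t)
  have hmm := hmin hm1
  simp only [mem_ofPred_eq] at hmm
  rw [hγ.isom, hγ.isom, hγ.isom, hm2, hm3] at h4
  rw [hγ.isom]
  rcases le_max_iff.1 (sub_le_iff_le_add.2 h4) with h5 | h5 <;> linarith

/-- Outside a compact subset of the domain, the section is far from a given point. -/
theorem exists_compact (h : Chart Ω lam p s) {o : ℂ} (ho : o ∈ ball (0:ℂ) 1) (r : ℝ) :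
    ∃ K ⊆ Ω, IsCompact K ∧ ∀ w ∈ Ω, 0 ≤ w.im → w ∉ K → r < hd o (s w) := by
  set r' := hd 0 o + |r|
  have hr0 : 0 ≤ r' := add_nonneg (hd_nonneg _ _) (abs_nonneg _)
  set b : ℂ := Real.tanh (r' / 2) * 1
  have hbm : b ∈ ball (0:ℂ) 1 := ray_mem (by simp) _
  have hb0 : hd 0 b = r' := by
    have := hd_ray (u := 1) (by simp) 0 r'
    simp only [zero_div, Real.tanh_zero, ofReal_zero, zero_mul, zero_sub, abs_neg,
      abs_of_nonneg hr0] at this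
    exact this
  have hsub : closedBall (0:ℂ) ‖b‖ ⊆ ball 0 1 := closedBall_subset_ball (mem_ball_zero_iff.1 hbm)
  refine ⟨p '' closedBall 0 ‖b‖, ?_, (isCompact_closedBall _ _).image_of_continuousOn
    (h.differentiableOn.continuousOn.mono hsub), fun w hw hwi hwK => ?_⟩
  · rintro _ ⟨a, ha, rfl⟩
    exact h.mem (hsub ha)
  · by_contra! hle
    have hsw := h.smem w hw hwi
    refine hwK ⟨s w, ?_, h.p_s hw hwi⟩
    rw [mem_closedBall_zero_iff, ← hd_zero_le_iff hsw hbm, hb0]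
    have := hd_triangle zero_mem_disc ho hsw
    linarith [le_abs_self r]

/-- Points of the upper half plane near a real point, or near infinity, are far from a point
which is far from the real points of the domain. -/
theorem eventually_far (h : Chart Ω lam p s) {o : ℂ} (ho : o ∈ ball (0:ℂ) 1) {r : ℝ}
    (hfar : ∀ b : ℝ, (b:ℂ) ∈ Ω → r < hd o (s b)) (a : ℝ) :
    ∀ᶠ w in 𝓝[{z | 0 < z.im}] (a:ℂ), r < hd o (s w) := by
  have hU : ∀ w : ℂ, 0 < w.im → w ∈ Ω := fun w hw => h.nonreal w hw.ne'
  by_cases haΩ : (a:ℂ) ∈ Ω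
  · have hc : ContinuousOn (fun w => hd o (s w)) {w | w ∈ Ω ∧ 0 ≤ w.im} :=
      Chart.continuousOn_hd continuousOn_const
        (fun w hw => (h.sdiff w hw.1 hw.2).continuousAt.continuousWithinAt)
        (fun _ _ => ho) (fun w hw => h.smem w hw.1 hw.2)
    have : ContinuousWithinAt (fun w => hd o (s w)) {z | 0 < z.im} a :=
      (hc a ⟨haΩ, by simp⟩).mono fun w hw => ⟨hU w hw, le_of_lt hw⟩
    exact this.eventually (lt_mem_nhds (hfar a haΩ))
  · obtain ⟨K, K1, K2, K3⟩ := h.exists_compact ho r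
    have : Kᶜ ∈ 𝓝 (a:ℂ) := K2.isClosed.isOpen_compl.mem_nhds fun hK => haΩ (K1 hK)
    filter_upwards [nhdsWithin_le_nhds this, self_mem_nhdsWithin] with w hw hwi
    exact K3 w (hU w hwi) (le_of_lt hwi) hw

theorem eventually_far_cocompact (h : Chart Ω lam p s) {o : ℂ} (ho : o ∈ ball (0:ℂ) 1) (r : ℝ) :
    ∀ᶠ w in cocompact ℂ ⊓ 𝓟 {z | 0 < z.im}, r < hd o (s w) := by
  obtain ⟨K, -, K2, K3⟩ := h.exists_compact ho r
  rw [eventually_inf_principal]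
  filter_upwards [K2.compl_mem_cocompact] with w hw hwi
  exact K3 w (h.nonreal w (ne_of_gt hwi)) (le_of_lt hwi) hw

end Chart

end

/-- A holomorphic function on the upper half plane whose real part is the harmonic measure of the
interval `[x, y]`. -/
def ang (x y : ℝ) (w : ℂ) : ℂ := -I * lg x y w / Real.pi

theorem ang_re (x y : ℝ) (w : ℂ) : (ang x y w).re = (lg x y w).im / Real.pi := by
  rw [ang, div_ofReal_re]
  simp

theorem ang_re_nonneg {x y : ℝ} (hxy : x < y) {w : ℂ} (hw : 0 ≤ w.im) : 0 ≤ (ang x y w).re := by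
  rw [ang_re]; exact div_nonneg (lg_im_nonneg hxy hw) Real.pi_pos.le

theorem ang_re_le_one (x y : ℝ) (w : ℂ) : (ang x y w).re ≤ 1 := by
  rw [ang_re]; exact div_le_one_of_le₀ lg_im_le Real.pi_pos.le

theorem differentiableOn_ang {x y : ℝ} (hxy : x < y) :
    DifferentiableOn ℂ (ang x y) {w | 0 < w.im} := fun _ hw =>
  (((differentiableAt_lg hxy hw).const_mul (-I)).div_const _).differentiableWithinAt

theorem tendsto_ang {x y : ℝ} (hxy : x < y) {a : ℝ} (hx : a ≠ x) (hy : a ≠ y) :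
    Tendsto (fun w => (ang x y w).re) (𝓝[{w | 0 < w.im}] (a:ℂ)) (𝓝 (ang x y a).re) := by
  have h := continuousWithinAt_lg hxy (w := a) (by exact_mod_cast hx)
    (by exact_mod_cast hy)
  have h2 := (continuous_im.continuousAt.comp_continuousWithinAt h).div_const Real.pi
  have h3 := h2.mono (t := {z : ℂ | 0 ≤ z.im}) (s := {w : ℂ | 0 < w.im}) fun w hw =>
    (le_of_lt hw : (0:ℝ) ≤ w.im)
  simp only [ang_re]
  exact h3

theorem eventually_ang_outer {x y : ℝ} (hxy : x < y) {a : ℝ} (ha : a < x ∨ y < a) {ε : ℝ}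
    (hε : 0 < ε) : ∀ᶠ w in 𝓝[{w | 0 < w.im}] (a:ℂ), (ang x y w).re < ε := by
  have h := tendsto_ang hxy (a := a) (by rintro rfl; rcases ha with ha | ha <;> linarith)
    (by rintro rfl; rcases ha with ha | ha <;> linarith)
  rw [ang_re x y a, lg_outer hxy ha, zero_div] at h
  exact h.eventually (gt_mem_nhds hε)

theorem eventually_ang_inner {x y : ℝ} {a : ℝ} (h1 : x < a) (h2 : a < y) {ε : ℝ}
    (hε : 0 < ε) : ∀ᶠ w in 𝓝[{w | 0 < w.im}] (a:ℂ), 1 - ε < (ang x y w).re := by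
  have h := tendsto_ang (h1.trans h2) (a := a) h1.ne' h2.ne
  rw [ang_re x y a, lg_inner h1 h2, div_self Real.pi_pos.ne'] at h
  exact h.eventually (lt_mem_nhds (by linarith))

theorem eventually_ang_cocompact (x y : ℝ) {ε : ℝ} (hε : 0 < ε) :
    ∀ᶠ w in cocompact ℂ, (ang x y w).re < ε := by
  have h := ((continuous_im.tendsto 0).comp (tendsto_lg_cocompact x y)).div_const Real.pi
  rw [zero_im, zero_div] at h
  simp only [ang_re]
  exact h.eventually (gt_mem_nhds hε)

theorem isOpen_upper : IsOpen {w : ℂ | 0 < w.im} := isOpen_lt continuous_const continuous_im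

/-- The maximum principle on the component of the complement of `T` containing `u`. -/
theorem re_le_add_of_winding {x y : ℝ} {T : Set ℂ} {n : ℂ → ℝ} (hn : IsWinding x y T n)
    (hT : IsClosed T) {t k : ℂ → ℂ} (ht : DifferentiableOn ℂ t {w | 0 < w.im})
    (hk : DifferentiableOn ℂ k {w | 0 < w.im}) {u : ℂ} (hu : 0 < u.im) (huT : u ∉ T)
    (ht1 : ∀ w : ℂ, 0 < w.im → (t w).re ≤ 1) (hk0 : ∀ w : ℂ, 0 < w.im → 0 ≤ (k w).re)
    (hkT : ∀ a ∈ T, ∀ᶠ w in 𝓝[{w | 0 < w.im}] a, 1 ≤ (k w).re) {ε : ℝ} (hε : 0 < ε)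
    (hr : ∀ a : ℝ, (a:ℂ) ∉ T → n a = n u → ∀ᶠ w in 𝓝[{w | 0 < w.im}] (a:ℂ), (t w).re ≤ ε)
    (hinf : ∀ᶠ w in cocompact ℂ ⊓ 𝓟 {w | 0 < w.im}, n w = n u → (t w).re ≤ ε) :
    (t u).re ≤ (k u).re + ε := by
  set V : Set ℂ := {w | 0 < w.im ∧ w ∉ T ∧ n w = n u}
  have hVU : V ⊆ {w | 0 < w.im} := fun w hw => hw.1
  have hUc : ({w : ℂ | 0 < w.im}) ⊆ {w | 0 ≤ w.im} := fun w hw =>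
    (le_of_lt hw : (0:ℝ) ≤ w.im)
  have hVo : IsOpen V := by
    rw [isOpen_iff_mem_nhds]
    rintro w ⟨w1, w2, w3⟩
    have e1 := hn.loc w w1.le w2
    rw [nhdsWithin_eq_nhds.2 (mem_of_superset (isOpen_upper.mem_nhds w1) hUc)] at e1
    filter_upwards [isOpen_upper.mem_nhds w1, hT.isOpen_compl.mem_nhds w2, e1] with z z1 z2 z3
    exact ⟨z1, z2, z3.trans w3⟩
  have := re_nonpos_of_frontier hVo (f := fun w => t w - k w - ε)
    (((ht.mono hVU).sub (hk.mono hVU)).sub_const _) ?_ ?_ (z := u) ⟨hu, huT, rfl⟩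
  · simp only [sub_re, ofReal_re] at this
    linarith
  · intro z hz
    simp only [sub_re, ofReal_re]
    rw [hVo.frontier_eq] at hz
    have hzi : 0 ≤ z.im :=
      closure_minimal (hVU.trans hUc) (isClosed_le continuous_const continuous_im) hz.1
    by_cases hzT : z ∈ T
    · filter_upwards [nhdsWithin_mono z hVU (hkT z hzT), self_mem_nhdsWithin] with w h1 h2
      have := ht1 w h2.1
      linarith
    · have hnz : n z = n u := by
        have : (𝓝[V] z).NeBot := mem_closure_iff_nhdsWithin_neBot.1 hz.1
        have e1 := (hn.loc z hzi hzT).filter_mono (nhdsWithin_mono z (hVU.trans hUc))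
        obtain ⟨w, w1, w2⟩ := (e1.and self_mem_nhdsWithin).exists
        rw [← w1, w2.2.2]
      rcases hzi.lt_or_eq with hzi | hzi
      · exact absurd ⟨hzi, hzT, hnz⟩ hz.2
      · have hza : z = (z.re : ℂ) := Complex.ext (by simp) (by simp [← hzi])
        rw [hza] at hzT hnz ⊢
        filter_upwards [nhdsWithin_mono _ hVU (hr _ hzT hnz), self_mem_nhdsWithin] with w h1 h2
        linarith [hk0 w h2.1]
  · rw [eventually_inf_principal] at hinf ⊢
    filter_upwards [hinf] with w hw hwV
    simp only [sub_re, ofReal_re]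
    linarith [hw hwV.1 hwV.2.2, hk0 w hwV.1]

/-- A positive harmonic function on the disc, large on geodesics whose point closest to the origin
is `v`. -/
def kern (v ζ : ℂ) : ℂ := ((1 - ‖v‖ ^ 2 : ℝ) : ℂ) * ((1 + conj v * ζ) / (1 - conj v * ζ))

theorem kern_den_ne {v ζ : ℂ} (hv : v ∈ ball (0:ℂ) 1) (hζ : ζ ∈ ball (0:ℂ) 1) :
    1 - conj v * ζ ≠ 0 := by
  have := mob_den_ne (neg_mem_disc hv) hζ
  simpa [sub_eq_add_neg] using this

theorem kern_re {v ζ : ℂ} : (kern v ζ).re =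
    (1 - ‖v‖ ^ 2) * ((1 - ‖v‖ ^ 2 * ‖ζ‖ ^ 2) / ‖1 - conj v * ζ‖ ^ 2) := by
  rw [kern, re_ofReal_mul]
  congr 1
  rw [div_re, ← add_div, ← normSq_eq_norm_sq (1 - _), ← normSq_eq_norm_sq v,
    ← normSq_eq_norm_sq ζ]
  congr 1
  simp [normSq_apply]
  ring

theorem sq_mul_sq_lt_one {v ζ : ℂ} (hv : v ∈ ball (0:ℂ) 1) (hζ : ζ ∈ ball (0:ℂ) 1) :
    ‖v‖ ^ 2 * ‖ζ‖ ^ 2 ≤ ‖v‖ ^ 2 ∧ ‖v‖ ^ 2 * ‖ζ‖ ^ 2 < 1 := by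
  have h1 := one_sub_sq_pos hv
  have h2 := one_sub_sq_pos hζ
  constructor <;> nlinarith [sq_nonneg ‖v‖, sq_nonneg ‖ζ‖]

theorem kern_re_nonneg {v ζ : ℂ} (hv : v ∈ ball (0:ℂ) 1) (hζ : ζ ∈ ball (0:ℂ) 1) :
    0 ≤ (kern v ζ).re := by
  rw [kern_re]
  have h1 := one_sub_sq_pos hv
  have h2 := (sq_mul_sq_lt_one hv hζ).2
  exact mul_nonneg h1.le (div_nonneg (by linarith) (sq_nonneg _))

theorem kern_zero_re (v : ℂ) : (kern v 0).re = 1 - ‖v‖ ^ 2 := by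
  rw [kern_re]; simp

theorem differentiableOn_kern {v : ℂ} (hv : v ∈ ball (0:ℂ) 1) :
    DifferentiableOn ℂ (kern v) (ball 0 1) := by
  intro ζ hζ
  have := kern_den_ne hv hζ
  unfold kern
  fun_prop (disch := assumption)

theorem le_kern_re {v w : ℂ} (hv : v ∈ ball (0:ℂ) 1) (hw : w ∈ ball (0:ℂ) 1) {K : ℝ}
    (h : hd v w ≤ hd 0 w - hd 0 v + K) : Real.exp (-K) / 4 ≤ (kern v w).re := by
  have hv1 := dw_pos hv
  have hw1 := dw_pos hw
  have hv2 := dw_sq hv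
  have hd0 : dw 0 = 1 := by simp [dw]
  have c0 : ∀ a ∈ ball (0:ℂ) 1, Real.cosh (hd 0 a / 2) = 1 / dw a := by
    intro a ha
    rw [cosh_hd zero_mem_disc ha]
    simp [hd0]
  have hexp : ∀ r : ℝ, 0 ≤ r → Real.cosh r ≤ Real.exp r := by
    intro r hr
    have := Real.exp_le_exp.2 (show -r ≤ r by linarith)
    rw [Real.cosh_eq]; linarith
  have hexp' : ∀ r : ℝ, Real.exp r ≤ 2 * Real.cosh r := by
    intro r
    have := Real.exp_pos (-r)
    rw [Real.cosh_eq]; linarith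
  have k1 : ‖1 - conj v * w‖ ≤ 2 * Real.exp (K / 2) * (1 - ‖v‖ ^ 2) := by
    have a1 : ‖1 - conj v * w‖ / (dw v * dw w) ≤
        Real.exp (hd 0 w / 2) * Real.exp (-(hd 0 v / 2)) * Real.exp (K / 2) := by
      rw [← cosh_hd hv hw, ← Real.exp_add, ← Real.exp_add]
      refine (hexp _ (by have := hd_nonneg v w; positivity)).trans (Real.exp_le_exp.2 (by linarith))
    have a2 : Real.exp (hd 0 w / 2) ≤ 2 / dw w := by
      have := hexp' (hd 0 w / 2)
      rw [c0 w hw] at this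
      linarith [show 2 / dw w = 2 * (1 / dw w) by ring]
    have a3 : Real.exp (-(hd 0 v / 2)) ≤ dw v := by
      have := hexp (hd 0 v / 2) (by have := hd_nonneg 0 v; positivity)
      rw [c0 v hv] at this
      rw [Real.exp_neg, inv_le_comm₀ (Real.exp_pos _) hv1, ← one_div]
      exact this
    have a4 : ‖1 - conj v * w‖ / (dw v * dw w) ≤ 2 / dw w * dw v * Real.exp (K / 2) :=
      a1.trans (by gcongr)
    rw [div_le_iff₀ (by positivity)] at a4
    refine a4.trans_eq ?_
    rw [← hv2]
    field_simp
  have n0 := norm_pos_iff.2 (kern_den_ne hv hw)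
  have k2 : ‖1 - conj v * w‖ ^ 2 ≤ 4 * Real.exp K * (1 - ‖v‖ ^ 2) ^ 2 := by
    refine (pow_le_pow_left₀ n0.le k1 2).trans_eq ?_
    have : Real.exp K = Real.exp (K / 2) ^ 2 := by
      rw [← Real.exp_nat_mul]; congr 1; push_cast; ring
    rw [this]; ring
  have p1 := one_sub_sq_pos hv
  have p2 := (sq_mul_sq_lt_one hv hw).1
  rw [kern_re, Real.exp_neg, mul_div_assoc', le_div_iff₀ (by positivity)]
  calc (Real.exp K)⁻¹ / 4 * ‖1 - conj v * w‖ ^ 2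
      ≤ (Real.exp K)⁻¹ / 4 * (4 * Real.exp K * (1 - ‖v‖ ^ 2) ^ 2) := by
        gcongr
    _ = (1 - ‖v‖ ^ 2) * (1 - ‖v‖ ^ 2) := by
        have := Real.exp_pos K
        field_simp
    _ ≤ _ := by gcongr

section

/-- The bound for the distance to a geodesic in terms of harmonic measure. -/
def nearC : ℝ := 256 * Real.exp (2 * hdK + 1)

theorem nearC_pos : 0 < nearC := mul_pos (by norm_num) (Real.exp_pos _)

theorem hd_zero_le_of_le {v : ℂ} (hv : v ∈ ball (0:ℂ) 1) {c : ℝ} (h : 1 ≤ c * (1 - ‖v‖ ^ 2)) :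
    hd 0 v ≤ 2 * c := by
  have hc : Real.cosh (hd 0 v / 2) = 1 / dw v := by
    rw [cosh_hd zero_mem_disc hv]
    simp [dw]
  have h1 := dw_pos hv
  rw [← dw_sq hv] at h
  have h2 : Real.cosh (hd 0 v / 2) ^ 2 ≤ c := by
    rw [hc, div_pow, one_pow, div_le_iff₀ (by positivity)]
    exact h
  have h3 := Real.self_le_sinh_iff.2 (show 0 ≤ hd 0 v / 2 by have := hd_nonneg 0 v; positivity)
  have h4 := Real.sinh_lt_cosh (hd 0 v / 2)
  have h5 := Real.one_le_cosh (hd 0 v / 2)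
  nlinarith

variable {Ω : Set ℂ} {lam : ℂ → ℝ} {p s : ℂ → ℂ}

namespace Chart

/-- Points which see the interval `[x, y]` with harmonic measure far from `0` and `1` are near
the geodesic joining its end points. -/
theorem exists_near_trace (h : Chart Ω lam p s) {x y : ℝ} (hx : (x:ℂ) ∈ Ω) (hy : (y:ℂ) ∈ Ω)
    (hxy : x < y) {γ : ℝ → ℂ} (hγ : UpperGeodesic p s x y γ) {u : ℂ} (hu : 0 < u.im)
    (h1 : 1 / 8 ≤ (ang x y u).re) (h2 : (ang x y u).re ≤ 7 / 8) :
    ∃ v ∈ trace p s x y γ, hd (s u) (s v) ≤ nearC := by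
  by_cases huT : u ∈ trace p s x y γ
  · exact ⟨u, huT, by rw [hd_self]; exact nearC_pos.le⟩
  obtain ⟨n, hn⟩ := h.exists_isWinding hx hy hxy hγ
  have hT := (h.isCompact_trace hγ).isClosed
  have hU : ∀ w : ℂ, 0 < w.im → w ∈ Ω := fun w hw => h.nonreal w hw.ne'
  have hsu := h.smem u (hU u hu) hu.le
  have hnsu := neg_mem_disc hsu
  obtain ⟨v, hvT, hv⟩ := exists_nearest hγ hsu
  refine ⟨v, hvT, ?_⟩
  set τ : ℂ → ℂ := fun w => mob (-(s u)) (s w)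
  have hτm : ∀ w ∈ Ω, 0 ≤ w.im → τ w ∈ ball (0:ℂ) 1 := fun w hw hwi =>
    mob_mem hnsu (h.smem w hw hwi)
  have hτu : τ u = 0 := mob_neg_self _
  have hτd : ∀ w ∈ Ω, 0 ≤ w.im → DifferentiableAt ℂ τ w := fun w hw hwi =>
    DifferentiableAt.fun_comp' w (hasDerivAt_mob hnsu (h.smem w hw hwi)).differentiableAt
      (h.sdiff w hw hwi)
  have hτh : ∀ z ∈ Ω, 0 ≤ z.im → ∀ w ∈ Ω, 0 ≤ w.im → hd (τ z) (τ w) = hd (s z) (s w) :=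
    fun z hz hzi w hw hwi => hd_mob hnsu (h.smem z hz hzi) (h.smem w hw hwi)
  obtain ⟨hvΩ, hvi, -⟩ := h.trace_subset hγ hvT
  have hvm := hτm v hvΩ hvi
  have hd0 : ∀ w ∈ Ω, 0 ≤ w.im → hd 0 (τ w) = hd (s u) (s w) := fun w hw hwi => by
    rw [← hτu, hτh u (hU u hu) hu.le w hw hwi]
  set c : ℝ := 8 * Real.exp (2 * hdK + 1) with hc
  have hc0 : 0 < c := by positivity
  set k : ℂ → ℂ := fun w => (c : ℂ) * kern (τ v) (τ w)
  have hkd : ∀ w ∈ Ω, 0 ≤ w.im → DifferentiableAt ℂ k w := fun w hw hwi =>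
    (DifferentiableAt.fun_comp' w ((differentiableOn_kern hvm).differentiableAt
      (isOpen_ball.mem_nhds (hτm w hw hwi))) (hτd w hw hwi)).const_mul _
  have hkre : ∀ w, (k w).re = c * (kern (τ v) (τ w)).re := fun w => re_ofReal_mul _ _
  have hkU : DifferentiableOn ℂ k {w | 0 < w.im} := fun w hw =>
    (hkd w (hU w hw) (le_of_lt hw)).differentiableWithinAt
  have hk0 : ∀ w : ℂ, 0 < w.im → 0 ≤ (k w).re := fun w hw => by
    rw [hkre]
    exact mul_nonneg hc0.le (kern_re_nonneg hvm (hτm w (hU w hw) hw.le))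
  have hkT : ∀ a ∈ trace p s x y γ, ∀ᶠ w in 𝓝[{w | 0 < w.im}] a, 1 ≤ (k w).re := by
    intro a ha
    obtain ⟨haΩ, hai, -⟩ := h.trace_subset hγ ha
    have hca : ContinuousAt (fun w => (k w).re) a :=
      continuous_re.continuousAt.comp (hkd a haΩ hai).continuousAt
    have hka : 1 < (k a).re := by
      have := le_kern_re hvm (hτm a haΩ hai) (K := 2 * hdK + 1)
        (by rw [hd0 a haΩ hai, hd0 v hvΩ hvi, hτh v hvΩ hvi a haΩ hai]; exact hv a ha)
      rw [hkre]
      have e : c * (Real.exp (-(2 * hdK + 1)) / 4) = 2 := by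
        rw [hc, Real.exp_neg]
        have := Real.exp_pos (2 * hdK + 1)
        field_simp
        norm_num
      nlinarith
    filter_upwards [nhdsWithin_le_nhds (hca.eventually (lt_mem_nhds hka))] with w hw using hw.le
  have hxT : (x:ℂ) ∈ trace p s x y γ := h.left_mem_trace hx (by simp) hγ
  have hyT : (y:ℂ) ∈ trace p s x y γ := h.right_mem_trace hy (by simp) hγ
  have hcase : ∀ a : ℝ, (a:ℂ) ∉ trace p s x y γ → (x < a ∧ a < y) ∨ (a < x ∨ y < a) := by
    intro a ha
    rcases lt_trichotomy a x with g | rfl | g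
    · exact Or.inr (Or.inl g)
    · exact absurd hxT ha
    · rcases lt_trichotomy a y with g' | rfl | g'
      · exact Or.inl ⟨g, g'⟩
      · exact absurd hyT ha
      · exact Or.inr (Or.inr g')
  have hang := differentiableOn_ang hxy
  have hku : (1:ℝ) / 16 ≤ (k u).re := by
    by_cases hnu : n u = 1
    · have := re_le_add_of_winding hn hT (t := fun w => 1 - ang x y w) (hang.const_sub _)
        hkU hu huT (fun w hw => by simpa using ang_re_nonneg hxy hw.le) hk0 hkT
        (ε := 1 / 16) (by norm_num) ?_ ?_
      · simp only [sub_re, one_re] at this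
        linarith
      · intro a haT hna
        rcases hcase a haT with g | g
        · filter_upwards [eventually_ang_inner g.1 g.2 (ε := 1 / 16) (by norm_num)] with w hw
          simp only [sub_re, one_re]
          linarith
        · rw [hn.outer a g haT, hnu] at hna
          norm_num at hna
      · have := hn.inf
        rw [eventually_inf_principal] at this ⊢
        filter_upwards [this] with w hw hwi hnw
        rw [hw (le_of_lt hwi), hnu] at hnw
        norm_num at hnw
    · have := re_le_add_of_winding hn hT (t := ang x y) hang
        hkU hu huT (fun w _ => ang_re_le_one x y w) hk0 hkT (ε := 1 / 16) (by norm_num) ?_ ?_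
      · linarith
      · intro a haT hna
        rcases hcase a haT with g | g
        · rw [hn.inner a g.1 g.2 haT] at hna
          exact absurd hna.symm hnu
        · filter_upwards [eventually_ang_outer hxy g (ε := 1 / 16) (by norm_num)] with w hw
          exact hw.le
      · filter_upwards [inf_le_left (a := cocompact ℂ)
          (eventually_ang_cocompact x y (ε := 1 / 16) (by norm_num))] with w hw _
        exact le_of_lt hw
  rw [hkre, hτu, kern_zero_re] at hku
  rw [← hd0 v hvΩ hvi]
  have := hd_zero_le_of_le hvm (c := 16 * c) (by linarith)
  rw [nearC]
  linarith

end Chart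

end

section

/-- A function whose real part is harmonic on the disc, and small at the points near the lower
half of the circle and near `±1`. -/
def cap (ζ : ℂ) : ℂ := -I * ζ + (1 - ζ ^ 2) / 2

theorem cap_re (ζ : ℂ) : (cap ζ).re = ζ.im + (1 - ζ.re ^ 2 + ζ.im ^ 2) / 2 := by
  have : (1 - ζ ^ 2) / 2 = (1 - ζ ^ 2) / ((2:ℝ):ℂ) := by norm_num
  rw [cap, this, add_re, div_ofReal_re]
  simp [pow_two]
  ring

theorem continuous_cap : Continuous cap := by unfold cap; fun_prop

theorem norm_sq_eq (ζ : ℂ) : ‖ζ‖ ^ 2 = ζ.re ^ 2 + ζ.im ^ 2 := by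
  rw [← normSq_eq_norm_sq, normSq_apply]; ring

theorem cap_re_le_two {ζ : ℂ} (hζ : ζ ∈ ball (0:ℂ) 1) : (cap ζ).re ≤ 2 := by
  have h1 := one_sub_sq_pos hζ
  rw [norm_sq_eq] at h1
  rw [cap_re]
  nlinarith [sq_nonneg (ζ.im - 1), sq_nonneg ζ.re, sq_nonneg ζ.im]

theorem cap_re_le_of_im_nonpos {ζ : ℂ} (hζ : ζ ∈ ball (0:ℂ) 1) (hi : ζ.im ≤ 0)
    (h : 4 / 5 ≤ ‖ζ‖ ^ 2) : (cap ζ).re < 1 / 4 := by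
  have h1 := one_sub_sq_pos hζ
  rw [norm_sq_eq] at h1 h
  rw [cap_re]
  have h2 : -1 ≤ ζ.im := by nlinarith [sq_nonneg ζ.re]
  nlinarith

/-- A lower bound for a positive harmonic function on the upper half plane, by comparison with
the pull back of `cap`. -/
theorem one_eighth_le {τ t : ℂ → ℂ} (hτ : DifferentiableOn ℂ τ {w | 0 < w.im})
    (hτm : ∀ w : ℂ, 0 < w.im → τ w ∈ ball (0:ℂ) 1) (ht : DifferentiableOn ℂ t {w | 0 < w.im})
    (ht0 : ∀ w : ℂ, 0 < w.im → 0 ≤ (t w).re) {u : ℂ} (hu : 0 < u.im) (hτu : τ u = 0)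
    (hr : ∀ a : ℝ, (∀ᶠ w in 𝓝[{w | 0 < w.im}] (a:ℂ), 7 / 8 ≤ (t w).re) ∨
      ∀ᶠ w in 𝓝[{w | 0 < w.im}] (a:ℂ), (cap (τ w)).re ≤ 1 / 4)
    (hinf : ∀ᶠ w in cocompact ℂ ⊓ 𝓟 {w | 0 < w.im}, 7 / 8 ≤ (t w).re ∨ (cap (τ w)).re ≤ 1 / 4) :
    1 / 8 ≤ (t u).re := by
  have hre : ∀ w, ((cap (τ w) - (1 / 4 : ℝ)) / (2:ℝ) - t w).re =
      ((cap (τ w)).re - 1 / 4) / 2 - (t w).re := fun w => by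
    rw [sub_re, div_ofReal_re, sub_re, ofReal_re]
  have hd : DifferentiableOn ℂ (fun w => (cap (τ w) - (1 / 4 : ℝ)) / (2:ℝ) - t w)
      {w | 0 < w.im} := by
    unfold cap
    fun_prop
  have hself : ∀ a : ℂ, ∀ᶠ w in 𝓝[{w | 0 < w.im}] a, w ∈ {w : ℂ | 0 < w.im} := fun a =>
    self_mem_nhdsWithin
  have := re_nonpos_of_frontier isOpen_upper hd ?_ ?_ hu
  · rw [hre, hτu, cap_re] at this
    simp at this
    linarith
  · intro z hz
    rw [frontier_setOfPred_lt_im] at hz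
    have hz0 : z.im = 0 := hz
    have hza : z = (z.re : ℂ) := Complex.ext (by simp) (by simp [hz0])
    rw [hza]
    simp only [hre]
    rcases hr z.re with h | h
    · filter_upwards [h, hself _] with w h1 h2
      linarith [cap_re_le_two (hτm w h2)]
    · filter_upwards [h, hself _] with w h1 h2
      linarith [ht0 w h2]
  · simp only [hre]
    rw [eventually_inf_principal] at hinf ⊢
    filter_upwards [hinf] with w hw hwi
    rcases hw hwi with h | h
    · linarith [cap_re_le_two (hτm w hwi)]
    · linarith [ht0 w hwi]

/-- Two points on the same side of the real line are closer than one of them and the mirror image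
of the other one. -/
theorem hd_lt_hd_conj {a b : ℂ} (ha : a ∈ ball (0:ℂ) 1) (hb : b ∈ ball (0:ℂ) 1)
    (h : 0 < a.im * b.im) : hd a b < hd a (conj b) := by
  have h1 := dw_pos ha
  have h2 := dw_pos hb
  have h3 : dw (conj b) = dw b := by simp [dw]
  have h4 : ‖a - b‖ < ‖a - conj b‖ := by
    refine lt_of_pow_lt_pow_left₀ 2 (norm_nonneg _) ?_
    rw [norm_sq_eq, norm_sq_eq]
    simp
    nlinarith
  rw [hd, hd, h3]
  have := Real.arsinh_strictMono (div_lt_div_of_pos_right h4 (mul_pos h1 h2))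
  linarith

theorem im_ne_zero_of_between {a b m : ℂ} (ha : a ∈ ball (0:ℂ) 1) (hb : b ∈ ball (0:ℂ) 1)
    (hm : m ∈ ball (0:ℂ) 1) (hab : 0 < a.im * b.im) (h : hd a m + hd m b ≤ hd a b) :
    m.im ≠ 0 := by
  intro h0
  have hb' : conj b ∈ ball (0:ℂ) 1 := by simpa using hb
  have h1 := hd_triangle ha hm hb'
  have h2 : hd m (conj b) = hd m b := by
    conv_lhs => rw [← conj_eq_iff_im.2 h0]
    simp only [hd, dw, norm_conj, ← map_sub]
  linarith [hd_lt_hd_conj ha hb hab]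

theorem four_fifths_le {ζ : ℂ} (hζ : ζ ∈ ball (0:ℂ) 1) (h : 2 * Real.arsinh 2 < hd 0 ζ) :
    4 / 5 ≤ ‖ζ‖ ^ 2 := by
  have h1 := dw_pos hζ
  have h2 := dw_sq hζ
  rw [hd_zero_left] at h
  have h3 := Real.arsinh_lt_arsinh.1 (lt_of_mul_lt_mul_left h zero_le_two)
  rw [lt_div_iff₀ h1] at h3
  nlinarith

variable {Ω : Set ℂ} {lam : ℂ → ℝ} {p s : ℂ → ℂ}

/-- A section of the covering, moved so that the geodesic `T` becomes real. -/
structure Straightening (Ω T : Set ℂ) (s τ : ℂ → ℂ) : Prop where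
  mem : ∀ w ∈ Ω, 0 ≤ w.im → τ w ∈ ball (0:ℂ) 1
  diff : ∀ w ∈ Ω, 0 ≤ w.im → DifferentiableAt ℂ τ w
  isom : ∀ z ∈ Ω, 0 ≤ z.im → ∀ w ∈ Ω, 0 ≤ w.im → hd (τ z) (τ w) = hd (s z) (s w)
  real : ∀ w ∈ T, (τ w).im = 0

namespace Chart

theorem winding_eq (h : Chart Ω lam p s) {x y : ℝ} {T : Set ℂ} {n : ℂ → ℝ}
    (hn : IsWinding x y T n) {τ : ℂ → ℂ} (hτ : Straightening Ω T s τ) {z w : ℂ} (hz : z ∈ Ω)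
    (hw : w ∈ Ω) (hzi : 0 ≤ z.im) (hwi : 0 ≤ w.im) (hzw : 0 < (τ z).im * (τ w).im) :
    n z = n w := by
  obtain ⟨γ, hγ⟩ := h.exists_upperGeodesic hz hw hzi hwi
  have hl := hd_nonneg (s z) (s w)
  set f : Icc 0 (hd (s z) (s w)) → ℝ := fun t => n (p (γ t)) with hf
  have hloc : IsLocallyConstant f := by
    rw [IsLocallyConstant.iff_eventually_eq]
    intro t
    obtain ⟨hmΩ, hmi, hmb⟩ := h.trace_subset hγ ⟨t, t.2, rfl⟩
    have hnT : p (γ t) ∉ T := fun hT => by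
      refine im_ne_zero_of_between (hτ.mem z hz hzi) (hτ.mem w hw hwi) (hτ.mem _ hmΩ hmi) hzw ?_
        (hτ.real _ hT)
      rw [hτ.isom z hz hzi _ hmΩ hmi, hτ.isom _ hmΩ hmi w hw hwi, hτ.isom z hz hzi w hw hwi]
      exact hmb
    have hc : Tendsto (fun t : Icc 0 (hd (s z) (s w)) => p (γ t)) (𝓝 t)
        (𝓝[{z | 0 ≤ z.im}] p (γ t)) := by
      refine tendsto_nhdsWithin_iff.2 ⟨?_, Eventually.of_forall fun t => (hγ.upper t t.2).1⟩
      exact ((h.contDiff_trace hγ).continuous.comp continuous_subtype_val).tendsto t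
    exact hc.eventually (hn.loc _ hmi hnT)
  have : PreconnectedSpace (Icc 0 (hd (s z) (s w))) :=
    Subtype.preconnectedSpace isPreconnected_Icc
  have e := hloc.apply_eq_of_preconnectedSpace ⟨0, left_mem_Icc.2 hl⟩ ⟨_, right_mem_Icc.2 hl⟩
  simp only [hf, hγ.left, hγ.right, h.p_s hz hzi, h.p_s hw hwi] at e
  exact e

theorem exists_im_ne_zero (h : Chart Ω lam p s) {x y : ℝ} {T : Set ℂ} {n : ℂ → ℝ}
    (hn : IsWinding x y T n) {τ : ℂ → ℂ} (hτ : Straightening Ω T s τ) {a : ℝ}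
    (ha : (a:ℂ) ∉ T) : ∃ w : ℂ, 0 < w.im ∧ n w = n a ∧ (τ w).im ≠ 0 := by
  have hU : ∀ w : ℂ, 0 < w.im → w ∈ Ω := fun w hw => h.nonreal w hw.ne'
  obtain ⟨O, O1, O2, O3⟩ := mem_nhdsWithin.1 (hn.loc a (by simp) ha)
  have hacl : (a:ℂ) ∈ closure {w : ℂ | 0 < w.im} := by
    rw [closure_setOfPred_lt_im]; simp
  obtain ⟨w₀, hw₀, hw₀i⟩ := mem_closure_iff.1 hacl O O1 O2
  have hw₀i' : 0 < w₀.im := hw₀i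
  by_contra! hcon
  have hN : ∀ᶠ w in 𝓝 w₀, 0 < w.im ∧ (τ w).im = 0 := by
    filter_upwards [O1.mem_nhds hw₀, isOpen_upper.mem_nhds hw₀i] with w w1 w2
    have w2' : 0 < w.im := w2
    exact ⟨w2, hcon w w2 (O3 ⟨w1, (w2'.le : (0:ℝ) ≤ w.im)⟩)⟩
  have han : AnalyticAt ℂ τ w₀ := by
    refine DifferentiableOn.analyticAt (s := {w | 0 < w.im}) (fun w hw => ?_)
      (isOpen_upper.mem_nhds hw₀i)
    exact (hτ.diff w (hU w hw) (le_of_lt hw)).differentiableWithinAt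
  rcases han.eventually_constant_or_nhds_le_map_nhds with h1 | h1
  · have h2 : ∀ᶠ w in 𝓝 w₀, w = w₀ := by
      filter_upwards [h1, hN] with w w1 w2
      have w3 := w2.1
      have e := hτ.isom w (hU w w3) w3.le w₀ (hU w₀ hw₀i') hw₀i'.le
      rw [w1, hd_self] at e
      have e2 := eq_of_hd_le_zero (h.smem w (hU w w3) w3.le) (h.smem w₀ (hU w₀ hw₀i') hw₀i'.le) e.ge
      rw [← h.p_s (hU w w3) w3.le, e2, h.p_s (hU w₀ hw₀i') hw₀i'.le]
    have h3 : ∀ᶠ w in 𝓝[≠] w₀, w = w₀ := nhdsWithin_le_nhds h2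
    obtain ⟨w, w1, w2⟩ := (h3.and eventually_mem_nhdsWithin).exists
    exact w2 w1
  · have h2 : ∀ᶠ ζ in 𝓝 (τ w₀), ζ.im = 0 := h1 (by
      rw [mem_map]
      filter_upwards [hN] with w hw using hw.2)
    have h3 : Tendsto (fun r : ℝ => τ w₀ + r * I) (𝓝[≠] 0) (𝓝 (τ w₀)) := by
      have : Continuous fun r : ℝ => τ w₀ + r * I := by fun_prop
      have h4 := this.tendsto 0
      simp only [ofReal_zero, zero_mul, add_zero] at h4
      exact h4.mono_left nhdsWithin_le_nhds
    have h0 := hN.self_of_nhds.2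
    obtain ⟨r, hr1, hr2⟩ := ((h3.eventually h2).and eventually_mem_nhdsWithin).exists
    simp [h0] at hr1
    exact hr2 hr1

/-- The winding number is determined by the side of the geodesic. -/
theorem exists_sign (h : Chart Ω lam p s) {x y : ℝ} {T : Set ℂ} (hT : IsCompact T)
    {n : ℂ → ℝ} (hn : IsWinding x y T n) {τ : ℂ → ℂ} (hτ : Straightening Ω T s τ) {a : ℝ}
    (hxa : x < a) (hay : a < y) (ha : (a:ℂ) ∉ T) :
    ∃ e : ℝ, e ^ 2 = 1 ∧ ∀ w ∈ Ω, 0 ≤ w.im →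
      (n w = 0 → e * (τ w).im ≤ 0) ∧ (n w = 1 → 0 ≤ e * (τ w).im) := by
  have hU : ∀ w : ℂ, 0 < w.im → w ∈ Ω := fun w hw => h.nonreal w hw.ne'
  obtain ⟨R, hR⟩ := hT.isBounded.exists_norm_le
  set b : ℝ := min (-R - 1) (x - 1)
  have hbT : (b:ℂ) ∉ T := fun hbT => by
    have h1 := hR _ hbT
    rw [norm_real, Real.norm_eq_abs] at h1
    have h2 := neg_abs_le b
    have h3 : b ≤ -R - 1 := min_le_left _ _
    linarith
  obtain ⟨w₁, p1, p2, p3⟩ := h.exists_im_ne_zero hn hτ ha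
  obtain ⟨w₀, q1, q2, q3⟩ := h.exists_im_ne_zero hn hτ hbT
  rw [hn.inner a hxa hay ha] at p2
  rw [hn.outer b (Or.inl (by linarith [min_le_right (-R - 1) (x - 1)])) hbT] at q2
  have hne : (τ w₀).im * (τ w₁).im < 0 := by
    rcases lt_or_gt_of_ne (mul_ne_zero q3 p3) with g | g
    · exact g
    · have := h.winding_eq hn hτ (hU _ q1) (hU _ p1) q1.le p1.le g
      rw [p2, q2] at this
      norm_num at this
  have key0 : ∀ w ∈ Ω, 0 ≤ w.im → n w = 0 → (τ w).im * (τ w₁).im ≤ 0 := by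
    intro w hw hwi h0
    by_contra! g
    have := h.winding_eq hn hτ hw (hU _ p1) hwi p1.le g
    rw [p2, h0] at this
    norm_num at this
  have key1 : ∀ w ∈ Ω, 0 ≤ w.im → n w = 1 → (τ w).im * (τ w₀).im ≤ 0 := by
    intro w hw hwi h0
    by_contra! g
    have := h.winding_eq hn hτ hw (hU _ q1) hwi q1.le g
    rw [q2, h0] at this
    norm_num at this
  rcases lt_or_gt_of_ne p3 with g | g
  · refine ⟨-1, by norm_num, fun w hw hwi => ⟨fun h0 => ?_, fun h0 => ?_⟩⟩
    · nlinarith [key0 w hw hwi h0]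
    · have : 0 < (τ w₀).im := by nlinarith
      nlinarith [key1 w hw hwi h0]
  · refine ⟨1, by norm_num, fun w hw hwi => ⟨fun h0 => ?_, fun h0 => ?_⟩⟩
    · nlinarith [key0 w hw hwi h0]
    · have : (τ w₀).im < 0 := by nlinarith
      nlinarith [key1 w hw hwi h0]

end Chart

end

section

variable {Ω : Set ℂ} {lam : ℂ → ℝ} {p s : ℂ → ℂ}

namespace Chart

/-- Points of a geodesic with real end points which are far from the real points of the domain
see the interval between the end points with harmonic measure far from `0` and `1`. -/
theorem ang_bounds (h : Chart Ω lam p s) {x y : ℝ} (hx : (x:ℂ) ∈ Ω) (hy : (y:ℂ) ∈ Ω)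
    (hxy : x < y) {u : ℂ} (hu : 0 < u.im)
    (hb : hd (s x) (s u) + hd (s u) (s y) ≤ hd (s x) (s y))
    (hfar : ∀ b : ℝ, (b:ℂ) ∈ Ω → 2 * Real.arsinh 2 < hd (s u) (s b)) :
    1 / 8 ≤ (ang x y u).re ∧ (ang x y u).re ≤ 7 / 8 := by
  have hU : ∀ w : ℂ, 0 < w.im → w ∈ Ω := fun w hw => h.nonreal w hw.ne'
  have hsx := h.smem x hx (by simp)
  have hsy := h.smem y hy (by simp)
  have hsu := h.smem u (hU u hu) hu.le
  have hxu : s x ≠ s u := fun he => by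
    have := hfar x hx
    rw [he, hd_self] at this
    linarith [Real.arsinh_nonneg_iff.2 zero_le_two]
  obtain ⟨M, M1, M2, M3, M4, M5, M6⟩ := exists_normalise hsx hsy hsu hxu hb
  obtain ⟨γ, hγ⟩ := h.exists_upperGeodesic hx hy (by simp) (by simp)
  obtain ⟨n, hn⟩ := h.exists_isWinding hx hy hxy hγ
  set T := trace p s x y γ with hTdef
  have hTc := h.isCompact_trace hγ
  have hxT : (x:ℂ) ∈ T := h.left_mem_trace hx (by simp) hγ
  have hyT : (y:ℂ) ∈ T := h.right_mem_trace hy (by simp) hγ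
  have hτ : Straightening Ω T s (fun w => M (s w)) := by
    refine ⟨fun w hw hwi => M2 _ (h.smem w hw hwi), fun w hw hwi => ?_, fun z hz hzi w hw hwi =>
      M4 _ (h.smem z hz hzi) _ (h.smem w hw hwi), fun w hw => ?_⟩
    · exact DifferentiableAt.fun_comp' w (M1.differentiableAt
        (isOpen_ball.mem_nhds (h.smem w hw hwi))) (h.sdiff w hw hwi)
    · obtain ⟨w1, w2, w3⟩ := h.trace_subset hγ hw
      have hsw := h.smem w w1 w2
      refine im_eq_zero_of_real_between (M2 _ hsx) (M2 _ hsy) (M2 _ hsw) M5 M6 ?_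
      rwa [M4 _ hsx _ hsw, M4 _ hsw _ hsy, M4 _ hsx _ hsy]
  set τ : ℂ → ℂ := fun w => M (s w)
  have hτu : τ u = 0 := M3
  obtain ⟨a₀, ha1, ha2, ha3⟩ : ∃ a : ℝ, x < a ∧ a < y ∧ (a:ℂ) ∉ T := by
    by_contra! hcon
    refine hu.ne' (h.im_eq_zero_of_between (x := x) (y := y) (fun r hr => ?_) (hU u hu) hu.le ?_)
    · rw [uIcc_of_le hxy.le] at hr
      rcases hr.1.eq_or_lt with rfl | g1
      · exact hx
      rcases hr.2.eq_or_lt with rfl | g2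
      · exact hy
      exact (h.trace_subset hγ (hcon r g1 g2)).1
    · rwa [ed_of_nonneg (by simp) hu.le, ed_of_nonneg hu.le (by simp),
        ed_of_nonneg (by simp) (by simp)]
  obtain ⟨e, he, hsign⟩ := h.exists_sign hTc hn hτ ha1 ha2 ha3
  have hnorm : ∀ w ∈ Ω, 0 ≤ w.im → 2 * Real.arsinh 2 < hd (s u) (s w) → 4 / 5 ≤ ‖τ w‖ ^ 2 := by
    intro w hw hwi hlt
    refine four_fifths_le (hτ.mem w hw hwi) ?_
    rwa [← hτu, hτ.isom u (hU u hu) hu.le w hw hwi]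
  have hmul : ∀ {c : ℝ}, c ^ 2 = 1 → ∀ w, ‖(c:ℂ) * τ w‖ = ‖τ w‖ := by
    intro c hc w
    rw [norm_mul, norm_real, Real.norm_eq_abs, (sq_eq_sq₀ (abs_nonneg c) zero_le_one).1
      (by rw [sq_abs, hc, one_pow]), one_mul]
  have hmulm : ∀ {c : ℝ}, c ^ 2 = 1 → ∀ w ∈ Ω, 0 ≤ w.im → (c:ℂ) * τ w ∈ ball (0:ℂ) 1 := by
    intro c hc w hw hwi
    rw [mem_ball_zero_iff, hmul hc]
    exact mem_ball_zero_iff.1 (hτ.mem w hw hwi)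
  have hdiff : ∀ c : ℝ, DifferentiableOn ℂ (fun w => (c:ℂ) * τ w) {w | 0 < w.im} :=
    fun c w hw => ((hτ.diff w (hU w hw) (le_of_lt hw)).const_mul _).differentiableWithinAt
  have hcapT : ∀ {c : ℝ}, c ^ 2 = 1 → ∀ a : ℝ, (a:ℂ) ∈ T →
      ∀ᶠ w in 𝓝[{w | 0 < w.im}] (a:ℂ), (cap (c * τ w)).re ≤ 1 / 4 := by
    intro c hc a ha
    obtain ⟨haΩ, hai, -⟩ := h.trace_subset hγ ha
    have hca : ContinuousAt (fun w => (cap (c * τ w)).re) (a:ℂ) :=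
      (continuous_re.comp continuous_cap).continuousAt.comp
        ((hτ.diff _ haΩ hai).const_mul (c:ℂ)).continuousAt
    have hlt : (cap (c * τ a)).re < 1 / 4 := by
      refine cap_re_le_of_im_nonpos (hmulm hc _ haΩ hai) (by simp [hτ.real _ ha]) ?_
      rw [hmul hc]
      exact hnorm _ haΩ hai (hfar a haΩ)
    filter_upwards [nhdsWithin_le_nhds (hca.eventually (gt_mem_nhds hlt))] with w hw using le_of_lt hw
  have hcapn : ∀ {c : ℝ}, c ^ 2 = 1 → ∀ w : ℂ, 0 < w.im → c * (τ w).im ≤ 0 →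
      2 * Real.arsinh 2 < hd (s u) (s w) → (cap (c * τ w)).re ≤ 1 / 4 := by
    intro c hc w hw hcw hlt
    refine (cap_re_le_of_im_nonpos (hmulm hc _ (hU w hw) hw.le) (by simpa using hcw) ?_).le
    rw [hmul hc]
    exact hnorm _ (hU w hw) hw.le hlt
  have hnear : ∀ a : ℝ, (a:ℂ) ∉ T →
      ∀ᶠ w in 𝓝[{w | 0 < w.im}] (a:ℂ), n w = n a ∧ 0 < w.im ∧
        2 * Real.arsinh 2 < hd (s u) (s w) := by
    intro a ha
    have e1 := (hn.loc a (by simp) ha).filter_mono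
      (nhdsWithin_mono _ (fun w hw => (le_of_lt hw : (0:ℝ) ≤ w.im) :
        {w : ℂ | 0 < w.im} ⊆ {w | 0 ≤ w.im}))
    filter_upwards [e1, h.eventually_far hsu hfar a, self_mem_nhdsWithin] with w h1 h2 h3
    exact ⟨h1, h3, h2⟩
  have hfinf : ∀ᶠ w in cocompact ℂ ⊓ 𝓟 {w | 0 < w.im}, n w = 0 ∧ 0 < w.im ∧
      2 * Real.arsinh 2 < hd (s u) (s w) := by
    have e1 := hn.inf
    have e2 := h.eventually_far_cocompact hsu (2 * Real.arsinh 2)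
    rw [eventually_inf_principal] at e1 e2 ⊢
    filter_upwards [e1, e2] with w h1 h2 hwi
    exact ⟨h1 (le_of_lt hwi), hwi, h2 hwi⟩
  have hcase : ∀ a : ℝ, (a:ℂ) ∉ T → (x < a ∧ a < y) ∨ (a < x ∨ y < a) := by
    intro a ha
    rcases lt_trichotomy a x with g | rfl | g
    · exact Or.inr (Or.inl g)
    · exact absurd hxT ha
    · rcases lt_trichotomy a y with g' | rfl | g'
      · exact Or.inl ⟨g, g'⟩
      · exact absurd hyT ha
      · exact Or.inr (Or.inr g')
  have hang := differentiableOn_ang hxy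
  constructor
  · refine one_eighth_le (hdiff e) (fun w hw => hmulm he w (hU w hw) hw.le) hang
      (fun w hw => ang_re_nonneg hxy hw.le) hu (by simp [hτu]) (fun a => ?_) ?_
    · by_cases haT : (a:ℂ) ∈ T
      · exact Or.inr (hcapT he a haT)
      · rcases hcase a haT with g | g
        · left
          filter_upwards [eventually_ang_inner g.1 g.2 (ε := 1 / 8) (by norm_num)] with w hw
          linarith
        · right
          filter_upwards [hnear a haT] with w hw
          refine hcapn he w hw.2.1 ((hsign w (hU w hw.2.1) hw.2.1.le).1 ?_) hw.2.2
          rw [hw.1, hn.outer a g haT]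
    · filter_upwards [hfinf] with w hw
      exact Or.inr (hcapn he w hw.2.1 ((hsign w (hU w hw.2.1) hw.2.1.le).1 hw.1) hw.2.2)
  · have he' : (-e) ^ 2 = 1 := by rw [neg_sq, he]
    have key : 1 / 8 ≤ (1 - ang x y u).re := by
      refine one_eighth_le (hdiff (-e)) (fun w hw => hmulm he' w (hU w hw) hw.le)
        (hang.const_sub 1) (fun w hw => ?_) hu (by simp [hτu]) (fun a => ?_) ?_
      · rw [sub_re, one_re]
        linarith [ang_re_le_one x y w]
      · by_cases haT : (a:ℂ) ∈ T
        · exact Or.inr (hcapT he' a haT)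
        · rcases hcase a haT with g | g
          · right
            filter_upwards [hnear a haT] with w hw
            refine hcapn he' w hw.2.1 ?_ hw.2.2
            have := (hsign w (hU w hw.2.1) hw.2.1.le).2 (by rw [hw.1, hn.inner a g.1 g.2 haT])
            linarith
          · left
            filter_upwards [eventually_ang_outer hxy g (ε := 1 / 8) (by norm_num)] with w hw
            rw [sub_re, one_re]
            linarith
      · filter_upwards [(eventually_ang_cocompact x y (ε := 1 / 8) (by norm_num)).filter_mono
          inf_le_left] with w hw
        left
        rw [sub_re, one_re]
        linarith
    rw [sub_re, one_re] at key
    linarith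

end Chart

end

section

theorem IsDenjoyDomain.subset_of_isPreconnected {Ω U : Set ℂ} (hΩ : IsDenjoyDomain Ω)
    (hU : IsPreconnected U) (him : ∀ z ∈ U, z.im ≠ 0) (hne : (U ∩ Ω).Nonempty) : U ⊆ Ω := by
  refine hU.subset_left_of_subset_union hΩ.1 isClosed_closure.isOpen_compl
    (disjoint_compl_right.mono_left subset_closure) (fun z hz => ?_) hne
  by_cases hc : z ∈ closure Ω
  · by_contra hcon
    exact him z hz (hΩ.2.2 ⟨hc, fun hi => hcon (Or.inl (interior_subset hi))⟩)
  · exact Or.inr hc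

theorem IsDenjoyDomain.mem_of_im_ne_zero {Ω : Set ℂ} (hΩ : IsDenjoyDomain Ω) {r : ℝ}
    (hr : (r:ℂ) ∈ Ω) (z : ℂ) (hz : z.im ≠ 0) : z ∈ Ω := by
  obtain ⟨ε, hε, hball⟩ := Metric.isOpen_iff.1 hΩ.1 r hr
  have hmem : ∀ c : ℝ, |c| = ε / 2 → (r:ℂ) + c * I ∈ Ω := fun c hc => hball <| by
    rw [mem_ball, dist_eq, add_sub_cancel_left, norm_mul, norm_I, mul_one, norm_real,
      Real.norm_eq_abs, hc]
    exact half_lt_self hε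
  rcases hz.lt_or_gt with h | h
  · refine hΩ.subset_of_isPreconnected (convex_halfSpace_im_lt 0).isPreconnected
      (fun w hw => ne_of_lt hw) ⟨(r:ℂ) + (-(ε / 2) : ℝ) * I, ?_, hmem _ ?_⟩ h
    · simpa using hε
    · rw [abs_neg, abs_of_pos (half_pos hε)]
  · refine hΩ.subset_of_isPreconnected (convex_halfSpace_im_gt 0).isPreconnected
      (fun w hw => ne_of_gt hw) ⟨(r:ℂ) + (ε / 2 : ℝ) * I, ?_, hmem _ ?_⟩ h
    · simpa using hε
    · rw [abs_of_pos (half_pos hε)]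

variable {Ω : Set ℂ} {lam : ℂ → ℝ} {p s : ℂ → ℂ}

/-- In a hyperbolic domain the points of a geodesic with real end points are close to the real
points of the domain, as one sees from the bigon which it forms with its mirror image. -/
theorem Chart.exists_real_near (h : Chart Ω lam p s) {δ : ℝ}
    (hδ : GromovHyperbolicWith Ω (densityDist Ω lam) δ) {x y : ℝ} (hx : (x:ℂ) ∈ Ω)
    (hy : (y:ℂ) ∈ Ω) {γ : ℝ → ℂ} (hγ : UpperGeodesic p s x y γ) {v : ℂ}
    (hv : v ∈ trace p s x y γ) :
    ∃ b : ℝ, (b:ℂ) ∈ Ω ∧ ed s v b ≤ δ + 1 := by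
  obtain ⟨g1, g2⟩ := h.isGeodesicIn_upper hx hy (by simp) (by simp) hγ.mem hγ.left hγ.right
    hγ.isom hγ.upper
  rw [conj_ofReal, conj_ofReal] at g2
  have hxy : densityDist Ω lam x y = hd (s x) (s y) := by
    rw [h.dist_eq_of_nonneg hx hy (by simp) (by simp), ed_of_nonneg (by simp) (by simp)]
  have hyy : densityDist Ω lam y y = 0 := by
    rw [h.dist_eq_of_nonneg hy hy (by simp) (by simp), ed_of_nonneg (by simp) (by simp), hd_self]
  have g3 : IsGeodesicIn Ω (densityDist Ω lam) (fun _ => (y:ℂ)) y y := by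
    refine ⟨rfl, rfl, fun _ _ => hy, fun t ht t' ht' => ?_⟩
    rw [hyy, Icc_self, mem_singleton_iff] at ht ht'
    rw [hyy, ht, ht', sub_zero, abs_zero]
  obtain ⟨t, ht, rfl⟩ := hv
  obtain ⟨q, hq, hqδ⟩ := hδ x hx y hy y hy _ _ _ g1 g2 g3 t (by rwa [hxy])
  have hqΩ : q ∈ Ω ∧ q.im ≤ 0 := by
    rcases hq with ⟨t', ht', rfl⟩ | ⟨t', ht', rfl⟩
    · refine ⟨g2.2.2.1 t' ht', ?_⟩
      rw [hxy] at ht'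
      simpa using (hγ.upper t' ht').1
    · exact ⟨hy, by simp⟩
  have hvi := (hγ.upper t ht).1
  obtain ⟨b, hb, hbi, hle⟩ := h.exists_glue_of_opposite (h.mem (hγ.mem t)) hqΩ.1
    (mul_nonpos_of_nonneg_of_nonpos hvi hqΩ.2) one_pos
  refine ⟨b.re, ?_, ?_⟩ <;> rw [← conj_eq_iff_re.1 (conj_eq_iff_im.2 hbi)] at hb hle
  · exact hb
  · have : 0 ≤ ed s (b.re : ℂ) q := hd_nonneg _ _
    linarith

end

end

noncomputable section

/-- Theorem 1.2, Poincaré case: removing a closed subset of `(-∞, 0]` from a Denjoy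
domain containing `(-∞, 0)` preserves non-Gromov-hyperbolicity of the Poincaré metric. -/
theorem denjoy_poincare_not_hyperbolic_remove_far_side
    (Ω F : Set ℂ)
    (hΩ : IsDenjoyDomain Ω)
    (hneg : {z : ℂ | z.im = 0 ∧ z.re < 0} ⊆ Ω)
    (hFcl : IsClosed F)
    (hFsub : F ⊆ {z : ℂ | z.im = 0 ∧ z.re ≤ 0})
    (lam lam' : ℂ → ℝ)
    (hlam : IsPoincareDensity Ω lam)
    (hlam' : IsPoincareDensity (Ω \ F) lam')
    (hnot : ¬ IsGromovHyperbolic Ω (densityDist Ω lam)) :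
    ¬ IsGromovHyperbolic (Ω \ F) (densityDist (Ω \ F) lam') := by
  have hneg' : ∀ r : ℝ, r < 0 → (r:ℂ) ∈ Ω := fun r hr => hneg (by simpa using hr)
  have hnr := hΩ.mem_of_im_ne_zero (hneg' (-1) (by norm_num))
  obtain ⟨p, hp⟩ := hlam.exists_pcov hΩ.1
  obtain ⟨s, h⟩ := hp.exists_chart hnr
  obtain ⟨p', hp'⟩ := hlam'.exists_pcov (hΩ.1.sdiff hFcl)
  obtain ⟨s', h'⟩ := hp'.exists_chart fun z hz => ⟨hnr z hz, fun hF => hz (hFsub hF).1⟩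
  rintro ⟨δ, -, hδ⟩
  obtain ⟨x, y, hx, hy, hx0, hxy, u, hu, hui, hb, hfar⟩ :=
    h.exists_far hneg' hnot (max (2 * Real.arsinh 2) (nearC + (δ + 1)))
  have hpos : ∀ r : ℝ, (r:ℂ) ∈ Ω → 0 < r → (r:ℂ) ∈ Ω \ F := fun r hr h0 =>
    ⟨hr, fun hF => h0.not_ge (hFsub hF).2⟩
  have hx' := hpos x hx hx0
  have hy' := hpos y hy (hx0.trans hxy)
  have hui' : 0 < u.im := by
    refine hui.lt_of_ne' fun h0 => ?_
    have hur : u = (u.re : ℂ) := (conj_eq_iff_re.1 (conj_eq_iff_im.2 h0)).symm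
    have h1 := hfar u.re (hur ▸ hu)
    rw [← hur, Chart.ed_of_nonneg hui hui, hd_self] at h1
    linarith [le_max_left (2 * Real.arsinh 2) (nearC + (δ + 1)),
      Real.arsinh_nonneg_iff.2 zero_le_two]
  have hfar' : ∀ b : ℝ, (b:ℂ) ∈ Ω → 2 * Real.arsinh 2 < hd (s u) (s b) := fun b hbΩ => by
    rw [← Chart.ed_of_nonneg hui (by simp)]
    exact (le_max_left _ _).trans_lt (hfar b hbΩ)
  rw [Chart.ed_of_nonneg (by simp) hui, Chart.ed_of_nonneg hui (by simp),
    Chart.ed_of_nonneg (by simp) (by simp)] at hb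
  obtain ⟨h1, h2⟩ := h.ang_bounds hx hy hxy hui' hb hfar'
  obtain ⟨γ, hγ⟩ := h'.exists_upperGeodesic hx' hy' (by simp) (by simp)
  obtain ⟨v, hv, hvu⟩ := h'.exists_near_trace hx' hy' hxy hγ hui' h1 h2
  obtain ⟨b, hbΩ, hvb⟩ := h'.exists_real_near hδ hx' hy' hγ hv
  obtain ⟨hvΩ, hvi, -⟩ := h'.trace_subset hγ hv
  have hu' := h'.nonreal u hui'.ne'
  rw [← Chart.ed_of_nonneg hui hvi] at hvu
  have := h'.ed_triangle hu' hvΩ hbΩ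
  have := h.ed_mono h' sdiff_subset hu' hbΩ
  linarith [hfar b hbΩ.1, le_max_right (2 * Real.arsinh 2) (nearC + (δ + 1))]
end
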